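/- Minimal covariant basis of S₆ ⊕ S₄: for V = S₆ ⊕ S₄, the covariant algebra Cov(V) admits a minimal basis consisting of exactly 194 homogeneous covariants; equivalently, dim_ℂ (C₊ / C₊²) = 194, where C₊ is the ideal of Cov(V) spanned by the homogeneous components of positive total degree. -/

import Mathlib

noncomputable section
set_option synthInstance.maxHeartbeats 1000000
set_option maxHeartbeats 1000000
open MvPolynomial

abbrev SL2 : Type := Matrix.SpecialLinearGroup (Fin 2) ℂ
abbrev Var {ι : Type} (ν : ι → ℕ) : Type := (Σ i : ι, Fin (ν i + 1)) ⊕ Fin 2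
abbrev CoordRing {ι : Type} (ν : ι → ℕ) : Type := MvPolynomial (Var ν) ℂ
def form (n : ℕ) (a : Fin (n + 1) → ℂ) : MvPolynomial (Fin 2) ℂ :=
  ∑ i : Fin (n + 1), MvPolynomial.C (a i) * X 0 ^ (n - (i : ℕ)) * X 1 ^ (i : ℕ)
def subst2 (g : SL2) : MvPolynomial (Fin 2) ℂ →ₐ[ℂ] MvPolynomial (Fin 2) ℂ :=
  aeval fun i => ∑ j : Fin 2, MvPolynomial.C ((g⁻¹).1 i j) * X j
def coeffOf (n : ℕ) (p : MvPolynomial (Fin 2) ℂ) (i : Fin (n + 1)) : ℂ :=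
  MvPolynomial.coeff (Finsupp.single 0 (n - (i : ℕ)) + Finsupp.single 1 ((i : ℕ))) p
def coeffAct (g : SL2) (n : ℕ) (a : Fin (n + 1) → ℂ) : Fin (n + 1) → ℂ :=
  coeffOf n (subst2 g (form n a))
def ptAct {ι : Type} (ν : ι → ℕ) (g : SL2) (pt : Var ν → ℂ) : Var ν → ℂ :=
  Sum.elim
    (fun c => coeffAct g (ν c.1) (fun k => pt (Sum.inl ⟨c.1, k⟩)) c.2)
    (fun i => ∑ j : Fin 2, (g).1 i j * pt (Sum.inr j))
def Covariants {ι : Type} (ν : ι → ℕ) : Subalgebra ℂ (CoordRing ν) where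
  carrier := {p | ∀ (g : SL2) (pt : Var ν → ℂ), eval (ptAct ν g pt) p = eval pt p}
  mul_mem' := by intro a b ha hb g pt; simp only [map_mul, ha g pt, hb g pt]
  one_mem' := by intro g pt; simp
  add_mem' := by intro a b ha hb g pt; simp only [map_add, ha g pt, hb g pt]
  zero_mem' := by intro g pt; simp
  algebraMap_mem' := by intro c g pt; simp [MvPolynomial.algebraMap_eq]
def wBi {ι : Type} (ν : ι → ℕ) : Var ν → ℕ × ℕ :=
  Sum.elim (fun _ => (1, 0)) (fun _ => (0, 1))

-- new defs to test
/-- The set of covariants that are bihomogeneous of degree `d` and order `k`,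
i.e. the homogeneous component `Cov_{d,k}(V)`. -/
def CovHom {ι : Type} (ν : ι → ℕ) (d k : ℕ) : Set (CoordRing ν) :=
  {h | h ∈ Covariants ν ∧ h.IsWeightedHomogeneous (wBi ν) (d, k)}

/-- A covariant of degree `d` and order `k` is *reducible* if it belongs to the
subalgebra generated by the homogeneous covariants of degree `d' ≤ d` and order
`k' ≤ k` with `(d',k') ≠ (d,k)`. -/
def IsReducibleAt {ι : Type} (ν : ι → ℕ) (d k : ℕ) (h : CoordRing ν) : Prop :=
  h ∈ Algebra.adjoin ℂ
    {p | ∃ d' k' : ℕ, d' ≤ d ∧ k' ≤ k ∧ (d', k') ≠ (d, k) ∧ p ∈ CovHom ν d' k'}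

/-- The ideal `C₊` of `Cov(V)` spanned by the homogeneous components of positive
total degree, as a `ℂ`-submodule of `Cov(V)`. -/
def Cplus {ι : Type} (ν : ι → ℕ) : Submodule ℂ ↥(Covariants ν) :=
  Submodule.span ℂ
    {h | ∃ d k : ℕ, 0 < d + k ∧ (h : CoordRing ν).IsWeightedHomogeneous (wBi ν) (d, k)}

/-- The `ℂ`-submodule `C₊²` of `Cov(V)` spanned by products of two elements of `C₊`. -/
def CplusSq {ι : Type} (ν : ι → ℕ) : Submodule ℂ ↥(Covariants ν) :=
  Submodule.span ℂ {h | ∃ x ∈ Cplus ν, ∃ y ∈ Cplus ν, h = x * y}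

/-- A *minimal basis* of `Cov(V)`: a family of bihomogeneous covariants of positive
total degree whose image in the quotient vector space `C₊/C₊²` is a `ℂ`-basis
(rendered as: the images in `Cov(V)/C₊²` are linearly independent and span the
image of `C₊`). -/
def IsMinimalBasis {ι : Type} (ν : ι → ℕ) {κ : Type} (B : κ → ↥(Covariants ν)) : Prop :=
  (∀ x, ∃ d k : ℕ, 0 < d + k ∧
      ((B x : CoordRing ν)).IsWeightedHomogeneous (wBi ν) (d, k)) ∧
  LinearIndependent ℂ (fun x => (CplusSq ν).mkQ (B x)) ∧
  Submodule.span ℂ (Set.range fun x => (CplusSq ν).mkQ (B x))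
    = (Cplus ν).map (CplusSq ν).mkQ

/-- A weight-graded `sl₂`-type pair of operators with bounded weights. -/
structure SlPair {V : Type*} [AddCommGroup V] [Module ℂ V] (W : ℤ → Submodule ℂ V)
    (E F : V →ₗ[ℂ] V) (c : ℕ) : Prop where
  E_mem : ∀ {h : ℤ} {x : V}, x ∈ W h → E x ∈ W (h + 2)
  F_mem : ∀ {h : ℤ} {x : V}, x ∈ W h → F x ∈ W (h - 2)
  comm : ∀ {h : ℤ} {x : V}, x ∈ W h → E (F x) = F (E x) + (h : ℂ) • x
  bound : ∀ {h : ℤ} {x : V}, (c : ℤ) < |h| → x ∈ W h → x = 0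

namespace SlPair

variable {V : Type*} [AddCommGroup V] [Module ℂ V] {W : ℤ → Submodule ℂ V}
  {E F : V →ₗ[ℂ] V} {c : ℕ}

theorem swap (H : SlPair W E F c) : SlPair (fun h => W (-h)) F E c where
  E_mem {h x} hx := by
    have := H.F_mem hx
    simpa [sub_eq_add_neg, add_comm] using this
  F_mem {h x} hx := by
    have := H.E_mem hx
    rwa [show -h + 2 = -(h - 2) by ring] at this
  comm {h x} hx := by
    have := H.comm hx
    rw [this]; push_cast; module
  bound {h x} hh hx := H.bound (by rwa [abs_neg]) hx

theorem F_pow_mem (H : SlPair W E F c) (n : ℕ) {h : ℤ} {x : V} (hx : x ∈ W h) :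
    (F ^ n) x ∈ W (h - 2 * n) := by
  induction n with
  | zero => simpa using hx
  | succ n ih =>
    rw [pow_succ']
    have := H.F_mem ih
    rwa [show h - 2 * (n : ℤ) - 2 = h - 2 * ((n + 1 : ℕ) : ℤ) by push_cast; ring] at this

theorem E_pow_mem (H : SlPair W E F c) (n : ℕ) {h : ℤ} {x : V} (hx : x ∈ W h) :
    (E ^ n) x ∈ W (h + 2 * n) := by
  induction n with
  | zero => simpa using hx
  | succ n ih =>
    rw [pow_succ']
    have := H.E_mem ih
    rwa [show h + 2 * (n : ℤ) + 2 = h + 2 * ((n + 1 : ℕ) : ℤ) by push_cast; ring] at this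

theorem E_F_pow (H : SlPair W E F c) (n : ℕ) {h : ℤ} {x : V} (hx : x ∈ W h) :
    E ((F ^ (n + 1)) x) = (F ^ (n + 1)) (E x) + ((n + 1 : ℂ) * (h - n)) • (F ^ n) x := by
  induction n with
  | zero => simp [H.comm hx]
  | succ n ih =>
    rw [pow_succ' F (n + 1), Module.End.mul_apply, H.comm (H.F_pow_mem (n + 1) hx), ih,
      map_add, map_smul, ← Module.End.mul_apply F (F ^ (n + 1)), ← pow_succ',
      ← Module.End.mul_apply F (F ^ n), ← pow_succ']
    push_cast
    module

theorem E_pow_eq_zero (H : SlPair W E F c) {h : ℤ} {x : V} (hx : x ∈ W h) :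
    ∃ N : ℕ, (E ^ N) x = 0 := by
  refine ⟨c + 1 + h.natAbs, H.bound ?_ (H.E_pow_mem _ hx)⟩
  push_cast
  rcases abs_cases h with h1 | h1 <;> rw [lt_abs] <;> left <;> omega

theorem exists_EF_aux (H : SlPair W E F c) {k : ℤ} (hk : 0 < k) (N : ℕ) :
    ∀ (j : ℕ) (y : V), y ∈ W (k + 2 * j) → (E ^ N) y = 0 → ∃ r ∈ W k, E (F r) = (F ^ j) y := by
  induction N with
  | zero => intro j y _ h0; refine ⟨0, zero_mem _, ?_⟩; simp at h0; simp [h0]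
  | succ N ih =>
    intro j y hy h0
    obtain ⟨r, hr, hr'⟩ := ih (j + 1) (E y)
      (by have := H.E_mem hy; rwa [show k + 2 * (j : ℤ) + 2 = k + 2 * ((j + 1 : ℕ) : ℤ) by
        push_cast; ring] at this) (by rw [pow_succ] at h0; exact h0)
    have h1 := H.E_F_pow j hy
    rw [← hr', pow_succ', Module.End.mul_apply] at h1
    have hne : ((j + 1 : ℂ) * (((k + 2 * j : ℤ) : ℂ) - j)) ≠ 0 := by
      have : ((j + 1 : ℂ) * (((k + 2 * j : ℤ) : ℂ) - j)) = (((j + 1) * (k + j) : ℤ) : ℂ) := by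
        push_cast; ring
      rw [this]
      exact_mod_cast (by positivity : ((j + 1 : ℤ) * (k + j)) ≠ 0)
    have hm : (F ^ j) y ∈ W k := by
      have := H.F_pow_mem j hy
      simpa using this
    refine ⟨((j + 1 : ℂ) * (((k + 2 * j : ℤ) : ℂ) - j))⁻¹ • ((F ^ j) y - r),
      Submodule.smul_mem _ _ (sub_mem hm hr), ?_⟩
    rw [map_smul, map_smul, map_sub, map_sub, h1, add_sub_cancel_left, smul_smul,
      inv_mul_cancel₀ hne, one_smul]

theorem exists_EF (H : SlPair W E F c) {k : ℤ} (hk : 0 < k) {x : V} (hx : x ∈ W k) :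
    ∃ r ∈ W k, E (F r) = x := by
  obtain ⟨N, hN⟩ := H.E_pow_eq_zero hx
  simpa using H.exists_EF_aux hk N 0 x (by simpa using hx) hN

theorem exists_FE (H : SlPair W E F c) {k : ℤ} (hk : k < 0) {x : V} (hx : x ∈ W k) :
    ∃ r ∈ W k, F (E r) = x := by
  obtain ⟨r, hr, h⟩ := H.swap.exists_EF (k := -k) (by omega) (x := x) (by simpa using hx)
  exact ⟨r, by simpa using hr, h⟩

theorem F_pow_eq_zero_of_bound (H : SlPair W E F c) {h : ℤ} {x : V} (hx : x ∈ W h) :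
    ∃ N : ℕ, (F ^ N) x = 0 := H.swap.E_pow_eq_zero (h := -h) (by simpa using hx)

theorem E_F_pow_of_ker (H : SlPair W E F c) (n : ℕ) {h : ℤ} {x : V} (hx : x ∈ W h)
    (h0 : E x = 0) : E ((F ^ (n + 1)) x) = ((n + 1 : ℂ) * (h - n)) • (F ^ n) x := by
  rw [H.E_F_pow n hx, h0, map_zero, zero_add]

theorem eq_zero_of_neg (H : SlPair W E F c) {h : ℤ} (hh : h < 0) {x : V} (hx : x ∈ W h)
    (h0 : E x = 0) : x = 0 := by
  obtain ⟨N, hN⟩ := H.F_pow_eq_zero_of_bound hx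
  induction N with
  | zero => simpa using hN
  | succ N ih =>
    apply ih
    have := H.E_F_pow_of_ker N hx h0
    rw [hN, map_zero] at this
    refine (smul_eq_zero.mp this.symm).resolve_left ?_
    have h2 : ((N + 1 : ℂ) * (h - N)) = (((N + 1) * (h - N) : ℤ) : ℂ) := by push_cast; ring
    rw [h2]
    have h3 : ((N : ℤ) + 1) * (h - N) ≠ 0 := mul_ne_zero (by omega) (by omega)
    exact_mod_cast h3

theorem F_pow_eq_zero (H : SlPair W E F c) {k : ℤ} {x : V} (hx : x ∈ W k)
    (h0 : E x = 0) {n : ℕ} (hn : k < n) : (F ^ n) x = 0 := by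
  rcases lt_or_ge k 0 with hk | hk
  · rw [H.eq_zero_of_neg hk hx h0, map_zero]
  · obtain ⟨m, rfl⟩ := Int.eq_ofNat_of_zero_le hk
    have h1 : (F ^ (m + 1)) x = 0 := by
      refine H.eq_zero_of_neg (h := (m : ℤ) - 2 * (m + 1 : ℕ)) (by push_cast; omega)
        (H.F_pow_mem _ hx) ?_
      rw [H.E_F_pow_of_ker m hx h0]; simp
    obtain ⟨t, rfl⟩ : ∃ t, n = t + (m + 1) := ⟨n - (m + 1), by omega⟩
    rw [pow_add, Module.End.mul_apply, h1, map_zero]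

theorem exists_decomp_step (H : SlPair W E F c) {h : ℤ} {x : V} (hx : x ∈ W h) :
    ∃ r ∈ W (h + 2), x - F r ∈ W h ∧ E (x - F r) = 0 := by
  have key : ∀ r ∈ W (h + 2), F r ∈ W h := fun r hr => by simpa using H.F_mem hr
  rcases lt_or_ge h 0 with hh | hh
  · obtain ⟨r, hr, h1⟩ := H.exists_FE hh hx
    exact ⟨E r, H.E_mem hr, by simp [h1], by simp [h1]⟩
  · obtain ⟨r, hr, h1⟩ := H.exists_EF (k := h + 2) (by omega) (H.E_mem hx)
    exact ⟨r, hr, sub_mem hx (key r hr), by simp [h1]⟩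

theorem exists_decomp (H : SlPair W E F c) {h : ℤ} {x : V} (hx : x ∈ W h) :
    ∃ (N : ℕ) (z : ℕ → V), (∀ l : ℕ, z l ∈ W (h + 2 * l) ∧ E (z l) = 0) ∧
      x = ∑ l ∈ Finset.range N, (F ^ l) (z l) := by
  obtain ⟨n, hn⟩ : ∃ n : ℕ, (c : ℤ) < h + n := ⟨c + 1 + h.natAbs, by push_cast; rcases abs_cases h with h1 | h1 <;> omega⟩
  induction n using Nat.strong_induction_on generalizing h x with
  | _ n ih =>
  rcases lt_or_ge (c : ℤ) h with hc | hc
  · refine ⟨0, fun _ => 0, fun _ => ⟨zero_mem _, map_zero _⟩, ?_⟩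
    rw [H.bound (by rw [lt_abs]; left; exact hc) hx]; simp
  · obtain ⟨r, hr, h1, h2⟩ := H.exists_decomp_step hx
    obtain ⟨N, z, hz, hs⟩ := ih (n - 2 ) (by omega) hr (by omega)
    refine ⟨N + 1, fun l => Nat.casesOn l (x - F r) z, ?_, ?_⟩
    · rintro (_ | l)
      · exact ⟨by simpa using h1, h2⟩
      · have := hz l
        rwa [show h + 2 + 2 * (l : ℤ) = h + 2 * ((l + 1 : ℕ) : ℤ) by push_cast; ring] at this
    · rw [Finset.sum_range_succ']
      simp only [pow_zero, Module.End.one_apply, pow_succ', Module.End.mul_apply]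
      rw [← map_sum, ← hs]; exact (add_sub_cancel _ _).symm

theorem E_pow_F_pow_lt (H : SlPair W E F c) {k : ℤ} {z : V} (hz : z ∈ W k) (h0 : E z = 0)
    {l L : ℕ} (hl : l < L) : (E ^ L) ((F ^ l) z) = 0 := by
  induction L generalizing l with
  | zero => omega
  | succ L ih =>
    rw [pow_succ, Module.End.mul_apply]
    cases l with
    | zero => simp [h0]
    | succ l => rw [H.E_F_pow_of_ker l hz h0, map_smul, ih (by omega), smul_zero]

theorem F_pow_eq_zero_of_E_pow (H : SlPair W E F c) {k : ℤ} {z : V} (hz : z ∈ W k)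
    (h0 : E z = 0) {L : ℕ} (h1 : (E ^ L) ((F ^ L) z) = 0) : (F ^ L) z = 0 := by
  induction L with
  | zero => simpa using h1
  | succ L ih =>
    rw [pow_succ E, Module.End.mul_apply, H.E_F_pow_of_ker L hz h0, map_smul] at h1
    rcases smul_eq_zero.mp h1 with h2 | h2
    · refine H.F_pow_eq_zero hz h0 ?_
      rcases mul_eq_zero.mp h2 with h3 | h3
      · exact absurd h3 (by exact_mod_cast Nat.succ_ne_zero L)
      · have : k = L := by
          have h4 : (k : ℂ) = (L : ℂ) := sub_eq_zero.mp h3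
          exact_mod_cast h4
        omega
    · rw [pow_succ', Module.End.mul_apply, ih h2, map_zero]

theorem F_pow_term_eq_zero (H : SlPair W E F c) {h : ℤ} {z : ℕ → V}
    (hz : ∀ l : ℕ, z l ∈ W (h + 2 * l) ∧ E (z l) = 0) {i : ℕ} (N : ℕ)
    (h0 : (E ^ i) (∑ l ∈ Finset.range N, (F ^ l) (z l)) = 0) :
    ∀ l, i ≤ l → l < N → (F ^ l) (z l) = 0 := by
  induction N with
  | zero => intro l _ h; omega
  | succ N ih =>
    rcases lt_or_ge N i with hN | hN
    · intro l h1 h2; omega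
    · have h1 : (E ^ N) (∑ l ∈ Finset.range (N + 1), (F ^ l) (z l)) = 0 := by
        obtain ⟨t, rfl⟩ := Nat.exists_eq_add_of_le' hN
        rw [pow_add, Module.End.mul_apply, h0, map_zero]
      rw [map_sum, Finset.sum_range_succ, Finset.sum_eq_zero, zero_add] at h1
      · have h2 := H.F_pow_eq_zero_of_E_pow (hz N).1 (hz N).2 h1
        rw [Finset.sum_range_succ, h2, add_zero] at h0
        intro l hl hl'
        rcases Nat.lt_succ_iff_lt_or_eq.mp hl' with h3 | rfl
        · exact ih h0 l hl h3
        · exact h2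
      · intro l hl
        exact H.E_pow_F_pow_lt (hz l).1 (hz l).2 (Finset.mem_range.mp hl)

/-- A vector killed by `E ^ i` is a combination of strings of length less than `i`. -/
theorem exists_decomp_of_E_pow (H : SlPair W E F c) {h : ℤ} {x : V} (hx : x ∈ W h) {i : ℕ}
    (h0 : (E ^ i) x = 0) :
    ∃ z : ℕ → V, (∀ l : ℕ, z l ∈ W (h + 2 * l) ∧ E (z l) = 0) ∧
      x = ∑ l ∈ Finset.range i, (F ^ l) (z l) := by
  obtain ⟨N, z, hz, hs⟩ := H.exists_decomp hx
  have h1 := H.F_pow_term_eq_zero hz N (hs ▸ h0)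
  refine ⟨fun l => if l < N then z l else 0, ?_, ?_⟩
  · intro l
    by_cases hl : l < N
    · simpa [hl] using hz l
    · simp [hl]
  · have h2 : ∀ l, l ∈ Finset.range (i + N) → (F ^ l) (if l < N then z l else 0) ≠ 0 →
        l < i ∧ l < N := by
      intro l _ hne
      by_cases hl : l < N
      · refine ⟨?_, hl⟩
        by_contra hi
        rw [if_pos hl] at hne
        exact hne (h1 l (by omega) hl)
      · simp [hl] at hne
    rw [hs]
    trans ∑ l ∈ Finset.range (i + N), (F ^ l) (if l < N then z l else 0)
    · rw [← Finset.sum_subset (Finset.range_subset_range.mpr (Nat.le_add_left N i))]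
      · exact Finset.sum_congr rfl fun l hl => by rw [if_pos (Finset.mem_range.mp hl)]
      · intro l _ hl; rw [if_neg (by simpa using hl), map_zero]
    · rw [← Finset.sum_subset (Finset.range_subset_range.mpr (Nat.le_add_right i N))]
      intro l hl hl'
      by_contra hne
      exact hl' (Finset.mem_range.mpr (h2 l hl hne).1)

theorem F_eq_zero_of_ker (H : SlPair W E F c) {h : ℤ} {y : V} (hy : y ∈ W h)
    (h0 : E (F y) = 0) : F y = 0 := by
  obtain ⟨N, z, hz, hs⟩ := H.exists_decomp hy
  have hz' : ∀ l : ℕ, (Nat.casesOn l 0 z : V) ∈ W (h - 2 + 2 * l) ∧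
      E (Nat.casesOn l 0 z : V) = 0 := by
    rintro (_ | l)
    · simp
    · have := hz l
      rwa [show h + 2 * (l : ℤ) = h - 2 + 2 * ((l + 1 : ℕ) : ℤ) by push_cast; ring] at this
  have hs' : F y = ∑ l ∈ Finset.range (N + 1), (F ^ l) (Nat.casesOn l 0 z : V) := by
    rw [Finset.sum_range_succ']
    simp only [pow_zero, Module.End.one_apply, pow_succ', Module.End.mul_apply]
    rw [← map_sum, ← hs]; exact (add_zero _).symm
  have := H.F_pow_term_eq_zero (i := 1) hz' (N + 1) (by rw [← hs', pow_one, h0])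
  rw [hs']
  refine Finset.sum_eq_zero ?_
  rintro (_ | l) hl
  · simp
  · exact this _ (by omega) (Finset.mem_range.mp hl)

end SlPair

/-- Indices of the coefficients of a sextic and a quartic. -/
abbrev Idx : Type := Fin 7 ⊕ Fin 5

/-- Tri-degrees: degree in the sextic, degree in the quartic, weight. -/
abbrev Deg : Type := ℕ × ℕ × ℤ

section Ring
variable (k : Type) [CommRing k]

/-- Coefficients of the generic sextic. -/
def ca (i : ℕ) : MvPolynomial Idx k := if h : i < 7 then X (Sum.inl ⟨i, h⟩) else 0

/-- Coefficients of the generic quartic. -/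
def cb (i : ℕ) : MvPolynomial Idx k := if h : i < 5 then X (Sum.inr ⟨i, h⟩) else 0

/-- Raising operator. -/
def opE : Derivation k (MvPolynomial Idx k) (MvPolynomial Idx k) :=
  mkDerivation k (Sum.elim
    (fun i => if (i : ℕ) = 0 then 0 else ((7 - (i : ℕ) : ℕ) : MvPolynomial Idx k) * ca k (i - 1))
    (fun i => if (i : ℕ) = 0 then 0 else ((5 - (i : ℕ) : ℕ) : MvPolynomial Idx k) * cb k (i - 1)))

/-- Lowering operator. -/
def opF : Derivation k (MvPolynomial Idx k) (MvPolynomial Idx k) :=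
  mkDerivation k (Sum.elim
    (fun i => ((i + 1 : ℕ) : MvPolynomial Idx k) * ca k (i + 1))
    (fun i => ((i + 1 : ℕ) : MvPolynomial Idx k) * cb k (i + 1)))

end Ring

/-- The tri-degree of each coefficient. -/
def wt : Idx → Deg :=
  Sum.elim (fun i => (1, 0, 6 - 2 * (i : ℤ))) (fun i => (0, 1, 4 - 2 * (i : ℤ)))

/-- A sequence `u 0, …, u m, 0, …` spanning the irreducible representation of dimension `m + 1`
(in divided-power normalisation). -/
structure IsStr {k : Type} [CommRing k] (m : ℕ) (u : ℕ → MvPolynomial Idx k) : Prop where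
  F_eq : ∀ s, opF k (u s) = ((s + 1 : ℕ) : MvPolynomial Idx k) * u (s + 1)
  E_zero : opE k (u 0) = 0
  E_succ : ∀ s, opE k (u (s + 1)) = ((m - s : ℤ) : MvPolynomial Idx k) * u s
  zero : ∀ s, m < s → u s = 0

section
variable (k : Type) [CommRing k]

theorem isStr_ca : IsStr 6 (ca k) where
  F_eq s := by
    by_cases h : s < 7
    · simp [ca, h, opF, mkDerivation_X]
    · simp [ca, h, show ¬ (s + 1 < 7) by omega]
  E_zero := by simp [ca, opE, mkDerivation_X]
  E_succ s := by
    by_cases h : s < 6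
    · have h7 : s < 7 := by omega
      simp only [ca, opE, show s + 1 < 7 by omega, h7, dif_pos, mkDerivation_X, Sum.elim_inl]
      simp only [Nat.add_sub_cancel, h7, dif_pos]
      rw [if_neg (by omega), show ((6 : ℕ) : ℤ) - s = ((7 - (s + 1) : ℕ) : ℤ) by omega]
      simp
    · rcases eq_or_ne s 6 with rfl | h6
      · simp [ca]
      · simp [ca, show ¬ (s < 7) by omega, show ¬ (s + 1 < 7) by omega]
  zero s hs := by simp [ca, show ¬ (s < 7) by omega]

theorem isStr_cb : IsStr 4 (cb k) where
  F_eq s := by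
    by_cases h : s < 5
    · simp [cb, h, opF, mkDerivation_X]
    · simp [cb, h, show ¬ (s + 1 < 5) by omega]
  E_zero := by simp [cb, opE, mkDerivation_X]
  E_succ s := by
    by_cases h : s < 4
    · have h7 : s < 5 := by omega
      simp only [cb, opE, show s + 1 < 5 by omega, h7, dif_pos, mkDerivation_X, Sum.elim_inr]
      simp only [Nat.add_sub_cancel, h7, dif_pos]
      rw [if_neg (by omega), show ((4 : ℕ) : ℤ) - s = ((5 - (s + 1) : ℕ) : ℤ) by omega]
      simp
    · rcases eq_or_ne s 4 with rfl | h6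
      · simp [cb]
      · simp [cb, show ¬ (s < 5) by omega, show ¬ (s + 1 < 5) by omega]
  zero s hs := by simp [cb, show ¬ (s < 5) by omega]

end

theorem isWH_ca (k : Type) [CommRing k] (i : ℕ) :
    (ca k i).IsWeightedHomogeneous wt ((1, 0, 6 - 2 * (i : ℤ)) : Deg) := by
  unfold ca
  split_ifs with h
  · exact isWeightedHomogeneous_X k wt _
  · exact isWeightedHomogeneous_zero k wt _

theorem isWH_cb (k : Type) [CommRing k] (i : ℕ) :
    (cb k i).IsWeightedHomogeneous wt ((0, 1, 4 - 2 * (i : ℤ)) : Deg) := by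
  unfold cb
  split_ifs with h
  · exact isWeightedHomogeneous_X k wt _
  · exact isWeightedHomogeneous_zero k wt _

theorem isWH_natCast_mul {k : Type} [CommRing k] (n : ℕ) {p : MvPolynomial Idx k} {d : Deg}
    (hp : p.IsWeightedHomogeneous wt d) :
    ((n : MvPolynomial Idx k) * p).IsWeightedHomogeneous wt d := by
  have := (isWeightedHomogeneous_C wt (n : k)).mul hp
  simpa using this

theorem isWH_mkDerivation {k : Type} [CommRing k] (f : Idx → MvPolynomial Idx k) (t : ℤ)
    (hf : ∀ i, (f i).IsWeightedHomogeneous wt (wt i + ((0, 0, t) : Deg)))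
    {p : MvPolynomial Idx k} {d : Deg} (hp : p.IsWeightedHomogeneous wt d) :
    (mkDerivation k f p).IsWeightedHomogeneous wt (d + ((0, 0, t) : Deg)) := by
  classical
  rw [← mem_weightedHomogeneousSubmodule]
  rw [p.as_sum, map_sum]
  refine sum_mem fun s hs => ?_
  have hw := hp (mem_support_iff.mp hs)
  rw [mkDerivation_monomial]
  refine Submodule.smul_mem _ _ (sum_mem fun i hi => ?_)
  rw [mem_weightedHomogeneousSubmodule]
  dsimp only
  rw [smul_eq_mul]
  have hi1 : 1 ≤ s i := Nat.one_le_iff_ne_zero.mpr (Finsupp.mem_support_iff.mp hi)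
  have h1 : Finsupp.weight wt (s - Finsupp.single i 1) + wt i = d := by
    rw [← hw]
    conv_rhs => rw [← tsub_add_cancel_of_le (show Finsupp.single i 1 ≤ s by simpa using hi1)]
    rw [map_add, Finsupp.weight_single]
    simp
  have := (isWeightedHomogeneous_monomial (R := k) wt (s - Finsupp.single i 1) (s i : k) rfl).mul
    (hf i)
  rwa [← add_assoc, h1] at this

theorem isWH_E {k : Type} [CommRing k] {p : MvPolynomial Idx k} {d : Deg}
    (hp : p.IsWeightedHomogeneous wt d) :
    (opE k p).IsWeightedHomogeneous wt (d + ((0, 0, 2) : Deg)) := by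
  refine isWH_mkDerivation _ 2 ?_ hp
  rintro (i | i)
  · by_cases h : (i : ℕ) = 0
    · simp only [Sum.elim_inl, h, if_true]
      exact isWeightedHomogeneous_zero _ _ _
    · simp only [Sum.elim_inl, h, if_false]
      convert isWH_natCast_mul _ (isWH_ca k (i - 1)) using 1
      simp only [wt, Sum.elim_inl, Prod.mk_add_mk]
      congr 2; omega
  · by_cases h : (i : ℕ) = 0
    · simp only [Sum.elim_inr, h, if_true]
      exact isWeightedHomogeneous_zero _ _ _
    · simp only [Sum.elim_inr, h, if_false]
      convert isWH_natCast_mul _ (isWH_cb k (i - 1)) using 1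
      simp only [wt, Sum.elim_inr, Prod.mk_add_mk]
      congr 2; omega

theorem isWH_F {k : Type} [CommRing k] {p : MvPolynomial Idx k} {d : Deg}
    (hp : p.IsWeightedHomogeneous wt d) :
    (opF k p).IsWeightedHomogeneous wt (d + ((0, 0, -2) : Deg)) := by
  refine isWH_mkDerivation _ (-2) ?_ hp
  rintro (i | i)
  · simp only [Sum.elim_inl]
    convert isWH_natCast_mul _ (isWH_ca k (i + 1)) using 1
    simp only [wt, Sum.elim_inl, Prod.mk_add_mk]
    congr 2; push_cast; ring
  · simp only [Sum.elim_inr]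
    convert isWH_natCast_mul _ (isWH_cb k (i + 1)) using 1
    simp only [wt, Sum.elim_inr, Prod.mk_add_mk]
    congr 2; push_cast; ring

/-- The Euler-type derivation recording the weight. -/
def opH : Derivation ℂ (MvPolynomial Idx ℂ) (MvPolynomial Idx ℂ) :=
  mkDerivation ℂ fun i => ((wt i).2.2 : ℂ) • X i

theorem derivation_intCast_mul {k : Type} [CommRing k]
    (D : Derivation k (MvPolynomial Idx k) (MvPolynomial Idx k)) (n : ℤ) (p : MvPolynomial Idx k) :
    D ((n : MvPolynomial Idx k) * p) = (n : MvPolynomial Idx k) * D p := by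
  rw [← zsmul_eq_mul, map_zsmul, zsmul_eq_mul]

theorem derivation_natCast_mul {k : Type} [CommRing k]
    (D : Derivation k (MvPolynomial Idx k) (MvPolynomial Idx k)) (n : ℕ) (p : MvPolynomial Idx k) :
    D ((n : MvPolynomial Idx k) * p) = (n : MvPolynomial Idx k) * D p := by
  rw [← nsmul_eq_mul, map_nsmul, nsmul_eq_mul]

theorem IsStr.comm {m : ℕ} {u : ℕ → MvPolynomial Idx ℂ} (h : IsStr m u) (s : ℕ) :
    opE ℂ (opF ℂ (u s)) - opF ℂ (opE ℂ (u s)) = ((m - 2 * s : ℤ) : ℂ) • u s := by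
  rw [h.F_eq, derivation_natCast_mul, h.E_succ, smul_eq_C_mul]
  cases s with
  | zero => rw [h.E_zero]; simp
  | succ s =>
    rw [h.E_succ, derivation_intCast_mul, h.F_eq]
    simp only [map_intCast]
    push_cast
    ring

theorem ca_fin (k : Type) [CommRing k] (i : Fin 7) : ca k i = X (Sum.inl i) := by simp [ca]

theorem cb_fin (k : Type) [CommRing k] (i : Fin 5) : cb k i = X (Sum.inr i) := by simp [cb]

theorem bracket_eq : ⁅opE ℂ, opF ℂ⁆ = opH := by
  refine MvPolynomial.derivation_ext ?_
  rintro (i | i)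
  · rw [Derivation.commutator_apply, ← ca_fin, (isStr_ca ℂ).comm]
    simp [ca_fin, opH, mkDerivation_X, wt]
  · rw [Derivation.commutator_apply, ← cb_fin, (isStr_cb ℂ).comm]
    simp [cb_fin, opH, mkDerivation_X, wt]

theorem opH_eq {p : MvPolynomial Idx ℂ} {d : Deg} (hp : p.IsWeightedHomogeneous wt d) :
    opH p = (d.2.2 : ℂ) • p := by
  classical
  conv_lhs => rw [p.as_sum]
  conv_rhs => rw [p.as_sum]
  rw [map_sum, Finset.smul_sum]
  refine Finset.sum_congr rfl fun s hs => ?_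
  have hw := hp (mem_support_iff.mp hs)
  rw [opH, mkDerivation_monomial, smul_monomial]
  have h1 : ∀ i ∈ s.support, (monomial (s - Finsupp.single i 1)) ((s i : ℂ)) •
      ((wt i).2.2 : ℂ) • (X i : MvPolynomial Idx ℂ) =
      monomial s ((s i : ℂ) * ((wt i).2.2 : ℂ)) := by
    intro i hi
    have hi1 : 1 ≤ s i := Nat.one_le_iff_ne_zero.mpr (Finsupp.mem_support_iff.mp hi)
    rw [X, smul_monomial, smul_eq_mul, monomial_mul,
      tsub_add_cancel_of_le (show Finsupp.single i 1 ≤ s by simpa using hi1)]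
    simp
  rw [Finsupp.sum, Finset.sum_congr rfl h1, ← map_sum, smul_monomial]
  congr 1
  rw [← hw, Finsupp.weight_apply, Finsupp.sum, smul_eq_mul, smul_eq_mul, mul_comm]
  congr 1
  rw [Prod.snd_sum, Prod.snd_sum]
  push_cast
  simp

theorem weight_bound (s : Idx →₀ ℕ) : |(Finsupp.weight wt s).2.2| ≤
    6 * (Finsupp.weight wt s).1 + 4 * (Finsupp.weight wt s).2.1 := by
  induction s using Finsupp.induction_linear with
  | zero => simp
  | add f g hf hg =>
    simp only [map_add, Prod.fst_add, Prod.snd_add]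
    refine (abs_add_le _ _).trans ?_
    push_cast; linarith
  | single i n =>
    rw [Finsupp.weight_single]
    have h1 : |(wt i).2.2| ≤ 6 * (wt i).1 + 4 * (wt i).2.1 := by
      rcases i with i | i <;> simp only [wt, Sum.elim_inl, Sum.elim_inr] <;> rw [abs_le] <;>
        constructor <;> push_cast <;> have := i.2 <;> omega
    have h2 := mul_le_mul_of_nonneg_left h1 (Nat.cast_nonneg (α := ℤ) n)
    rw [Prod.smul_snd, Prod.smul_snd, Prod.smul_fst, Prod.smul_fst, nsmul_eq_mul, abs_mul,
      Nat.abs_cast, nsmul_eq_mul, nsmul_eq_mul]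
    push_cast
    linarith

/-- The weight spaces of bidegree `(d₁, d₂)`. -/
def Wsp (d₁ d₂ : ℕ) (h : ℤ) : Submodule ℂ (MvPolynomial Idx ℂ) :=
  weightedHomogeneousSubmodule ℂ wt ((d₁, d₂, h) : Deg)

/-- Highest weight vectors of tri-degree `(d₁, d₂, h)`. -/
def Ssp (d₁ d₂ : ℕ) (h : ℤ) : Submodule ℂ (MvPolynomial Idx ℂ) :=
  Wsp d₁ d₂ h ⊓ LinearMap.ker (opE ℂ).toLinearMap

theorem mem_Wsp {d₁ d₂ : ℕ} {h : ℤ} {p : MvPolynomial Idx ℂ} :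
    p ∈ Wsp d₁ d₂ h ↔ p.IsWeightedHomogeneous wt ((d₁, d₂, h) : Deg) := Iff.rfl

theorem mem_Ssp {d₁ d₂ : ℕ} {h : ℤ} {p : MvPolynomial Idx ℂ} :
    p ∈ Ssp d₁ d₂ h ↔ p ∈ Wsp d₁ d₂ h ∧ opE ℂ p = 0 := Iff.rfl

theorem slPair (d₁ d₂ : ℕ) : SlPair (Wsp d₁ d₂) (opE ℂ).toLinearMap (opF ℂ).toLinearMap
    (6 * d₁ + 4 * d₂) where
  E_mem {h x} hx := by
    have := isWH_E (mem_Wsp.mp hx)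
    simpa [mem_Wsp] using this
  F_mem {h x} hx := by
    have := isWH_F (mem_Wsp.mp hx)
    simpa [mem_Wsp, sub_eq_add_neg] using this
  comm {h x} hx := by
    have := congrArg (fun D => D x) bracket_eq
    simp only [Derivation.commutator_apply, opH_eq (mem_Wsp.mp hx)] at this
    simpa [add_comm] using sub_eq_iff_eq_add.mp this
  bound {h x} hh hx := by
    ext s
    rw [coeff_zero]
    by_contra hne
    have h1 := (mem_Wsp.mp hx) hne
    have h2 := weight_bound s
    rw [h1] at h2
    push_cast at hh
    exact absurd h2 (by simpa using hh)

theorem Wsp_mul {d₁ d₂ e₁ e₂ : ℕ} {h l : ℤ} {p q : MvPolynomial Idx ℂ} (hp : p ∈ Wsp d₁ d₂ h)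
    (hq : q ∈ Wsp e₁ e₂ l) : p * q ∈ Wsp (d₁ + e₁) (d₂ + e₂) (h + l) :=
  IsWeightedHomogeneous.mul hp hq

theorem Ssp_mul {d₁ d₂ e₁ e₂ : ℕ} {h l : ℤ} {p q : MvPolynomial Idx ℂ} (hp : p ∈ Ssp d₁ d₂ h)
    (hq : q ∈ Ssp e₁ e₂ l) : p * q ∈ Ssp (d₁ + e₁) (d₂ + e₂) (h + l) := by
  refine mem_Ssp.mpr ⟨Wsp_mul hp.1 hq.1, ?_⟩
  rw [Derivation.leibniz, (mem_Ssp.mp hp).2, (mem_Ssp.mp hq).2]; simp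

/-- Coefficients of the `r`-th transvectant of strings of lengths `m` and `n`. -/
def tcoef (m n r i : ℕ) : ℤ :=
  (-1) ^ i * ((m - i).descFactorial (r - i) * (n - r + i).descFactorial i : ℕ)

/-- The `r`-th transvectant of two strings. -/
def trv {R : Type*} [CommRing R] (m n r : ℕ) (u v : ℕ → R) (s : ℕ) : R :=
  ∑ i ∈ Finset.range (r + 1), ∑ q ∈ Finset.HasAntidiagonal.antidiagonal s,
    ((tcoef m n r i * ((i + q.1).choose q.1 * (r - i + q.2).choose q.2 : ℕ) : ℤ) : R) *
      (u (i + q.1) * v (r - i + q.2))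

theorem trv_zero {R : Type*} [CommRing R] (m n r : ℕ) (u v : ℕ → R) :
    trv m n r u v 0 = ∑ i ∈ Finset.range (r + 1), (tcoef m n r i : R) * (u i * v (r - i)) := by
  simp [trv]

theorem choose_succ_mul (i a : ℕ) :
    (i + (a + 1)).choose (a + 1) * (a + 1) = (i + a).choose a * (i + a + 1) := by
  have := Nat.add_one_mul_choose_eq (i + a) a
  rw [← add_assoc, ← this, mul_comm]

theorem sum_antidiagonal_shift {R : Type*} [CommRing R] (i j : ℕ) (u v : ℕ → R) (s : ℕ) :
    ∑ q ∈ Finset.HasAntidiagonal.antidiagonal s, ((i + q.1).choose q.1 * (j + q.2).choose q.2 : R) *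
      ((i + q.1 + 1 : R) * u (i + q.1 + 1) * v (j + q.2) +
        u (i + q.1) * ((j + q.2 + 1 : R) * v (j + q.2 + 1))) =
    (s + 1 : R) * ∑ q ∈ Finset.HasAntidiagonal.antidiagonal (s + 1),
      ((i + q.1).choose q.1 * (j + q.2).choose q.2 : R) * (u (i + q.1) * v (j + q.2)) := by
  have h1 : (s + 1 : R) * ∑ q ∈ Finset.HasAntidiagonal.antidiagonal (s + 1),
      ((i + q.1).choose q.1 * (j + q.2).choose q.2 : R) * (u (i + q.1) * v (j + q.2)) =
      ∑ q ∈ Finset.HasAntidiagonal.antidiagonal (s + 1), (q.1 : R) *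
        (((i + q.1).choose q.1 * (j + q.2).choose q.2 : R) * (u (i + q.1) * v (j + q.2))) +
      ∑ q ∈ Finset.HasAntidiagonal.antidiagonal (s + 1), (q.2 : R) *
        (((i + q.1).choose q.1 * (j + q.2).choose q.2 : R) * (u (i + q.1) * v (j + q.2))) := by
    rw [Finset.mul_sum, ← Finset.sum_add_distrib]
    refine Finset.sum_congr rfl fun q hq => ?_
    rw [← add_mul]
    congr 1
    have := Finset.HasAntidiagonal.mem_antidiagonal.mp hq
    have := congrArg (Nat.cast : ℕ → R) this
    push_cast at this
    exact this.symm
  rw [h1, Finset.Nat.sum_antidiagonal_succ, Finset.Nat.sum_antidiagonal_succ']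
  simp only [Nat.cast_zero, zero_mul, zero_add, add_zero]
  rw [← Finset.sum_add_distrib]
  refine Finset.sum_congr rfl fun q _ => ?_
  have e1 : (((i + (q.1 + 1)).choose (q.1 + 1) : ℕ) : R) * (q.1 + 1) =
      (i + q.1).choose q.1 * (i + q.1 + 1) := by
    have := congrArg (Nat.cast : ℕ → R) (choose_succ_mul i q.1)
    push_cast at this ⊢
    exact this
  have e2 : (((j + (q.2 + 1)).choose (q.2 + 1) : ℕ) : R) * (q.2 + 1) =
      (j + q.2).choose q.2 * (j + q.2 + 1) := by
    have := congrArg (Nat.cast : ℕ → R) (choose_succ_mul j q.2)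
    push_cast at this ⊢
    exact this
  simp only [← add_assoc] at e1 e2 ⊢
  push_cast
  linear_combination (-(j + q.2).choose q.2 * u (i + q.1 + 1) * v (j + q.2) : R) * e1 -
    ((i + q.1).choose q.1 * u (i + q.1) * v (j + q.2 + 1) : R) * e2

section
variable {k : Type} [CommRing k] {u v : ℕ → MvPolynomial Idx k}

theorem F_trv (hu : ∀ s, opF k (u s) = ((s + 1 : ℕ) : MvPolynomial Idx k) * u (s + 1))
    (hv : ∀ s, opF k (v s) = ((s + 1 : ℕ) : MvPolynomial Idx k) * v (s + 1)) (m n r s : ℕ) :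
    opF k (trv m n r u v s) = ((s + 1 : ℕ) : MvPolynomial Idx k) * trv m n r u v (s + 1) := by
  unfold trv
  rw [map_sum, Finset.mul_sum]
  refine Finset.sum_congr rfl fun i _ => ?_
  rw [map_sum]
  have h1 := sum_antidiagonal_shift i (r - i) u v s
  have h2 : ∀ t, ∑ q ∈ Finset.HasAntidiagonal.antidiagonal t,
      ((tcoef m n r i * ((i + q.1).choose q.1 * (r - i + q.2).choose q.2 : ℕ) : ℤ) :
        MvPolynomial Idx k) * (u (i + q.1) * v (r - i + q.2)) =
      (tcoef m n r i : MvPolynomial Idx k) * ∑ q ∈ Finset.HasAntidiagonal.antidiagonal t,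
      ((i + q.1).choose q.1 * (r - i + q.2).choose q.2 : MvPolynomial Idx k) *
        (u (i + q.1) * v (r - i + q.2)) := by
    intro t
    rw [Finset.mul_sum]
    refine Finset.sum_congr rfl fun q _ => ?_
    push_cast; ring
  rw [h2 (s + 1), mul_left_comm, Nat.cast_succ, ← h1, Finset.mul_sum]
  refine Finset.sum_congr rfl fun q _ => ?_
  rw [derivation_intCast_mul, Derivation.leibniz, hu, hv]
  push_cast
  simp only [smul_eq_mul]
  ring

theorem tcoef_succ {m n r i : ℕ} (hr : r ≤ m) (hn : r ≤ n) (hi : i < r) :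
    tcoef m n r (i + 1) * (m - i) + tcoef m n r i * (n - (r - i - 1 : ℕ)) = 0 := by
  unfold tcoef
  have h1 : (m - i).descFactorial (r - i) = (m - i) * (m - (i + 1)).descFactorial (r - (i + 1)) := by
    obtain ⟨t, ht⟩ : ∃ t, m - i = t + 1 := ⟨m - i - 1, by omega⟩
    obtain ⟨w, hw⟩ : ∃ w, r - i = w + 1 := ⟨r - i - 1, by omega⟩
    rw [ht, hw, Nat.succ_descFactorial_succ, show m - (i + 1) = t by omega,
      show r - (i + 1) = w by omega]
  have h2 : (n - r + (i + 1)).descFactorial (i + 1) =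
      (n - r + i + 1) * (n - r + i).descFactorial i := by
    rw [← add_assoc, Nat.succ_descFactorial_succ]
  rw [h1, h2]
  have e1 : ((m - i : ℕ) : ℤ) = m - i := by omega
  have e2 : ((n - r + i + 1 : ℕ) : ℤ) = n - (r - i - 1 : ℕ) := by omega
  push_cast at e1 e2 ⊢
  rw [e1, e2]
  ring

theorem E_trv {m n r : ℕ} (hu0 : opE k (u 0) = 0) (hv0 : opE k (v 0) = 0)
    (hu : ∀ s, opE k (u (s + 1)) = ((m - s : ℤ) : MvPolynomial Idx k) * u s)
    (hv : ∀ s, opE k (v (s + 1)) = ((n - s : ℤ) : MvPolynomial Idx k) * v s)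
    (hr : r ≤ m) (hn : r ≤ n) : opE k (trv m n r u v 0) = 0 := by
  rw [trv_zero, map_sum]
  have h1 : ∀ i ∈ Finset.range (r + 1), opE k ((tcoef m n r i : MvPolynomial Idx k) *
      (u i * v (r - i))) = (tcoef m n r i : MvPolynomial Idx k) * (v (r - i) * opE k (u i)) +
        (tcoef m n r i : MvPolynomial Idx k) * (u i * opE k (v (r - i))) := by
    intro i _
    rw [derivation_intCast_mul, Derivation.leibniz]
    simp only [smul_eq_mul]
    ring
  rw [Finset.sum_congr rfl h1, Finset.sum_add_distrib, Finset.sum_range_succ', hu0,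
    Finset.sum_range_succ, Nat.sub_self, hv0, mul_zero, mul_zero, add_zero, mul_zero, mul_zero,
    add_zero, ← Finset.sum_add_distrib]
  refine Finset.sum_eq_zero fun i hi => ?_
  have hi := Finset.mem_range.mp hi
  obtain ⟨w, hw⟩ : ∃ w, r - i = w + 1 := ⟨r - i - 1, by omega⟩
  rw [hu, show r - (i + 1) = w by omega, hw, hv]
  have := congrArg (Int.cast : ℤ → MvPolynomial Idx k) (tcoef_succ hr hn hi)
  rw [hw, Nat.add_sub_cancel] at this
  push_cast at this ⊢
  linear_combination (u i * v w) * this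

end

/-- The string generated by a vector. -/
def strOf (x : MvPolynomial Idx ℂ) (s : ℕ) : MvPolynomial Idx ℂ :=
  ((s.factorial : ℂ))⁻¹ • ((opF ℂ).toLinearMap ^ s) x

theorem strOf_zero (x : MvPolynomial Idx ℂ) : strOf x 0 = x := by simp [strOf]

theorem strOf_F (x : MvPolynomial Idx ℂ) (s : ℕ) :
    opF ℂ (strOf x s) = ((s + 1 : ℕ) : MvPolynomial Idx ℂ) * strOf x (s + 1) := by
  unfold strOf
  rw [Derivation.map_smul, pow_succ', Module.End.mul_apply, ← nsmul_eq_mul, ← Nat.cast_smul_eq_nsmul ℂ,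
    smul_smul, Nat.factorial_succ]
  congr 1
  have h1 : (s.factorial : ℂ) ≠ 0 := by exact_mod_cast s.factorial_ne_zero
  have h2 : ((s + 1 : ℕ) : ℂ) ≠ 0 := by exact_mod_cast s.succ_ne_zero
  push_cast at h2 ⊢
  field_simp

theorem eq_strOf {u : ℕ → MvPolynomial Idx ℂ}
    (hu : ∀ s, opF ℂ (u s) = ((s + 1 : ℕ) : MvPolynomial Idx ℂ) * u (s + 1)) (s : ℕ) :
    u s = strOf (u 0) s := by
  induction s with
  | zero => rw [strOf_zero]
  | succ s ih =>
    have h1 := hu s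
    rw [ih, strOf_F] at h1
    have h2 : ((s + 1 : ℕ) : MvPolynomial Idx ℂ) ≠ 0 := by exact_mod_cast s.succ_ne_zero
    exact (mul_left_cancel₀ h2 h1).symm

theorem isStr_strOf {d₁ d₂ k : ℕ} {x : MvPolynomial Idx ℂ} (hx : x ∈ Ssp d₁ d₂ k) :
    IsStr k (strOf x) where
  F_eq := strOf_F x
  E_zero := by rw [strOf_zero]; exact hx.2
  E_succ s := by
    have h := (slPair d₁ d₂).E_F_pow_of_ker s hx.1 hx.2
    unfold strOf
    rw [Derivation.map_smul]
    change _ • (opE ℂ).toLinearMap _ = _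
    rw [h, ← zsmul_eq_mul, ← Int.cast_smul_eq_zsmul ℂ, smul_smul, smul_smul, Nat.factorial_succ]
    congr 1
    have h1 : (s.factorial : ℂ) ≠ 0 := by exact_mod_cast s.factorial_ne_zero
    have h2 : ((s : ℂ) + 1) ≠ 0 := by exact_mod_cast s.succ_ne_zero
    push_cast
    field_simp
  zero s hs := by
    unfold strOf
    rw [(slPair d₁ d₂).F_pow_eq_zero hx.1 hx.2 (by exact_mod_cast hs), smul_zero]

theorem strOf_mem {d₁ d₂ : ℕ} {k : ℤ} {x : MvPolynomial Idx ℂ} (hx : x ∈ Wsp d₁ d₂ k) (s : ℕ) :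
    strOf x s ∈ Wsp d₁ d₂ (k - 2 * s) :=
  Submodule.smul_mem _ _ ((slPair d₁ d₂).F_pow_mem s hx)

/-- The `r`-th transvectant of two highest weight vectors of weights `m`, `n`. -/
def tvt (m n r : ℕ) (x y : MvPolynomial Idx ℂ) : MvPolynomial Idx ℂ :=
  trv m n r (strOf x) (strOf y) 0

theorem tvt_mem {d₁ d₂ e₁ e₂ m n r : ℕ} {x y : MvPolynomial Idx ℂ} (hx : x ∈ Ssp d₁ d₂ m)
    (hy : y ∈ Ssp e₁ e₂ n) (hm : r ≤ m) (hn : r ≤ n) :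
    tvt m n r x y ∈ Ssp (d₁ + e₁) (d₂ + e₂) (m + n - 2 * r) := by
  have h1 := isStr_strOf hx
  have h2 := isStr_strOf hy
  refine mem_Ssp.mpr ⟨?_, E_trv h1.E_zero h2.E_zero h1.E_succ h2.E_succ hm hn⟩
  rw [tvt, trv_zero]
  refine sum_mem fun i hi => ?_
  have hi := Finset.mem_range.mp hi
  rw [← zsmul_eq_mul]
  refine zsmul_mem ?_ _
  have := Wsp_mul (strOf_mem hx.1 i) (strOf_mem hy.1 (r - i))
  rwa [show (m : ℤ) - 2 * i + (n - 2 * ((r - i : ℕ) : ℤ)) = m + n - 2 * r by omega] at this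

theorem strOf_tvt (m n r : ℕ) (x y : MvPolynomial Idx ℂ) (s : ℕ) :
    strOf (tvt m n r x y) s = trv m n r (strOf x) (strOf y) s :=
  (eq_strOf (F_trv (strOf_F x) (strOf_F y) m n r) s).symm

section Comp
variable {k : Type} [CommRing k]

theorem comp_of_mem {d e : Deg} {p : MvPolynomial Idx k} (hp : p.IsWeightedHomogeneous wt d) :
    weightedHomogeneousComponent wt e p = if d = e then p else 0 := by
  classical
  rw [weightedHomogeneousComponent_of_mem hp]
  simp [eq_comm]

theorem comp_linear (D : MvPolynomial Idx k →ₗ[k] MvPolynomial Idx k) (t : Deg)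
    (hD : ∀ (d : Deg) (p : MvPolynomial Idx k), p.IsWeightedHomogeneous wt d →
      (D p).IsWeightedHomogeneous wt (d + t)) (d : Deg) (p : MvPolynomial Idx k) :
    weightedHomogeneousComponent wt (d + t) (D p) = D (weightedHomogeneousComponent wt d p) := by
  induction p using MvPolynomial.induction_on' with
  | monomial s c =>
    have h1 := isWeightedHomogeneous_monomial (R := k) wt s c rfl
    rw [comp_of_mem h1, comp_of_mem (hD _ _ h1)]
    by_cases h : Finsupp.weight wt s = d
    · simp [h]
    · rw [if_neg h, if_neg (fun h' => h (add_right_cancel h')), map_zero]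
  | add p q hp hq => rw [map_add, map_add, hp, hq, map_add, map_add]

theorem eq_zero_of_comp {p : MvPolynomial Idx k}
    (h : ∀ d : Deg, weightedHomogeneousComponent wt d p = 0) : p = 0 := by
  classical
  ext s
  have := congrArg (coeff s) (h (Finsupp.weight wt s))
  rw [coeff_weightedHomogeneousComponent, if_pos rfl] at this
  exact this

theorem comp_mul {t : Deg} {a : MvPolynomial Idx k} (ha : a.IsWeightedHomogeneous wt t) (d : Deg)
    (p : MvPolynomial Idx k) :
    weightedHomogeneousComponent wt (d + t) (a * p) = a * weightedHomogeneousComponent wt d p := by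
  refine comp_linear (LinearMap.mulLeft k a) t (fun e q hq => ?_) d p
  rw [add_comm]
  exact ha.mul hq

theorem comp_E (d : Deg) (p : MvPolynomial Idx k) :
    weightedHomogeneousComponent wt (d + ((0, 0, 2) : Deg)) (opE k p) =
      opE k (weightedHomogeneousComponent wt d p) :=
  comp_linear (opE k).toLinearMap _ (fun _ _ h => isWH_E h) d p

theorem comp_F (d : Deg) (p : MvPolynomial Idx k) :
    weightedHomogeneousComponent wt (d + ((0, 0, -2) : Deg)) (opF k p) =
      opF k (weightedHomogeneousComponent wt d p) :=
  comp_linear (opF k).toLinearMap _ (fun _ _ h => isWH_F h) d p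

end Comp

theorem comp_mem_Ssp (d₁ d₂ : ℕ) (h : ℤ) {p : MvPolynomial Idx ℂ} (hp : opE ℂ p = 0) :
    weightedHomogeneousComponent wt ((d₁, d₂, h) : Deg) p ∈ Ssp d₁ d₂ h :=
  mem_Ssp.mpr ⟨weightedHomogeneousComponent_isWeightedHomogeneous _ _,
    by rw [← comp_E, hp, map_zero]⟩

theorem opF_eq_zero {y : MvPolynomial Idx ℂ} (hy : opE ℂ (opF ℂ y) = 0) : opF ℂ y = 0 := by
  refine eq_zero_of_comp ?_
  rintro ⟨d₁, d₂, h⟩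
  have h1 := comp_F ((d₁, d₂, h + 2) : Deg) y
  rw [show ((d₁, d₂, h + 2) : Deg) + ((0, 0, -2) : Deg) = ((d₁, d₂, h) : Deg) by simp] at h1
  rw [h1]
  refine (slPair d₁ d₂).F_eq_zero_of_ker (h := h + 2)
    (weightedHomogeneousComponent_isWeightedHomogeneous _ _) ?_
  change opE ℂ (opF ℂ _) = 0
  rw [← h1, ← comp_E, hy, map_zero]

/-- The image of the lowering operator. -/
def imF : Submodule ℂ (MvPolynomial Idx ℂ) := LinearMap.range (opF ℂ).toLinearMap

theorem mem_of_mem_sup_imF {T : Submodule ℂ (MvPolynomial Idx ℂ)}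
    (hT : ∀ t ∈ T, opE ℂ t = 0) {p : MvPolynomial Idx ℂ} (hp : opE ℂ p = 0)
    (h : p ∈ T ⊔ imF) : p ∈ T := by
  obtain ⟨t, ht, w, ⟨y, rfl⟩, rfl⟩ := Submodule.mem_sup.mp h
  have h1 : opF ℂ y = 0 := opF_eq_zero (by simpa [hT t ht] using hp)
  change t + opF ℂ y ∈ T
  rwa [h1, add_zero]

theorem strOf_mul_sub_mem {v : ℕ → MvPolynomial Idx ℂ}
    (hv : ∀ s, opF ℂ (v s) = ((s + 1 : ℕ) : MvPolynomial Idx ℂ) * v (s + 1))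
    (z : MvPolynomial Idx ℂ) (i j : ℕ) :
    strOf z i * v j - ((-1) ^ i * ((i + j).choose i : ℕ) : ℂ) • (z * v (i + j)) ∈ imF := by
  induction i generalizing j with
  | zero => simp [strOf_zero]
  | succ i ih =>
    have h1 : opF ℂ (strOf z i * v j) ∈ imF := ⟨_, rfl⟩
    have h2 := ih (j + 1)
    rw [Derivation.leibniz, strOf_F, hv, smul_eq_mul, smul_eq_mul] at h1
    have h3 : ((i + 1 : ℕ) : ℂ) ≠ 0 := by exact_mod_cast i.succ_ne_zero
    have h4 := imF.smul_mem ((i + 1 : ℕ) : ℂ)⁻¹ (imF.sub_mem h1 (imF.smul_mem ((j + 1 : ℕ) : ℂ) h2))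
    convert h4 using 1
    rw [show i + (j + 1) = i + 1 + j by ring]
    have h5 : (((i + 1 + j).choose (i + 1) : ℕ) : ℂ) * ((i + 1 : ℕ) : ℂ) =
        ((i + 1 + j).choose i : ℕ) * ((j + 1 : ℕ) : ℂ) := by
      have := Nat.choose_succ_right_eq (i + 1 + j) i
      rw [show i + 1 + j - i = j + 1 by omega] at this
      exact_mod_cast this
    rw [eq_inv_smul_iff₀ h3]
    simp only [smul_eq_C_mul, smul_sub, ← map_natCast (C (σ := Idx) (R := ℂ))]
    have h6 := congrArg (C (σ := Idx)) h5
    simp only [map_mul, map_natCast, map_pow, map_neg, map_one] at h6 ⊢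
    linear_combination (-(-1) ^ (i + 1) * z * v (i + 1 + j)) * h6

/-- The constant relating a transvectant to its leading product modulo the image of `F`. -/
def kap (m n r : ℕ) (w : ℕ → ℚ) : ℚ :=
  ∑ i ∈ Finset.range (r + 1), tcoef m n r i * w i * ((-1) ^ i * (r.choose i : ℕ))

theorem kap_pos {m n r : ℕ} (hm : r ≤ m) {w : ℕ → ℚ} (h0 : 0 < w 0) (hw : ∀ i, 0 ≤ w i) :
    0 < kap m n r w := by
  have key : ∀ i, (tcoef m n r i : ℚ) * w i * ((-1) ^ i * (r.choose i : ℕ)) =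
      ((m - i).descFactorial (r - i) * (n - r + i).descFactorial i : ℕ) * w i *
        (r.choose i : ℕ) := by
    intro i
    unfold tcoef
    push_cast
    have : ((-1 : ℚ) ^ i) * (-1) ^ i = 1 := by rw [← mul_pow]; simp
    linear_combination (((m - i).descFactorial (r - i) : ℚ) * ((n - r + i).descFactorial i : ℚ) *
      w i * (r.choose i : ℚ)) * this
  unfold kap
  refine Finset.sum_pos' (fun i _ => ?_) ⟨0, by simp, ?_⟩
  · rw [key]
    exact mul_nonneg (mul_nonneg (Nat.cast_nonneg _) (hw i)) (Nat.cast_nonneg _)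
  · rw [key]
    have : 0 < m.descFactorial r := Nat.descFactorial_pos.mpr hm
    simp only [Nat.sub_zero, Nat.descFactorial_zero, mul_one, Nat.choose_zero_right, Nat.cast_one]
    positivity

theorem tsum_sub_mem {v : ℕ → MvPolynomial Idx ℂ}
    (hv : ∀ s, opF ℂ (v s) = ((s + 1 : ℕ) : MvPolynomial Idx ℂ) * v (s + 1))
    (z : MvPolynomial Idx ℂ) (m n r : ℕ) (w : ℕ → ℚ) :
    (∑ i ∈ Finset.range (r + 1), ((tcoef m n r i * w i : ℚ) : ℂ) • (strOf z i * v (r - i))) -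
      (kap m n r w : ℂ) • (z * v r) ∈ imF := by
  have h1 : (kap m n r w : ℂ) • (z * v r) = ∑ i ∈ Finset.range (r + 1),
      ((tcoef m n r i * w i : ℚ) : ℂ) •
        (((-1) ^ i * ((i + (r - i)).choose i : ℕ) : ℂ) • (z * v (i + (r - i)))) := by
    rw [kap, Rat.cast_sum, Finset.sum_smul]
    refine Finset.sum_congr rfl fun i hi => ?_
    have hi := Finset.mem_range.mp hi
    rw [show i + (r - i) = r by omega, smul_smul]
    congr 1
    push_cast
    ring
  rw [h1, ← Finset.sum_sub_distrib]
  refine sum_mem fun i _ => ?_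
  rw [← smul_sub]
  exact imF.smul_mem _ (strOf_mul_sub_mem hv z i (r - i))

/-- Span of the transvectants with `ω` (of weight `n`) of highest weight vectors of bidegree
`(d₁, d₂)` and weight less than `M`. -/
def Tsp (ω : MvPolynomial Idx ℂ) (n d₁ d₂ M : ℕ) : Submodule ℂ (MvPolynomial Idx ℂ) :=
  Submodule.span ℂ {t | ∃ (m r : ℕ) (z : MvPolynomial Idx ℂ), m < M ∧ r ≤ m ∧ r ≤ n ∧
    z ∈ Ssp d₁ d₂ m ∧ t = tvt m n r z ω}

section
variable {ω : MvPolynomial Idx ℂ} {n e₁ e₂ : ℕ} (hω : ω ∈ Ssp e₁ e₂ n)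
include hω

theorem E_Tsp {d₁ d₂ M : ℕ} : ∀ t ∈ Tsp ω n d₁ d₂ M, opE ℂ t = 0 := by
  intro t ht
  induction ht using Submodule.span_induction with
  | mem t ht =>
    obtain ⟨m, r, z, _, h1, h2, h3, rfl⟩ := ht
    exact (tvt_mem h3 hω h1 h2).2
  | zero => simp
  | add x y _ _ hx hy => rw [map_add, hx, hy, add_zero]
  | smul c x _ hx => rw [Derivation.map_smul, hx, smul_zero]

theorem mul_str_mem {d₁ d₂ M k : ℕ} (hk : k < M) {z : MvPolynomial Idx ℂ} (hz : z ∈ Ssp d₁ d₂ k)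
    (j : ℕ) : z * strOf ω j ∈ Tsp ω n d₁ d₂ M ⊔ imF := by
  have hs := isStr_strOf hω
  rcases lt_or_ge n j with h1 | h1
  · rw [hs.zero j h1, mul_zero]; exact zero_mem _
  rcases lt_or_ge k j with h2 | h2
  · have h3 := strOf_mul_sub_mem hs.F_eq z j 0
    rw [(isStr_strOf hz).zero j h2, zero_mul, zero_sub, neg_mem_iff, add_zero, Nat.choose_self] at h3
    refine Submodule.mem_sup_right ?_
    refine (imF.smul_mem_iff (s := ((-1) ^ j * (1 : ℕ) : ℂ)) ?_).mp h3
    simp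
  · have h3 := tsum_sub_mem hs.F_eq z k n j (fun _ => 1)
    have h4 := kap_pos (m := k) (n := n) h2 (w := fun _ => 1) one_pos (fun _ => zero_le_one)
    have h5 : (∑ i ∈ Finset.range (j + 1), ((tcoef k n j i * 1 : ℚ) : ℂ) •
        (strOf z i * strOf ω (j - i))) = tvt k n j z ω := by
      rw [tvt, trv_zero]
      refine Finset.sum_congr rfl fun i _ => ?_
      rw [smul_eq_C_mul]; simp
    rw [h5] at h3
    have h6 : tvt k n j z ω ∈ Tsp ω n d₁ d₂ M :=
      Submodule.subset_span ⟨k, j, z, hk, h2, h1, hz, rfl⟩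
    have h7 : (kap k n j (fun _ => 1) : ℂ) • (z * strOf ω j) ∈ Tsp ω n d₁ d₂ M ⊔ imF := by
      have := Submodule.sub_mem _ (Submodule.mem_sup_left (T := imF) h6)
        (Submodule.mem_sup_right (S := Tsp ω n d₁ d₂ M) h3)
      rwa [sub_sub_cancel] at this
    refine ((Tsp ω n d₁ d₂ M ⊔ imF).smul_mem_iff ?_).mp h7
    exact_mod_cast h4.ne'

theorem F_pow_mul_str_mem {d₁ d₂ M : ℕ} {k : ℤ} (hk : k < M) {z : MvPolynomial Idx ℂ}
    (hz : z ∈ Ssp d₁ d₂ k) (l j : ℕ) :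
    ((opF ℂ).toLinearMap ^ l) z * strOf ω j ∈ Tsp ω n d₁ d₂ M ⊔ imF := by
  rcases lt_or_ge k 0 with h | h
  · rw [(slPair d₁ d₂).eq_zero_of_neg h hz.1 hz.2]; simp
  obtain ⟨k, rfl⟩ := Int.eq_ofNat_of_zero_le h
  have h1 := strOf_mul_sub_mem (strOf_F ω) z l j
  have h2 := mul_str_mem hω (by exact_mod_cast hk : k < M) hz (l + j)
  have h3 : strOf z l * strOf ω j ∈ Tsp ω n d₁ d₂ M ⊔ imF := by
    have := Submodule.add_mem _ (Submodule.mem_sup_right (S := Tsp ω n d₁ d₂ M) h1)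
      (Submodule.smul_mem _ ((-1) ^ l * ((l + j).choose l : ℕ) : ℂ) h2)
    rwa [sub_add_cancel] at this
  rw [strOf, smul_mul_assoc] at h3
  refine (Submodule.smul_mem_iff _ ?_).mp h3
  exact inv_ne_zero (by exact_mod_cast l.factorial_ne_zero)

theorem mul_str_mem_of_Wsp {d₁ d₂ M : ℕ} (hM : 6 * d₁ + 4 * d₂ < M) {h : ℤ}
    {y : MvPolynomial Idx ℂ} (hy : y ∈ Wsp d₁ d₂ h) (j : ℕ) :
    y * strOf ω j ∈ Tsp ω n d₁ d₂ M ⊔ imF := by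
  obtain ⟨N, z, hz, rfl⟩ := (slPair d₁ d₂).exists_decomp hy
  rw [Finset.sum_mul]
  refine sum_mem fun l _ => ?_
  rcases lt_or_ge (h + 2 * l) M with h1 | h1
  · exact F_pow_mul_str_mem hω h1 ⟨(hz l).1, (hz l).2⟩ l j
  · rw [(slPair d₁ d₂).bound _ (hz l).1]
    · simp
    · rw [lt_abs]; left; push_cast; omega

/-- Splitting: a transvectant of a product is, up to transvectants of lower weight,
a product involving a transvectant of a factor. -/
theorem tvt_mul_mem {d₁ d₂ f₁ f₂ m₁ m₂ r : ℕ} {y₁ y₂ : MvPolynomial Idx ℂ}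
    (h₁ : y₁ ∈ Ssp d₁ d₂ m₁) (h₂ : y₂ ∈ Ssp f₁ f₂ m₂) (hr : r ≤ m₁) (hn : r ≤ n) :
    ∃ c : ℂ, tvt (m₁ + m₂) n r (y₁ * y₂) ω - c • (tvt m₁ n r y₁ ω * y₂) ∈
      Tsp ω n (d₁ + f₁) (d₂ + f₂) (m₁ + m₂) := by
  have hy := Ssp_mul h₁ h₂
  rw [← Nat.cast_add] at hy
  set m := m₁ + m₂ with hm
  set y := y₁ * y₂ with hy'
  set T := Tsp ω n (d₁ + f₁) (d₂ + f₂) m with hT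
  have hEpow : ∀ (M : ℕ) (u : ℕ → MvPolynomial Idx ℂ) (q : MvPolynomial Idx ℂ), IsStr M u →
      opE ℂ q = 0 → ∀ i, i ≤ M → ((opE ℂ).toLinearMap ^ i) (u i * q) =
        (M.descFactorial i : ℂ) • (u 0 * q) := by
    intro M u q hu hq i
    induction i with
    | zero => intro _; simp
    | succ i ih =>
      intro hi
      rw [pow_succ, Module.End.mul_apply]
      change ((opE ℂ).toLinearMap ^ i) (opE ℂ (u (i + 1) * q)) = _
      rw [Derivation.leibniz, hq, smul_zero, zero_add, hu.E_succ, smul_eq_mul,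
        show q * ((((M - i : ℤ)) : MvPolynomial Idx ℂ) * u i) = ((M - i : ℤ) : ℂ) • (u i * q) by
          rw [smul_eq_C_mul]; simp; ring,
        map_smul, ih (by omega), smul_smul, Nat.descFactorial_succ, Nat.cast_mul,
        Nat.cast_sub (by omega)]
      congr 1
      push_cast; ring
  let C' : ℕ → ℚ := fun i => (m₁.descFactorial i : ℚ) / (m.descFactorial i : ℚ)
  have hterm : ∀ i, i ≤ r → ∀ j,
      strOf y₁ i * y₂ * strOf ω j - (C' i : ℂ) • (strOf y i * strOf ω j) ∈ T ⊔ imF := by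
    intro i hi j
    have e1 := hEpow m₁ _ y₂ (isStr_strOf h₁) h₂.2 i (by omega)
    have e2 := hEpow m _ 1 (isStr_strOf hy) (by simp) i (by omega)
    rw [mul_one, mul_one, strOf_zero] at e2
    rw [strOf_zero] at e1
    have hne : ((m.descFactorial i : ℕ) : ℂ) ≠ 0 := by
      exact_mod_cast (Nat.descFactorial_pos.mpr (by omega : i ≤ m)).ne'
    have e3 : ((opE ℂ).toLinearMap ^ i) (strOf y₁ i * y₂ - (C' i : ℂ) • strOf y i) = 0 := by
      rw [map_sub, map_smul, e1, e2, smul_smul, ← sub_smul]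
      have : (m₁.descFactorial i : ℂ) - (C' i : ℂ) * (m.descFactorial i : ℂ) = 0 := by
        simp only [C']; push_cast; field_simp; ring
      rw [this, zero_smul]
    have e4 : strOf y₁ i * y₂ - (C' i : ℂ) • strOf y i ∈
        Wsp (d₁ + f₁) (d₂ + f₂) ((m : ℤ) - 2 * i) := by
      refine sub_mem ?_ (Submodule.smul_mem _ _ (strOf_mem hy.1 i))
      have := Wsp_mul (strOf_mem h₁.1 i) h₂.1
      rwa [show (m₁ : ℤ) - 2 * i + m₂ = m - 2 * i by rw [hm]; push_cast; ring] at this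
    obtain ⟨z, hz, hs⟩ := (slPair _ _).exists_decomp_of_E_pow e4 e3
    rw [← smul_mul_assoc, ← sub_mul, hs, Finset.sum_mul]
    refine sum_mem fun l hl => ?_
    have hl := Finset.mem_range.mp hl
    exact F_pow_mul_str_mem hω (by omega) ⟨(hz l).1, (hz l).2⟩ l j
  have hs := isStr_strOf hω
  have g1 := tsum_sub_mem hs.F_eq y m₁ n r C'
  have g2 := tsum_sub_mem hs.F_eq y m n r (fun _ => 1)
  have hC0 : 0 < C' 0 := by simp [C']
  have hC : ∀ i, 0 ≤ C' i := fun i => by positivity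
  have k1 := kap_pos (m := m₁) (n := n) hr hC0 hC
  have g3 : tvt m₁ n r y₁ ω * y₂ - (kap m₁ n r C' : ℂ) • (y * strOf ω r) ∈ T ⊔ imF := by
    have g4 : tvt m₁ n r y₁ ω * y₂ - ∑ i ∈ Finset.range (r + 1),
        ((tcoef m₁ n r i * C' i : ℚ) : ℂ) • (strOf y i * strOf ω (r - i)) ∈ T ⊔ imF := by
      rw [tvt, trv_zero, Finset.sum_mul, ← Finset.sum_sub_distrib]
      refine sum_mem fun i hi => ?_
      have hi := Finset.mem_range.mp hi
      have := Submodule.smul_mem _ ((tcoef m₁ n r i : ℤ) : ℂ) (hterm i (by omega) (r - i))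
      convert this using 1
      rw [smul_sub, smul_smul]
      congr 1
      · rw [smul_eq_C_mul, map_intCast]; ring
      · push_cast; rfl
    have := Submodule.add_mem _ g4 (Submodule.mem_sup_right (S := T) g1)
    rwa [sub_add_sub_cancel] at this
  have g5 : (∑ i ∈ Finset.range (r + 1), ((tcoef m n r i * 1 : ℚ) : ℂ) •
        (strOf y i * strOf ω (r - i))) = tvt m n r y ω := by
    rw [tvt, trv_zero]
    refine Finset.sum_congr rfl fun i _ => ?_
    rw [smul_eq_C_mul]; simp
  rw [g5] at g2
  set κ₁ : ℂ := (kap m₁ n r C' : ℂ)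
  set κ₂ : ℂ := (kap m n r (fun _ => 1) : ℂ)
  have hκ : κ₁ ≠ 0 := by simp only [κ₁]; exact_mod_cast k1.ne'
  refine ⟨κ₂ / κ₁, mem_of_mem_sup_imF (E_Tsp hω) ?_ ?_⟩
  · rw [map_sub, Derivation.map_smul, (mem_Ssp.mp (tvt_mem hy hω (by omega) hn)).2, Derivation.leibniz,
      (mem_Ssp.mp (tvt_mem h₁ hω hr hn)).2, (mem_Ssp.mp h₂).2]
    simp
  · have := Submodule.sub_mem _ (Submodule.mem_sup_right (S := T) g2)
      (Submodule.smul_mem _ (κ₂ / κ₁) g3)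
    convert this using 1
    rw [smul_sub, smul_smul, div_mul_cancel₀ _ hκ]
    abel

end

theorem a0_mem : ca ℂ 0 ∈ Ssp 1 0 (6 : ℕ) :=
  mem_Ssp.mpr ⟨by simpa [mem_Wsp] using isWH_ca ℂ 0, (isStr_ca ℂ).E_zero⟩

theorem b0_mem : cb ℂ 0 ∈ Ssp 0 1 (4 : ℕ) :=
  mem_Ssp.mpr ⟨by simpa [mem_Wsp] using isWH_cb ℂ 0, (isStr_cb ℂ).E_zero⟩

theorem Ssp_le_Tsp_cb {d₁ d₂ : ℕ} {h : ℤ} {p : MvPolynomial Idx ℂ} (hp : p ∈ Ssp d₁ (d₂ + 1) h) :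
    p ∈ Tsp (cb ℂ 0) 4 d₁ d₂ (6 * d₁ + 4 * d₂ + 1) := by
  refine mem_of_mem_sup_imF (E_Tsp b0_mem) hp.2 ?_
  rw [p.as_sum]
  refine sum_mem fun s hs => ?_
  have hw := (mem_Wsp.mp hp.1) (mem_support_iff.mp hs)
  obtain ⟨j, hj⟩ : ∃ j : Fin 5, 1 ≤ s (Sum.inr j) := by
    by_contra! hcon
    have h1 : (Finsupp.weight wt s).2.1 = 0 := by
      rw [Finsupp.weight_apply, Finsupp.sum, Prod.snd_sum, Prod.fst_sum]
      refine Finset.sum_eq_zero fun i _ => ?_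
      rcases i with i | i
      · simp [wt]
      · have := hcon i; simp [show s (Sum.inr i) = 0 by omega]
    rw [hw] at h1
    simp at h1
  have h2 : monomial s (coeff s p) =
      monomial (s - Finsupp.single (Sum.inr j) 1) (coeff s p) * strOf (cb ℂ 0) j := by
    rw [← eq_strOf (isStr_cb ℂ).F_eq, cb_fin, X, monomial_mul, mul_one,
      tsub_add_cancel_of_le (by simpa using hj)]
  rw [h2]
  refine mul_str_mem_of_Wsp b0_mem (Nat.lt_succ_self _) (h := h - (4 - 2 * (j : ℤ))) ?_ j
  refine isWeightedHomogeneous_monomial _ _ _ ?_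
  have h3 : Finsupp.weight wt (s - Finsupp.single (Sum.inr j) 1) + wt (Sum.inr j) =
      ((d₁, d₂ + 1, h) : Deg) := by
    rw [← hw]
    conv_rhs => rw [← tsub_add_cancel_of_le (show Finsupp.single (Sum.inr j) 1 ≤ s by simpa using hj)]
    rw [map_add, Finsupp.weight_single, one_smul]
  refine add_right_cancel (b := wt (Sum.inr j)) (h3.trans ?_)
  simp [wt]

theorem Ssp_le_Tsp_ca {d₁ d₂ : ℕ} {h : ℤ} {p : MvPolynomial Idx ℂ} (hp : p ∈ Ssp (d₁ + 1) d₂ h) :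
    p ∈ Tsp (ca ℂ 0) 6 d₁ d₂ (6 * d₁ + 4 * d₂ + 1) := by
  refine mem_of_mem_sup_imF (E_Tsp a0_mem) hp.2 ?_
  rw [p.as_sum]
  refine sum_mem fun s hs => ?_
  have hw := (mem_Wsp.mp hp.1) (mem_support_iff.mp hs)
  obtain ⟨j, hj⟩ : ∃ j : Fin 7, 1 ≤ s (Sum.inl j) := by
    by_contra! hcon
    have h1 : (Finsupp.weight wt s).1 = 0 := by
      rw [Finsupp.weight_apply, Finsupp.sum, Prod.fst_sum]
      refine Finset.sum_eq_zero fun i _ => ?_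
      rcases i with i | i
      · have := hcon i; simp [show s (Sum.inl i) = 0 by omega]
      · simp [wt]
    rw [hw] at h1
    simp at h1
  have h2 : monomial s (coeff s p) =
      monomial (s - Finsupp.single (Sum.inl j) 1) (coeff s p) * strOf (ca ℂ 0) j := by
    rw [← eq_strOf (isStr_ca ℂ).F_eq, ca_fin, X, monomial_mul, mul_one,
      tsub_add_cancel_of_le (by simpa using hj)]
  rw [h2]
  refine mul_str_mem_of_Wsp a0_mem (Nat.lt_succ_self _) (h := h - (6 - 2 * (j : ℤ))) ?_ j
  refine isWeightedHomogeneous_monomial _ _ _ ?_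
  have h3 : Finsupp.weight wt (s - Finsupp.single (Sum.inl j) 1) + wt (Sum.inl j) =
      ((d₁ + 1, d₂, h) : Deg) := by
    rw [← hw]
    conv_rhs => rw [← tsub_add_cancel_of_le (show Finsupp.single (Sum.inl j) 1 ≤ s by simpa using hj)]
    rw [map_add, Finsupp.weight_single, one_smul]
  refine add_right_cancel (b := wt (Sum.inl j)) (h3.trans ?_)
  simp [wt]

theorem Tsp_mono {ω : MvPolynomial Idx ℂ} {n d₁ d₂ M N : ℕ} (h : M ≤ N) :
    Tsp ω n d₁ d₂ M ≤ Tsp ω n d₁ d₂ N := by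
  refine Submodule.span_mono ?_
  rintro t ⟨m, r, z, h1, h2⟩
  exact ⟨m, r, z, h1.trans_le h, h2⟩

theorem E_pow_str_mul {M : ℕ} {u : ℕ → MvPolynomial Idx ℂ} {q : MvPolynomial Idx ℂ}
    (hu : IsStr M u) (hq : opE ℂ q = 0) (i : ℕ) (hi : i ≤ M) :
    ((opE ℂ).toLinearMap ^ i) (u i * q) = (M.descFactorial i : ℂ) • (u 0 * q) := by
  induction i with
  | zero => simp
  | succ i ih =>
    rw [pow_succ, Module.End.mul_apply]
    change ((opE ℂ).toLinearMap ^ i) (opE ℂ (u (i + 1) * q)) = _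
    rw [Derivation.leibniz, hq, smul_zero, zero_add, hu.E_succ, smul_eq_mul,
      show q * ((((M - i : ℤ)) : MvPolynomial Idx ℂ) * u i) = ((M - i : ℤ) : ℂ) • (u i * q) by
        rw [smul_eq_C_mul]; simp; ring,
      map_smul, ih (by omega), smul_smul, Nat.descFactorial_succ, Nat.cast_mul,
      Nat.cast_sub (by omega)]
    congr 1
    push_cast; ring

/-- Ratio of falling factorials. -/
def drat (m₁ m i : ℕ) : ℚ := (m₁.descFactorial i : ℚ) / (m.descFactorial i : ℚ)

theorem str_mul_str_mem {ω : MvPolynomial Idx ℂ} {n e₁ e₂ : ℕ} (hω : ω ∈ Ssp e₁ e₂ n)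
    {d₁ d₂ f₁ f₂ m₁ m₂ : ℕ} {y₁ y₂ : MvPolynomial Idx ℂ}
    (h₁ : y₁ ∈ Ssp d₁ d₂ m₁) (h₂ : y₂ ∈ Ssp f₁ f₂ m₂) (i j : ℕ) :
    strOf y₁ i * y₂ * strOf ω j - (drat m₁ (m₁ + m₂) i : ℂ) • (strOf (y₁ * y₂) i * strOf ω j) ∈
      Tsp ω n (d₁ + f₁) (d₂ + f₂) (m₁ + m₂) ⊔ imF := by
  rcases lt_or_ge m₁ i with hi | hi
  · rw [(isStr_strOf h₁).zero i hi, drat, Nat.descFactorial_of_lt hi]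
    simp
  have hy := Ssp_mul h₁ h₂
  rw [← Nat.cast_add] at hy
  set m := m₁ + m₂ with hm
  set y := y₁ * y₂ with hy'
  have e1 := E_pow_str_mul (isStr_strOf h₁) h₂.2 i (by omega)
  have e2 := E_pow_str_mul (q := 1) (isStr_strOf hy) (by simp) i (by omega)
  rw [mul_one, mul_one, strOf_zero] at e2
  rw [strOf_zero] at e1
  have hne : ((m.descFactorial i : ℕ) : ℂ) ≠ 0 := by
    exact_mod_cast (Nat.descFactorial_pos.mpr (by omega : i ≤ m)).ne'
  have e3 : ((opE ℂ).toLinearMap ^ i) (strOf y₁ i * y₂ - (drat m₁ m i : ℂ) • strOf y i) = 0 := by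
    rw [map_sub, map_smul, e1, e2, smul_smul, ← sub_smul]
    have : (m₁.descFactorial i : ℂ) - (drat m₁ m i : ℂ) * (m.descFactorial i : ℂ) = 0 := by
      rw [drat]; push_cast; field_simp; ring
    rw [this, zero_smul]
  have e4 : strOf y₁ i * y₂ - (drat m₁ m i : ℂ) • strOf y i ∈
      Wsp (d₁ + f₁) (d₂ + f₂) ((m : ℤ) - 2 * i) := by
    refine sub_mem ?_ (Submodule.smul_mem _ _ (strOf_mem hy.1 i))
    have := Wsp_mul (strOf_mem h₁.1 i) h₂.1
    rwa [show (m₁ : ℤ) - 2 * i + m₂ = m - 2 * i by rw [hm]; push_cast; ring] at this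
  obtain ⟨z, hz, hs⟩ := (slPair _ _).exists_decomp_of_E_pow e4 e3
  rw [← smul_mul_assoc, ← sub_mul, hs, Finset.sum_mul]
  refine sum_mem fun l hl => ?_
  have hl := Finset.mem_range.mp hl
  exact F_pow_mul_str_mem hω (by omega) ⟨(hz l).1, (hz l).2⟩ l j

/-- The scalar relating an iterated transvectant to its leading product. -/
def kapTwo (m₁ m₂ n r₁ r₂ : ℕ) : ℚ :=
  ∑ i ∈ Finset.range (r₂ + 1), ∑ q ∈ Finset.HasAntidiagonal.antidiagonal r₁,
    ((tcoef m₂ n r₂ i * ((i + q.1).choose q.1 * (r₂ - i + q.2).choose q.2 : ℕ) : ℤ) : ℚ) *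
      (drat m₂ (m₂ + m₁) (i + q.1) * ((-1) ^ (i + q.1) * ((r₁ + r₂).choose (i + q.1) : ℕ)))

theorem tvt_eq_sum (m n r : ℕ) (x y : MvPolynomial Idx ℂ) :
    (∑ i ∈ Finset.range (r + 1), ((tcoef m n r i * 1 : ℚ) : ℂ) •
      (strOf x i * strOf y (r - i))) = tvt m n r x y := by
  rw [tvt, trv_zero]
  refine Finset.sum_congr rfl fun i _ => ?_
  rw [smul_eq_C_mul]; simp

theorem tvt_tvt_mem {ω : MvPolynomial Idx ℂ} {n e₁ e₂ : ℕ} (hω : ω ∈ Ssp e₁ e₂ n)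
    {d₁ d₂ f₁ f₂ m₁ m₂ r₁ r₂ n' : ℕ} {y₁ y₂ : MvPolynomial Idx ℂ}
    (h₁ : y₁ ∈ Ssp d₁ d₂ m₁) (h₂ : y₂ ∈ Ssp f₁ f₂ m₂) (hr₁ : r₁ ≤ m₁) (hr₂ : r₂ ≤ m₂)
    (hn : r₁ + r₂ ≤ n) (hn' : (n' : ℤ) = m₂ + n - 2 * r₂) (hr' : r₁ ≤ n')
    (hk : kapTwo m₁ m₂ n r₁ r₂ ≠ 0) :
    ∃ c : ℂ, tvt (m₂ + m₁) n (r₁ + r₂) (y₂ * y₁) ω - c • tvt m₁ n' r₁ y₁ (tvt m₂ n r₂ y₂ ω) ∈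
      Tsp ω n (f₁ + d₁) (f₂ + d₂) (m₂ + m₁) := by
  have hy := Ssp_mul h₂ h₁
  rw [← Nat.cast_add] at hy
  have hW := tvt_mem h₂ hω hr₂ (by omega)
  rw [← hn'] at hW
  set T := Tsp ω n (f₁ + d₁) (f₂ + d₂) (m₂ + m₁) with hT
  have hs := isStr_strOf hω
  set W := tvt m₂ n r₂ y₂ ω with hWdef
  have g1 := tsum_sub_mem (isStr_strOf hW).F_eq y₁ m₁ n' r₁ (fun _ => 1)
  have k1 := kap_pos (n := n') hr₁ (w := fun _ => 1) one_pos (fun _ => zero_le_one)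
  have g2 := tsum_sub_mem hs.F_eq (y₂ * y₁) (m₂ + m₁) n (r₁ + r₂) (fun _ => 1)
  rw [tvt_eq_sum] at g1 g2
  set κ₁ : ℂ := (kap m₁ n' r₁ (fun _ => 1) : ℂ)
  set κ₂ : ℂ := (kap (m₂ + m₁) n (r₁ + r₂) (fun _ => 1) : ℂ)
  have hκ₁ : κ₁ ≠ 0 := by simp only [κ₁]; exact_mod_cast k1.ne'
  have g3 : y₁ * strOf W r₁ - (kapTwo m₁ m₂ n r₁ r₂ : ℂ) • ((y₂ * y₁) * strOf ω (r₁ + r₂)) ∈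
      T ⊔ imF := by
    rw [hWdef, strOf_tvt, trv, kapTwo, Rat.cast_sum, Finset.sum_smul, Finset.mul_sum,
      ← Finset.sum_sub_distrib]
    refine sum_mem fun i hi => ?_
    rw [Rat.cast_sum, Finset.sum_smul, Finset.mul_sum, ← Finset.sum_sub_distrib]
    refine sum_mem fun q hq => ?_
    have hi := Finset.mem_range.mp hi
    have hq := Finset.HasAntidiagonal.mem_antidiagonal.mp hq
    have a1 := str_mul_str_mem hω h₂ h₁ (i + q.1) (r₂ - i + q.2)
    have a2 := strOf_mul_sub_mem hs.F_eq (y₂ * y₁) (i + q.1) (r₂ - i + q.2)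
    rw [show i + q.1 + (r₂ - i + q.2) = r₁ + r₂ by omega] at a2
    have a3 := Submodule.add_mem _ a1 (Submodule.mem_sup_right (S := T)
      (imF.smul_mem (drat m₂ (m₂ + m₁) (i + q.1) : ℂ) a2))
    rw [smul_sub, sub_add_sub_cancel] at a3
    have a4 := Submodule.smul_mem _ ((tcoef m₂ n r₂ i *
      ((i + q.1).choose q.1 * (r₂ - i + q.2).choose q.2 : ℕ) : ℤ) : ℂ) a3
    convert a4 using 1
    rw [smul_sub, smul_smul, smul_smul]
    congr 1
    · rw [smul_eq_C_mul, map_intCast]; ring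
    · congr 1
      push_cast; ring
  have hk' : (kapTwo m₁ m₂ n r₁ r₂ : ℂ) ≠ 0 := by exact_mod_cast hk
  set κ₃ : ℂ := (kapTwo m₁ m₂ n r₁ r₂ : ℂ)
  refine ⟨κ₂ / (κ₁ * κ₃), mem_of_mem_sup_imF (E_Tsp hω) ?_ ?_⟩
  · rw [map_sub, Derivation.map_smul, (mem_Ssp.mp (tvt_mem hy hω (by omega) hn)).2,
      (mem_Ssp.mp (tvt_mem h₁ hW hr₁ hr')).2]
    simp
  · have b1 := Submodule.smul_mem _ κ₁ g3
    have b2 := Submodule.add_mem _ b1 (Submodule.mem_sup_right (S := T) g1)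
    have b3 := Submodule.sub_mem _ (Submodule.mem_sup_right (S := T) g2)
      (Submodule.smul_mem _ (κ₂ / (κ₁ * κ₃)) b2)
    convert b3 using 1
    have : κ₂ / (κ₁ * κ₃) * (κ₁ * κ₃) = κ₂ := div_mul_cancel₀ _ (mul_ne_zero hκ₁ hk')
    have e := congrArg (C (σ := Idx)) this
    simp only [smul_eq_C_mul, map_mul] at e ⊢
    linear_combination ((y₂ * y₁) * strOf ω (r₁ + r₂)) * (-e)

theorem kapTwo_one : kapTwo 2 2 4 1 2 ≠ 0 := by
  decide +kernel

theorem kapTwo_two : kapTwo 2 2 4 2 2 ≠ 0 := by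
  decide +kernel

theorem strOf_add (x y : MvPolynomial Idx ℂ) (s : ℕ) : strOf (x + y) s = strOf x s + strOf y s := by
  simp [strOf]

theorem strOf_smul (c : ℂ) (x : MvPolynomial Idx ℂ) (s : ℕ) : strOf (c • x) s = c • strOf x s := by
  rw [strOf, strOf, map_smul, smul_comm]

theorem tvt_add_left (m n r : ℕ) (x y w : MvPolynomial Idx ℂ) :
    tvt m n r (x + y) w = tvt m n r x w + tvt m n r y w := by
  simp only [tvt, trv_zero, ← Finset.sum_add_distrib, strOf_add]
  exact Finset.sum_congr rfl fun i _ => by ring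

theorem tvt_smul_left (m n r : ℕ) (c : ℂ) (x w : MvPolynomial Idx ℂ) :
    tvt m n r (c • x) w = c • tvt m n r x w := by
  simp only [tvt, trv_zero, Finset.smul_sum, strOf_smul]
  exact Finset.sum_congr rfl fun i _ => by rw [smul_mul_assoc, mul_smul_comm]

theorem tvt_add_right (m n r : ℕ) (x y w : MvPolynomial Idx ℂ) :
    tvt m n r w (x + y) = tvt m n r w x + tvt m n r w y := by
  simp only [tvt, trv_zero, ← Finset.sum_add_distrib, strOf_add]
  exact Finset.sum_congr rfl fun i _ => by ring

theorem tvt_smul_right (m n r : ℕ) (c : ℂ) (x w : MvPolynomial Idx ℂ) :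
    tvt m n r w (c • x) = c • tvt m n r w x := by
  simp only [tvt, trv_zero, Finset.smul_sum, strOf_smul]
  exact Finset.sum_congr rfl fun i _ => by rw [mul_smul_comm, mul_smul_comm]

theorem tvt_index_zero (m n : ℕ) (x w : MvPolynomial Idx ℂ) : tvt m n 0 x w = x * w := by
  rw [tvt, trv_zero]; simp [tcoef, strOf_zero]

theorem tvt_mem_span_left {m n r : ℕ} {w : MvPolynomial Idx ℂ} {S : Set (MvPolynomial Idx ℂ)}
    {T : Submodule ℂ (MvPolynomial Idx ℂ)} (h : ∀ x ∈ S, tvt m n r x w ∈ T)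
    {x : MvPolynomial Idx ℂ} (hx : x ∈ Submodule.span ℂ S) : tvt m n r x w ∈ T := by
  induction hx using Submodule.span_induction with
  | mem x hx => exact h x hx
  | zero => have := tvt_smul_left m n r 0 0 w; simp only [zero_smul] at this; rw [this]; exact T.zero_mem
  | add x y _ _ hx hy => rw [tvt_add_left]; exact T.add_mem hx hy
  | smul c x _ hx => rw [tvt_smul_left]; exact T.smul_mem c hx

theorem tvt_mem_span_right {m n r : ℕ} {w : MvPolynomial Idx ℂ} {S : Set (MvPolynomial Idx ℂ)}
    {T : Submodule ℂ (MvPolynomial Idx ℂ)} (h : ∀ x ∈ S, tvt m n r w x ∈ T)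
    {x : MvPolynomial Idx ℂ} (hx : x ∈ Submodule.span ℂ S) : tvt m n r w x ∈ T := by
  induction hx using Submodule.span_induction with
  | mem x hx => exact h x hx
  | zero => have := tvt_smul_right m n r 0 0 w; simp only [zero_smul] at this; rw [this]; exact T.zero_mem
  | add x y _ _ hx hy => rw [tvt_add_right]; exact T.add_mem hx hy
  | smul c x _ hx => rw [tvt_smul_right]; exact T.smul_mem c hx

theorem F_invariant {d₁ d₂ : ℕ} {q : MvPolynomial Idx ℂ} (hq : q ∈ Ssp d₁ d₂ 0) :
    opF ℂ q = 0 := by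
  have := (isStr_strOf (k := 0) hq).F_eq 0
  rw [(isStr_strOf (k := 0) hq).zero 1 one_pos, strOf_zero] at this
  simpa using this

theorem strOf_invariant_mul {d₁ d₂ : ℕ} {q : MvPolynomial Idx ℂ} (hq : q ∈ Ssp d₁ d₂ 0)
    (x : MvPolynomial Idx ℂ) (s : ℕ) : strOf (q * x) s = q * strOf x s := by
  have h : ∀ s, ((opF ℂ).toLinearMap ^ s) (q * x) = q * ((opF ℂ).toLinearMap ^ s) x := by
    intro s
    induction s with
    | zero => simp
    | succ s ih =>
      rw [pow_succ', Module.End.mul_apply, Module.End.mul_apply, ih]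
      change opF ℂ _ = q * opF ℂ _
      rw [Derivation.leibniz, F_invariant hq, smul_zero, add_zero, smul_eq_mul]
  rw [strOf, strOf, h, mul_smul_comm]

theorem tvt_invariant_mul {d₁ d₂ : ℕ} {q : MvPolynomial Idx ℂ} (hq : q ∈ Ssp d₁ d₂ 0)
    (m n r : ℕ) (x w : MvPolynomial Idx ℂ) : tvt m n r w (q * x) = q * tvt m n r w x := by
  simp only [tvt, trv_zero, Finset.mul_sum, strOf_invariant_mul hq]
  exact Finset.sum_congr rfl fun i _ => by ring

theorem eq_C_of_degree_zero {h : ℤ} {p : MvPolynomial Idx ℂ} (hp : p ∈ Wsp 0 0 h) :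
    ∃ c, p = C c := by
  refine ⟨coeff 0 p, ?_⟩
  rw [p.as_sum]
  rw [Finset.sum_eq_single 0]
  · simp
  · intro s hs hne
    exfalso
    have hw := hp (mem_support_iff.mp hs)
    apply hne
    ext i
    have h1 : (Finsupp.weight wt s).1 + (Finsupp.weight wt s).2.1 = 0 := by rw [hw]; rfl
    have h2 : s i * ((wt i).1 + (wt i).2.1) ≤
        (Finsupp.weight wt s).1 + (Finsupp.weight wt s).2.1 := by
      rw [Finsupp.weight_apply, Finsupp.sum, Prod.snd_sum, Prod.fst_sum, Prod.fst_sum,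
        ← Finset.sum_add_distrib]
      by_cases hi : i ∈ s.support
      · refine le_trans (le_of_eq ?_) (Finset.single_le_sum (fun _ _ => Nat.zero_le _) hi)
        simp [mul_add]
      · simp [Finsupp.notMem_support_iff.mp hi]
    rw [h1] at h2
    have h3 : (wt i).1 + (wt i).2.1 = 1 := by rcases i with i | i <;> simp [wt]
    rw [h3] at h2
    simpa using h2
  · intro h0
    simp [notMem_support_iff.mp h0]

/-- The space of highest weight vectors of a given degree with nonnegative weight. -/
abbrev Sd (δ : ℕ × ℕ × ℕ) : Submodule ℂ (MvPolynomial Idx ℂ) := Ssp δ.1 δ.2.1 δ.2.2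

section Gen
variable {ι : Type} {γ : ι → MvPolynomial Idx ℂ} {dg : ι → ℕ × ℕ × ℕ}

theorem prod_mem_Sd (hγ : ∀ i, γ i ∈ Sd (dg i)) (s : Multiset ι) :
    (s.map γ).prod ∈ Sd (s.map dg).sum := by
  induction s using Multiset.induction with
  | empty =>
    refine mem_Ssp.mpr ⟨?_, by simp⟩
    exact mem_Wsp.mpr (isWeightedHomogeneous_one ℂ wt)
  | cons i s ih =>
    rw [Multiset.map_cons, Multiset.map_cons, Multiset.prod_cons, Multiset.sum_cons]
    have := Ssp_mul (hγ i) ih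
    rwa [← Nat.cast_add] at this

theorem mem_span_monomials (hγ : ∀ i, γ i ∈ Sd (dg i)) {δ : ℕ × ℕ × ℕ} {z : MvPolynomial Idx ℂ}
    (hz : z ∈ Algebra.adjoin ℂ (Set.range γ)) (hz' : z ∈ Sd δ) :
    z ∈ Submodule.span ℂ {p | ∃ s : Multiset ι, (s.map dg).sum = δ ∧ p = (s.map γ).prod} := by
  rw [Algebra.adjoin_range_eq_range_aeval] at hz
  obtain ⟨q, rfl⟩ := hz
  change aeval γ q ∈ _ at hz'
  have h1 : weightedHomogeneousComponent wt ((δ.1, δ.2.1, (δ.2.2 : ℤ)) : Deg)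
      (aeval γ q) = aeval γ q := by
    rw [comp_of_mem (mem_Wsp.mp hz'.1), if_pos rfl]
  change aeval γ q ∈ _
  rw [← h1, q.as_sum, map_sum, map_sum]
  refine sum_mem fun m _ => ?_
  have h2 : aeval γ (monomial m (coeff m q)) =
      coeff m q • ((Finsupp.toMultiset m).map γ).prod := by
    rw [aeval_monomial, Algebra.smul_def]
    congr 1
    rw [Finsupp.toMultiset_map, Finsupp.prod_toMultiset, Finsupp.prod_mapDomain_index]
    · exact fun _ => pow_zero _
    · exact fun _ _ _ => pow_add _ _ _
  rw [h2, map_smul]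
  refine Submodule.smul_mem _ _ ?_
  have h3 := prod_mem_Sd hγ (Finsupp.toMultiset m)
  rw [comp_of_mem (mem_Wsp.mp h3.1)]
  split_ifs with h
  · refine Submodule.subset_span ⟨_, ?_, rfl⟩
    simp only [Prod.mk.injEq, Nat.cast_inj] at h
    exact Prod.ext h.1 (Prod.ext h.2.1 h.2.2)
  · exact zero_mem _

end Gen

theorem Ssp_of_neg {d₁ d₂ : ℕ} {h : ℤ} (hh : h < 0) {p : MvPolynomial Idx ℂ} (hp : p ∈ Ssp d₁ d₂ h) :
    p = 0 :=
  (slPair d₁ d₂).eq_zero_of_neg hh hp.1 hp.2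

theorem zero_lt_cons {ι : Type} (i : ι) (s : Multiset ι) : 0 < i ::ₘ s :=
  pos_iff_ne_zero.mpr Multiset.cons_ne_zero

section Gen
variable {ι : Type} {γ : ι → MvPolynomial Idx ℂ} {dg : ι → ℕ × ℕ × ℕ}
  (hγ : ∀ i, γ i ∈ Sd (dg i)) (hpos : ∀ i, 0 < (dg i).1 + (dg i).2.1)
include hγ hpos

theorem Tsp_le_of_minimal {ω : MvPolynomial Idx ℂ} {n e₁ e₂ d₁ d₂ : ℕ} (hω : ω ∈ Ssp e₁ e₂ n)
    (he : 0 < e₁ + e₂) (hωB : ω ∈ Algebra.adjoin ℂ (Set.range γ))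
    (IH : ∀ (c₁ c₂ : ℕ) (h : ℤ), c₁ + c₂ < d₁ + d₂ + (e₁ + e₂) →
      Ssp c₁ c₂ h ≤ Subalgebra.toSubmodule (Algebra.adjoin ℂ (Set.range γ)))
    (hmin : ∀ (s : Multiset ι) (m r : ℕ), 1 ≤ r → r ≤ n → r ≤ m → (s.map dg).sum = (d₁, d₂, m) →
      (∀ t < s, (t.map dg).sum.2.2 < r) →
      Tsp ω n d₁ d₂ m ≤ Subalgebra.toSubmodule (Algebra.adjoin ℂ (Set.range γ)) →
      tvt m n r (s.map γ).prod ω ∈ Algebra.adjoin ℂ (Set.range γ)) (M : ℕ) :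
    Tsp ω n d₁ d₂ M ≤ Subalgebra.toSubmodule (Algebra.adjoin ℂ (Set.range γ)) := by
  induction M with
  | zero => exact Submodule.span_le.mpr (by rintro t ⟨m, r, z, h, -⟩; omega)
  | succ M ih =>
    refine Submodule.span_le.mpr ?_
    rintro _ ⟨m, r, z, hm, hrm, hrn, hz, rfl⟩
    have hzB : z ∈ Algebra.adjoin ℂ (Set.range γ) := IH d₁ d₂ m (by omega) hz
    rcases Nat.eq_zero_or_pos r with rfl | hr
    · rw [tvt_index_zero]
      exact Subalgebra.mul_mem _ hzB hωB
    refine tvt_mem_span_left (T := Subalgebra.toSubmodule (Algebra.adjoin ℂ (Set.range γ)))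
      ?_ (mem_span_monomials hγ (δ := (d₁, d₂, m)) hzB hz)
    rintro _ ⟨s, hs, rfl⟩
    have hTm := (Tsp_mono (ω := ω) (n := n) (d₁ := d₁) (d₂ := d₂)
      (Nat.lt_succ_iff.mp hm)).trans ih
    by_cases hall : ∀ t < s, (t.map dg).sum.2.2 < r
    · exact hmin s m r hr hrn hrm hs hall hTm
    push Not at hall
    obtain ⟨t, hts, htr⟩ := hall
    obtain ⟨u, rfl⟩ := Multiset.le_iff_exists_add.mp hts.le
    rw [Multiset.map_add, Multiset.sum_add] at hs
    rw [Multiset.map_add, Multiset.prod_add]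
    have p1 := prod_mem_Sd hγ t
    have p2 := prod_mem_Sd hγ u
    have hu : 0 < (u.map dg).sum.1 + (u.map dg).sum.2.1 := by
      rcases Multiset.empty_or_exists_mem u with rfl | ⟨i, hi⟩
      · simp at hts
      · obtain ⟨u', rfl⟩ := Multiset.exists_cons_of_mem hi
        have := hpos i
        rw [Multiset.map_cons, Multiset.sum_cons, Prod.fst_add, Prod.snd_add, Prod.fst_add]
        omega
    generalize (t.map dg).sum = τ at *
    generalize (u.map dg).sum = υ at *
    obtain ⟨t₁, t₂, t₃⟩ := τ
    obtain ⟨u₁, u₂, u₃⟩ := υ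
    simp only [Prod.mk_add_mk, Prod.mk.injEq] at hs
    obtain ⟨rfl, rfl, rfl⟩ := hs
    obtain ⟨c, hc⟩ := tvt_mul_mem hω p1 p2 htr hrn
    have h1 := hTm hc
    have h2 : tvt t₃ n r (t.map γ).prod ω ∈ Algebra.adjoin ℂ (Set.range γ) :=
      IH (t₁ + e₁) (t₂ + e₂) _ (by dsimp only at hu; omega) (tvt_mem p1 hω htr hrn)
    have h3 : (u.map γ).prod ∈ Algebra.adjoin ℂ (Set.range γ) := by
      refine Subalgebra.multiset_prod_mem _ fun x hx => ?_
      obtain ⟨i, -, rfl⟩ := Multiset.mem_map.mp hx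
      exact Algebra.subset_adjoin ⟨i, rfl⟩
    have h4 := Subalgebra.add_mem _ h1 (Subalgebra.smul_mem _ (Subalgebra.mul_mem _ h2 h3) c)
    rwa [sub_add_cancel] at h4

/-- Transvectants of a pair of generators of order two with a generator of order four. -/
theorem tvt_pair_mem {ω : MvPolynomial Idx ℂ} {e₁ e₂ d₁ d₂ f₁ f₂ r₁ : ℕ} (hω : ω ∈ Ssp e₁ e₂ 4)
    {x y : MvPolynomial Idx ℂ} (hx : x ∈ Sd (d₁, d₂, 2)) (hy : y ∈ Sd (f₁, f₂, 2))
    (hd : 0 < d₁ + d₂)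
    (hr : r₁ = 1 ∨ r₁ = 2)
    (IH : ∀ (c₁ c₂ : ℕ) (h : ℤ), c₁ + c₂ < d₁ + d₂ + (f₁ + f₂) + (e₁ + e₂) →
      Ssp c₁ c₂ h ≤ Subalgebra.toSubmodule (Algebra.adjoin ℂ (Set.range γ)))
    (hT : Tsp ω 4 (d₁ + f₁) (d₂ + f₂) 4 ≤
      Subalgebra.toSubmodule (Algebra.adjoin ℂ (Set.range γ)))
    (hno : ∀ i, dg i ≠ (f₁ + e₁, f₂ + e₂, 2))
    (heven : ∀ i, Even (dg i).2.2) :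
    tvt 4 4 (r₁ + 2) (x * y) ω ∈ Algebra.adjoin ℂ (Set.range γ) := by
  have hk : kapTwo 2 2 4 r₁ 2 ≠ 0 := by
    rcases hr with rfl | rfl
    exacts [kapTwo_one, kapTwo_two]
  have hr2 : r₁ ≤ 2 := by omega
  obtain ⟨c, hc⟩ := tvt_tvt_mem (n' := 2) (n := 4) (m₁ := 2) (m₂ := 2) (r₁ := r₁) (r₂ := 2) hω hx hy hr2 le_rfl (by omega) (by norm_num) hr2 hk
  rw [show f₁ + d₁ = d₁ + f₁ from add_comm _ _, show f₂ + d₂ = d₂ + f₂ from add_comm _ _] at hc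
  have h1 := hT hc
  have hW : tvt 2 4 2 y ω ∈ Sd (f₁ + e₁, f₂ + e₂, 2) := by
    have := tvt_mem (r := 2) hy hω le_rfl (by norm_num)
    norm_num at this
    exact this
  have hWB : tvt 2 4 2 y ω ∈ Algebra.adjoin ℂ (Set.range γ) :=
    IH (f₁ + e₁) (f₂ + e₂) _ (by omega) hW
  have h2 : tvt 2 2 r₁ x (tvt 2 4 2 y ω) ∈ Algebra.adjoin ℂ (Set.range γ) := by
    refine tvt_mem_span_right (T := Subalgebra.toSubmodule (Algebra.adjoin ℂ (Set.range γ)))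
      ?_ (mem_span_monomials hγ hWB hW)
    rintro _ ⟨s, hs, rfl⟩
    obtain ⟨i, hi, hki⟩ : ∃ i ∈ s, (dg i).2.2 ≠ 0 := by
      by_contra! hcon
      have : (s.map dg).sum.2.2 = 0 := by
        clear hs
        induction s using Multiset.induction with
        | empty => rfl
        | cons j s ih =>
          rw [Multiset.map_cons, Multiset.sum_cons, Prod.snd_add, Prod.snd_add,
            hcon j (Multiset.mem_cons_self _ _),
            ih fun i hi => hcon i (Multiset.mem_cons_of_mem hi)]
      rw [hs] at this
      exact two_ne_zero this
    obtain ⟨s, rfl⟩ := Multiset.exists_cons_of_mem hi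
    rw [Multiset.map_cons, Multiset.sum_cons] at hs
    have p2 := prod_mem_Sd hγ s
    have p1 := hγ i
    have hne := hno i
    have hev := heven i
    rw [Multiset.map_cons, Multiset.prod_cons]
    have hs0 : 0 < (s.map dg).sum.1 + (s.map dg).sum.2.1 := by
      rcases Multiset.empty_or_exists_mem s with rfl | ⟨j, hj⟩
      · simp at hs; exact absurd hs hne
      · obtain ⟨u', rfl⟩ := Multiset.exists_cons_of_mem hj
        have := hpos j
        rw [Multiset.map_cons, Multiset.sum_cons, Prod.fst_add, Prod.snd_add, Prod.fst_add]
        omega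
    generalize (s.map dg).sum = τ at *
    generalize dg i = υ at *
    obtain ⟨t₁, t₂, t₃⟩ := τ
    obtain ⟨u₁, u₂, u₃⟩ := υ
    simp only [Prod.mk_add_mk, Prod.mk.injEq] at hs
    obtain ⟨hs1, hs2, hs3⟩ := hs
    dsimp only at hki hev hs0
    obtain ⟨rfl, rfl⟩ : u₃ = 2 ∧ t₃ = 0 := by
      obtain ⟨v, rfl⟩ := hev; omega
    rw [mul_comm, tvt_invariant_mul p2]
    refine Subalgebra.mul_mem _ ?_ ?_
    · refine Subalgebra.multiset_prod_mem _ fun x hx => ?_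
      obtain ⟨i, -, rfl⟩ := Multiset.mem_map.mp hx
      exact Algebra.subset_adjoin ⟨i, rfl⟩
    · refine IH (d₁ + u₁) (d₂ + u₂) _ (by omega) (tvt_mem hx p1 hr2 hr2)
  have h3 := Subalgebra.add_mem _ h1 (Subalgebra.smul_mem _ h2 c)
  rw [sub_add_cancel] at h3
  rw [mul_comm x y, add_comm r₁ 2]
  rwa [add_comm r₁ 2] at h3

/-- The generation criterion: a family of highest weight vectors generates all of them as soon as
finitely many degrees can be checked inductively. -/
theorem generation (ha : ca ℂ 0 ∈ Algebra.adjoin ℂ (Set.range γ))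
    (hb : cb ℂ 0 ∈ Algebra.adjoin ℂ (Set.range γ)) (heven : ∀ i, Even (dg i).2.2)
    (K : ℕ × ℕ × ℕ → Prop)
    (hK : ∀ δ, K δ → (∀ (c₁ c₂ : ℕ) (h : ℤ), c₁ + c₂ < δ.1 + δ.2.1 →
        Ssp c₁ c₂ h ≤ Subalgebra.toSubmodule (Algebra.adjoin ℂ (Set.range γ))) →
      Sd δ ≤ Subalgebra.toSubmodule (Algebra.adjoin ℂ (Set.range γ)))
    (hg₁ : ∀ i r, 1 ≤ r → r ≤ 4 → r ≤ (dg i).2.2 →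
      K ((dg i).1, (dg i).2.1 + 1, (dg i).2.2 + 4 - 2 * r))
    (hg₂ : ∀ i j r, r = 3 ∨ r = 4 → (dg i).2.2 = 2 → (dg j).2.2 = 2 →
      K ((dg i).1 + (dg j).1, (dg i).2.1 + (dg j).2.1 + 1, 8 - 2 * r) ∨
        (∀ l, dg l ≠ ((dg i).1, (dg i).2.1 + 1, 2)) ∨ ∀ l, dg l ≠ ((dg j).1, (dg j).2.1 + 1, 2))
    (hf₁ : ∀ i r, (dg i).2.1 = 0 → 1 ≤ r → r ≤ 6 → r ≤ (dg i).2.2 →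
      K ((dg i).1 + 1, 0, (dg i).2.2 + 6 - 2 * r))
    (hf₂ : ∀ i j r, (dg i).2.1 = 0 → (dg j).2.1 = 0 → (dg i).2.2 < r → (dg j).2.2 < r → r ≤ 6 →
      r ≤ (dg i).2.2 + (dg j).2.2 →
      K ((dg i).1 + (dg j).1 + 1, 0, (dg i).2.2 + (dg j).2.2 + 6 - 2 * r))
    (hf₃ : ∀ i j l r, (dg i).2.1 = 0 → (dg j).2.1 = 0 → (dg l).2.1 = 0 → (dg i).2.2 = 2 →
      (dg j).2.2 = 2 → (dg l).2.2 = 2 → r = 5 ∨ r = 6 →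
      K ((dg i).1 + (dg j).1 + (dg l).1 + 1, 0, 12 - 2 * r)) (N : ℕ) :
    ∀ (d₁ d₂ : ℕ) (h : ℤ), d₁ + d₂ = N →
      Ssp d₁ d₂ h ≤ Subalgebra.toSubmodule (Algebra.adjoin ℂ (Set.range γ)) := by
  induction N using Nat.strong_induction_on with
  | _ N ih =>
  intro d₁ d₂ h hN
  have ih' : ∀ (c₁ c₂ : ℕ) (h : ℤ), c₁ + c₂ < N →
      Ssp c₁ c₂ h ≤ Subalgebra.toSubmodule (Algebra.adjoin ℂ (Set.range γ)) :=
    fun c₁ c₂ h hc => ih _ hc c₁ c₂ h rfl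
  have hev2 : ∀ i, (dg i).2.2 = 0 ∨ 2 ≤ (dg i).2.2 := by
    intro i
    obtain ⟨v, hv⟩ := heven i
    omega
  have hdrop : ∀ (i : ι) (s : Multiset ι) (m r : ℕ), r ≤ m → ((i ::ₘ s).map dg).sum.2.2 = m →
      (∀ t < i ::ₘ s, (t.map dg).sum.2.2 < r) → 2 ≤ (dg i).2.2 := by
    intro i s m r h1 h2 h3
    have h4 := h3 s (Multiset.lt_cons_self _ _)
    rw [Multiset.map_cons, Multiset.sum_cons, Prod.snd_add, Prod.snd_add] at h2
    have := hev2 i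
    omega
  have hprod : ∀ (s : Multiset ι) (d₁ d₂ m : ℕ), (s.map dg).sum = (d₁, d₂, m) →
      (s.map γ).prod ∈ Ssp d₁ d₂ m := by
    intro s d₁ d₂ m hs
    have := prod_mem_Sd hγ s
    rwa [hs] at this
  rcases d₂ with - | d₂
  · rcases d₁ with - | d₁
    · intro p hp
      obtain ⟨c, rfl⟩ := eq_C_of_degree_zero hp.1
      exact Subalgebra.algebraMap_mem _ c
    · refine fun p hp => Tsp_le_of_minimal hγ hpos a0_mem (by norm_num) ha
        (fun c₁ c₂ h hc => ih' c₁ c₂ h (by omega)) ?_ _ (Ssp_le_Tsp_ca hp)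
      intro s m r hr1 hr6 hrm hs hall hT
      have hd2 : ∀ i ∈ s, (dg i).2.1 = 0 := by
        intro i hi
        obtain ⟨u, rfl⟩ := Multiset.exists_cons_of_mem hi
        have := congrArg (fun δ => δ.2.1) hs
        simp only [Multiset.map_cons, Multiset.sum_cons, Prod.snd_add, Prod.fst_add] at this
        omega
      have key : K (d₁ + 1, 0, m + 6 - 2 * r) →
          tvt m 6 r (s.map γ).prod (ca ℂ 0) ∈ Algebra.adjoin ℂ (Set.range γ) := by
        intro hKK
        refine hK _ hKK (fun c₁ c₂ h hc => ih' c₁ c₂ h (by dsimp only at hc; omega)) ?_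
        have := tvt_mem (hprod s _ _ _ hs) a0_mem hrm hr6
        rw [show (m : ℤ) + (6 : ℕ) - 2 * r = ((m + 6 - 2 * r : ℕ) : ℤ) by omega] at this
        exact this
      apply key
      have hm : (s.map dg).sum.2.2 = m := by rw [hs]
      rcases Multiset.empty_or_exists_mem s with rfl | ⟨i, hi⟩
      · simp at hm; omega
      obtain ⟨s, rfl⟩ := Multiset.exists_cons_of_mem hi
      have hi2 := hdrop i s m r hrm hm hall
      have hi0 := hd2 i (by simp)
      rcases Multiset.empty_or_exists_mem s with rfl | ⟨j, hj⟩
      · simp at hs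
        rw [hs] at hi0 hi2
        have := hf₁ i r (by rw [hs]) hr1 hr6 (by rw [hs]; exact hrm)
        rwa [hs] at this
      obtain ⟨s, rfl⟩ := Multiset.exists_cons_of_mem hj
      have hj2 := hdrop j (i ::ₘ s) m r hrm (by rw [Multiset.cons_swap]; exact hm)
        (by rw [Multiset.cons_swap]; exact hall)
      have hj0 := hd2 j (by simp)
      have hi' := hall {i} (by
        rw [← Multiset.cons_zero]
        exact (Multiset.cons_lt_cons_iff (a := i)).mpr (zero_lt_cons _ _))
      have hj' := hall {j} (by
        rw [← Multiset.cons_zero, Multiset.cons_swap]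
        exact (Multiset.cons_lt_cons_iff (a := j)).mpr (zero_lt_cons _ _))
      simp only [Multiset.map_singleton, Multiset.sum_singleton] at hi' hj'
      rcases Multiset.empty_or_exists_mem s with rfl | ⟨l, hl⟩
      · simp only [Multiset.map_cons, Multiset.sum_cons, Multiset.map_zero, Multiset.sum_zero,
          add_zero] at hs
        have h1 : (dg i).1 + (dg j).1 = d₁ := congrArg (fun δ => δ.1) hs
        have h3 : (dg i).2.2 + (dg j).2.2 = m := congrArg (fun δ => δ.2.2) hs
        have := hf₂ i j r hi0 hj0 hi' hj' hr6 (by omega)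
        rwa [h1, h3] at this
      obtain ⟨s, rfl⟩ := Multiset.exists_cons_of_mem hl
      have hl2 := hdrop l (i ::ₘ j ::ₘ s) m r hrm
        (by rw [Multiset.cons_swap l i, Multiset.cons_swap l j]; exact hm)
        (by rw [Multiset.cons_swap l i, Multiset.cons_swap l j]; exact hall)
      have hl0 := hd2 l (by simp)
      have hij := hall {i, j} (by
        rw [show ({i, j} : Multiset ι) = i ::ₘ j ::ₘ 0 from rfl]
        exact (Multiset.cons_lt_cons_iff (a := i)).mpr
          ((Multiset.cons_lt_cons_iff (a := j)).mpr (zero_lt_cons _ _)))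
      have hil := hall {i, l} (by
        rw [show ({i, l} : Multiset ι) = i ::ₘ l ::ₘ 0 from rfl, Multiset.cons_swap j l]
        exact (Multiset.cons_lt_cons_iff (a := i)).mpr
          ((Multiset.cons_lt_cons_iff (a := l)).mpr (zero_lt_cons _ _)))
      simp only [Multiset.insert_eq_cons, Multiset.map_cons, Multiset.sum_cons,
        Multiset.map_singleton, Multiset.sum_singleton, Prod.snd_add] at hij hil
      obtain ⟨u, hu⟩ := heven i
      obtain ⟨v, hv⟩ := heven j
      obtain ⟨w, hw⟩ := heven l
      rcases Multiset.empty_or_exists_mem s with rfl | ⟨q, hq⟩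
      · simp only [Multiset.map_cons, Multiset.sum_cons, Multiset.map_zero, Multiset.sum_zero,
          add_zero] at hs
        have h1 : (dg i).1 + ((dg j).1 + (dg l).1) = d₁ := congrArg (fun δ => δ.1) hs
        have h3 : (dg i).2.2 + ((dg j).2.2 + (dg l).2.2) = m := congrArg (fun δ => δ.2.2) hs
        have := hf₃ i j l r hi0 hj0 hl0 (by omega) (by omega) (by omega) (by omega)
        rw [add_assoc (dg i).1, h1] at this
        rwa [show m + 6 - 2 * r = 12 - 2 * r by omega]
      · obtain ⟨s, rfl⟩ := Multiset.exists_cons_of_mem hq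
        have h3 := hall {i, j, l} (by
          rw [show ({i, j, l} : Multiset ι) = i ::ₘ j ::ₘ l ::ₘ 0 from rfl]
          exact (Multiset.cons_lt_cons_iff (a := i)).mpr
            ((Multiset.cons_lt_cons_iff (a := j)).mpr
              ((Multiset.cons_lt_cons_iff (a := l)).mpr (zero_lt_cons _ _))))
        simp only [Multiset.insert_eq_cons, Multiset.map_cons, Multiset.sum_cons,
          Multiset.map_singleton, Multiset.sum_singleton, Prod.snd_add] at h3
        omega
  · refine fun p hp => Tsp_le_of_minimal hγ hpos b0_mem (by norm_num) hb
      (fun c₁ c₂ h hc => ih' c₁ c₂ h (by omega)) ?_ _ (Ssp_le_Tsp_cb hp)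
    intro s m r hr1 hr4 hrm hs hall hT
    have key : K (d₁, d₂ + 1, m + 4 - 2 * r) →
        tvt m 4 r (s.map γ).prod (cb ℂ 0) ∈ Algebra.adjoin ℂ (Set.range γ) := by
      intro hKK
      refine hK _ hKK (fun c₁ c₂ h hc => ih' c₁ c₂ h (by dsimp only at hc; omega)) ?_
      have := tvt_mem (hprod s _ _ _ hs) b0_mem hrm hr4
      rw [show (m : ℤ) + (4 : ℕ) - 2 * r = ((m + 4 - 2 * r : ℕ) : ℤ) by omega] at this
      exact this
    have hm : (s.map dg).sum.2.2 = m := by rw [hs]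
    rcases Multiset.empty_or_exists_mem s with rfl | ⟨i, hi⟩
    · simp at hm; omega
    obtain ⟨s, rfl⟩ := Multiset.exists_cons_of_mem hi
    have hi2 := hdrop i s m r hrm hm hall
    rcases Multiset.empty_or_exists_mem s with rfl | ⟨j, hj⟩
    · simp at hs
      apply key
      have := hg₁ i r hr1 hr4 (by rw [hs]; exact hrm)
      rwa [hs] at this
    obtain ⟨s, rfl⟩ := Multiset.exists_cons_of_mem hj
    have hj2 := hdrop j (i ::ₘ s) m r hrm (by rw [Multiset.cons_swap]; exact hm)
      (by rw [Multiset.cons_swap]; exact hall)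
    have hi' := hall {i} (by
      rw [← Multiset.cons_zero]
      exact (Multiset.cons_lt_cons_iff (a := i)).mpr (zero_lt_cons _ _))
    have hj' := hall {j} (by
      rw [← Multiset.cons_zero, Multiset.cons_swap]
      exact (Multiset.cons_lt_cons_iff (a := j)).mpr (zero_lt_cons _ _))
    simp only [Multiset.map_singleton, Multiset.sum_singleton] at hi' hj'
    obtain ⟨u, hu⟩ := heven i
    obtain ⟨v, hv⟩ := heven j
    rcases Multiset.empty_or_exists_mem s with rfl | ⟨l, hl⟩
    · simp only [Multiset.map_cons, Multiset.sum_cons, Multiset.map_zero, Multiset.sum_zero,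
        add_zero] at hs
      have hik : (dg i).2.2 = 2 := by omega
      have hjk : (dg j).2.2 = 2 := by omega
      have h1 : (dg i).1 + (dg j).1 = d₁ := congrArg (fun δ => δ.1) hs
      have h2 : (dg i).2.1 + (dg j).2.1 = d₂ := congrArg (fun δ => δ.2.1) hs
      have h3 : (dg i).2.2 + (dg j).2.2 = m := congrArg (fun δ => δ.2.2) hs
      have hm4 : m = 4 := by omega
      subst hm4
      rcases hg₂ i j r (by omega) hik hjk with hKK | hno | hno
      · apply key
        rwa [h1, h2] at hKK
      · have h4 := tvt_pair_mem hγ hpos b0_mem (r₁ := r - 2) (x := γ j) (y := γ i) (d₁ := (dg j).1)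
          (d₂ := (dg j).2.1) (f₁ := (dg i).1) (f₂ := (dg i).2.1)
          (by have := hγ j; rwa [← hjk]) (by have := hγ i; rwa [← hik]) (hpos j)
          (by omega) (fun c₁ c₂ h hc => ih' c₁ c₂ h (by omega))
          (by rwa [add_comm, h1, add_comm, h2]) hno heven
        rw [show r - 2 + 2 = r by omega] at h4
        simpa [mul_comm] using h4
      · have h4 := tvt_pair_mem hγ hpos b0_mem (r₁ := r - 2) (x := γ i) (y := γ j) (d₁ := (dg i).1)
          (d₂ := (dg i).2.1) (f₁ := (dg j).1) (f₂ := (dg j).2.1)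
          (by have := hγ i; rwa [← hik]) (by have := hγ j; rwa [← hjk]) (hpos i)
          (by omega) (fun c₁ c₂ h hc => ih' c₁ c₂ h (by omega))
          (by rwa [h1, h2]) hno heven
        rw [show r - 2 + 2 = r by omega] at h4
        simpa using h4
    · obtain ⟨s, rfl⟩ := Multiset.exists_cons_of_mem hl
      have hij := hall {i, j} (by
        rw [show ({i, j} : Multiset ι) = i ::ₘ j ::ₘ 0 from rfl]
        exact (Multiset.cons_lt_cons_iff (a := i)).mpr
          ((Multiset.cons_lt_cons_iff (a := j)).mpr (zero_lt_cons _ _)))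
      simp only [Multiset.insert_eq_cons, Multiset.map_cons, Multiset.sum_cons,
        Multiset.map_singleton, Multiset.sum_singleton, Prod.snd_add] at hij
      omega

end Gen

theorem land_add_mul {K a b x y : ℕ} (ha : a < 2 ^ K) (hb : b < 2 ^ K) :
    (a + 2 ^ K * x) &&& (b + 2 ^ K * y) = (a &&& b) + 2 ^ K * (x &&& y) := by
  have h0 : 0 < 2 ^ K := by positivity
  have h1 : ((a + 2 ^ K * x) &&& (b + 2 ^ K * y)) % 2 ^ K = a &&& b := by
    rw [Nat.and_mod_two_pow, Nat.add_mul_mod_self_left, Nat.add_mul_mod_self_left,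
      Nat.mod_eq_of_lt ha, Nat.mod_eq_of_lt hb]
  have h2 : ((a + 2 ^ K * x) &&& (b + 2 ^ K * y)) / 2 ^ K = x &&& y := by
    rw [Nat.and_div_two_pow, Nat.add_mul_div_left _ _ h0, Nat.add_mul_div_left _ _ h0,
      Nat.div_eq_of_lt ha, Nat.div_eq_of_lt hb, zero_add, zero_add]
  rw [← Nat.mod_add_div ((a + 2 ^ K * x) &&& (b + 2 ^ K * y)) (2 ^ K), h1, h2]

theorem sum_range_succ_base (K len : ℕ) (d : ℕ → ℕ) :
    ∑ i ∈ Finset.range (len + 1), d i * (2 ^ K) ^ i =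
      d 0 + 2 ^ K * ∑ i ∈ Finset.range len, d (i + 1) * (2 ^ K) ^ i := by
  rw [Finset.sum_range_succ', add_comm, Finset.mul_sum]
  simp only [pow_zero, mul_one]
  congr 1
  refine Finset.sum_congr rfl fun i _ => ?_
  ring

theorem land_sum (K len : ℕ) : ∀ (d e : ℕ → ℕ), (∀ i, d i < 2 ^ K) → (∀ i, e i < 2 ^ K) →
    (∑ i ∈ Finset.range len, d i * (2 ^ K) ^ i) &&& (∑ i ∈ Finset.range len, e i * (2 ^ K) ^ i) =
      ∑ i ∈ Finset.range len, (d i &&& e i) * (2 ^ K) ^ i := by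
  induction len with
  | zero => simp
  | succ len ih =>
    intro d e hd he
    rw [sum_range_succ_base, sum_range_succ_base, sum_range_succ_base K len fun i => d i &&& e i,
      land_add_mul (hd 0) (he 0), ih _ _ (fun i => hd _) fun i => he _]

theorem sum_lt_base (K len : ℕ) : ∀ (d : ℕ → ℕ), (∀ i, d i < 2 ^ K) →
    ∑ i ∈ Finset.range len, d i * (2 ^ K) ^ i < (2 ^ K) ^ len := by
  induction len with
  | zero => simp
  | succ len ih =>
    intro d hd
    rw [Finset.sum_range_succ]
    have h1 := ih d hd
    have h2 : (d len + 1) * (2 ^ K) ^ len ≤ 2 ^ K * (2 ^ K) ^ len :=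
      Nat.mul_le_mul_right _ (hd len)
    rw [pow_succ']
    linarith

/-- Evaluate a number before passing it on. -/
def force {α : Type} (n : Nat) (k : Nat → α) : α :=
  Nat.rec (k 0) (fun m _ => k (Nat.succ m)) n

theorem force_eq {α : Type} (n : ℕ) (k : ℕ → α) : force n k = k n := by
  cases n <;> rfl

/-- Add the high part of every digit selected by the mask to its 13 low bits. -/
def foldOnce (M n : Nat) : Nat :=
  Nat.add (Nat.land n M) (Nat.shiftRight (Nat.sub n (Nat.land n M)) 13)

/-- The periodic mask selecting the 13 low bits of each of `len` digits. -/
def digitMask (K len : ℕ) : ℕ := ∑ i ∈ Finset.range len, 8191 * (2 ^ K) ^ i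

theorem foldOnce_sum {K len : ℕ} (hK : 13 ≤ K) {d : ℕ → ℕ} (hd : ∀ i, d i < 2 ^ K) :
    foldOnce (digitMask K len) (∑ i ∈ Finset.range len, d i * (2 ^ K) ^ i) =
      ∑ i ∈ Finset.range len, (d i % 2 ^ 13 + d i / 2 ^ 13) * (2 ^ K) ^ i := by
  have h1 : (∑ i ∈ Finset.range len, d i * (2 ^ K) ^ i).land (digitMask K len) =
      ∑ i ∈ Finset.range len, (d i % 2 ^ 13) * (2 ^ K) ^ i := by
    have := land_sum K len d (fun _ => 8191) hd fun _ =>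
      lt_of_lt_of_le (by norm_num : 8191 < 2 ^ 13) (Nat.pow_le_pow_right (by norm_num) hK)
    refine Eq.trans this (Finset.sum_congr rfl fun i _ => ?_)
    congr 1
    exact Nat.and_two_pow_sub_one_eq_mod (d i) 13
  have h2 : ∑ i ∈ Finset.range len, d i * (2 ^ K) ^ i =
      ∑ i ∈ Finset.range len, (d i % 2 ^ 13) * (2 ^ K) ^ i +
      (∑ i ∈ Finset.range len, (d i / 2 ^ 13) * (2 ^ K) ^ i) * 2 ^ 13 := by
    rw [Finset.sum_mul, ← Finset.sum_add_distrib]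
    refine Finset.sum_congr rfl fun i _ => ?_
    conv_lhs => rw [← Nat.mod_add_div (d i) (2 ^ 13)]
    ring
  unfold foldOnce
  rw [h1]
  simp only [Nat.add_eq, Nat.sub_eq]
  conv_lhs => rw [h2]
  rw [Nat.add_sub_cancel_left]
  change _ + (_ >>> 13) = _
  rw [Nat.shiftRight_eq_div_pow, Nat.mul_div_cancel _ (by positivity), ← Finset.sum_add_distrib]
  refine Finset.sum_congr rfl fun i _ => ?_
  ring

/-- `n` has `len` digits smaller than `b` in base `2 ^ K`, congruent to the values `v`. -/
def Row (K len b n : ℕ) (v : ℕ → ZMod 8191) : Prop :=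
  ∃ d : ℕ → ℕ, (∀ i, d i < b) ∧ n = ∑ i ∈ Finset.range len, d i * (2 ^ K) ^ i ∧
    ∀ i < len, (d i : ZMod 8191) = v i

namespace Row
variable {K len b b' n n' : ℕ} {v v' : ℕ → ZMod 8191}

theorem mono (h : Row K len b n v) (hb : b ≤ b') : Row K len b' n v := by
  obtain ⟨d, h1, h2, h3⟩ := h
  exact ⟨d, fun i => (h1 i).trans_le hb, h2, h3⟩

theorem congr (h : Row K len b n v) (hv : ∀ i < len, v i = v' i) : Row K len b n v' := by
  obtain ⟨d, h1, h2, h3⟩ := h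
  exact ⟨d, h1, h2, fun i hi => (h3 i hi).trans (hv i hi)⟩

theorem zero (hb : 0 < b) : Row K len b 0 0 :=
  ⟨0, fun _ => hb, by simp, fun _ _ => by simp⟩

theorem add (h : Row K len b n v) (h' : Row K len b' n' v') :
    Row K len (b + b') (n + n') (v + v') := by
  obtain ⟨d, h1, h2, h3⟩ := h
  obtain ⟨d', h1', h2', h3'⟩ := h'
  refine ⟨d + d', fun i => Nat.add_lt_add (h1 i) (h1' i), ?_, fun i hi => ?_⟩
  · rw [h2, h2', ← Finset.sum_add_distrib]
    exact Finset.sum_congr rfl fun i _ => (add_mul _ _ _).symm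
  · simp [h3 i hi, h3' i hi]

theorem smul (h : Row K len b n v) {c B : ℕ} (hc : c ≤ B) (hB : 0 < B) :
    Row K len (B * b) (c * n) (fun i => (c : ZMod 8191) * v i) := by
  obtain ⟨d, h1, h2, h3⟩ := h
  refine ⟨fun i => c * d i, fun i => ?_, ?_, fun i hi => ?_⟩
  · exact lt_of_le_of_lt (Nat.mul_le_mul_right _ hc) (Nat.mul_lt_mul_of_pos_left (h1 i) hB)
  · rw [h2, Finset.mul_sum]
    exact Finset.sum_congr rfl fun i _ => (mul_assoc _ _ _).symm
  · simp [h3 i hi]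

theorem foldOnce (h : Row K len b n v) (hK : 13 ≤ K) (hb : b ≤ 2 ^ K) {c : ℕ}
    (hc : b ≤ 2 ^ 13 * c) : Row K len (2 ^ 13 + c) (foldOnce (digitMask K len) n) v := by
  obtain ⟨d, h1, h2, h3⟩ := h
  refine ⟨fun i => d i % 2 ^ 13 + d i / 2 ^ 13, fun i => ?_, ?_, fun i hi => ?_⟩
  · have := Nat.mod_lt (d i) (by norm_num : 0 < 2 ^ 13)
    have h4 : d i / 2 ^ 13 < c := Nat.div_lt_of_lt_mul ((h1 i).trans_le hc)
    change d i % 2 ^ 13 + d i / 2 ^ 13 < _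
    omega
  · rw [h2]
    exact foldOnce_sum hK fun i => (h1 i).trans_le hb
  · rw [← h3 i hi]
    conv_rhs => rw [← Nat.mod_add_div (d i) (2 ^ 13)]
    push_cast
    have : (8192 : ZMod 8191) = 1 := by decide
    rw [this, one_mul]

end Row

/-- Fold the digits twice and continue. -/
def foldTwice {α : Type} (M n : Nat) (K : Nat → α) : α :=
  force n fun n => force (foldOnce M n) fun n => force (foldOnce M n) K

theorem foldTwice_eq {α : Type} (M n : ℕ) (K : ℕ → α) :
    foldTwice M n K = K (foldOnce M (foldOnce M n)) := by
  simp only [foldTwice, force_eq]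

theorem Row.foldTwice {len b n : ℕ} {v : ℕ → ZMod 8191} (h : Row 36 len b n v) (hb : b ≤ 2 ^ 36) :
    Row 36 len (2 ^ 14) (_root_.foldOnce (digitMask 36 len) (_root_.foldOnce (digitMask 36 len) n)) v := by
  have h1 := ((h.mono hb).foldOnce (by norm_num) le_rfl (c := 2 ^ 23) (by norm_num)).foldOnce
    (by norm_num) (by norm_num) (c := 2 ^ 12) (by norm_num)
  exact h1.mono (by norm_num)

/-- The low `2 ^ (K * len)` part. -/
theorem land_low (k n : ℕ) : Nat.land n (Nat.sub (2 ^ k) 1) = n % 2 ^ k :=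
  Nat.and_two_pow_sub_one_eq_mod n k

theorem sum_mod_base {K len len' : ℕ} (h : len ≤ len') {d : ℕ → ℕ} (hd : ∀ i, d i < 2 ^ K) :
    (∑ i ∈ Finset.range len', d i * (2 ^ K) ^ i) % (2 ^ K) ^ len =
      ∑ i ∈ Finset.range len, d i * (2 ^ K) ^ i := by
  obtain ⟨c, rfl⟩ := Nat.exists_eq_add_of_le h
  rw [Finset.sum_range_add]
  have : ∑ x ∈ Finset.range c, d (len + x) * (2 ^ K) ^ (len + x) =
      (2 ^ K) ^ len * ∑ x ∈ Finset.range c, d (len + x) * (2 ^ K) ^ x := by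
    rw [Finset.mul_sum]
    refine Finset.sum_congr rfl fun i _ => ?_
    ring
  rw [this, Nat.add_mul_mod_self_left, Nat.mod_eq_of_lt (sum_lt_base K len d hd)]

theorem Row.trunc {K len len' b n : ℕ} {v : ℕ → ZMod 8191} (h : Row K len' b n v)
    (hl : len ≤ len') (hb : b ≤ 2 ^ K) : Row K len b (n % 2 ^ (K * len)) v := by
  obtain ⟨d, h1, h2, h3⟩ := h
  refine ⟨d, h1, ?_, fun i hi => h3 i (hi.trans_le hl)⟩
  rw [h2, pow_mul]
  exact sum_mod_base hl fun i => (h1 i).trans_le hb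

theorem Row.mul {K len b n n' : ℕ} {f g : PowerSeries (ZMod 8191)} {B : ℕ}
    (h : Row K len b n fun i => PowerSeries.coeff i f)
    (h' : Row K len b n' fun i => PowerSeries.coeff i g) (hb : 0 < b) (hl : 0 < len)
    (hB : len * b ^ 2 ≤ B) (hK : B ≤ 2 ^ K) :
    Row K len B (n * n' % 2 ^ (K * len)) fun i => PowerSeries.coeff i (f * g) := by
  obtain ⟨d, h1, h2, h3⟩ := h
  obtain ⟨e, h1', h2', h3'⟩ := h'
  have key : Row K (2 * len) B (n * n') fun i =>
      ((∑ q ∈ Finset.HasAntidiagonal.antidiagonal i,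
        (if q.1 < len then d q.1 else 0) * (if q.2 < len then e q.2 else 0) : ℕ) : ZMod 8191) := by
    refine ⟨_, fun i => ?_, ?_, fun i _ => rfl⟩
    · have h4 : ∀ q ∈ Finset.HasAntidiagonal.antidiagonal i,
          (if q.1 < len then d q.1 else 0) * (if q.2 < len then e q.2 else 0) ≤
            if q.1 < len then (b - 1) ^ 2 else 0 := by
        intro q _
        split_ifs with h5 h6
        · rw [pow_two]
          exact Nat.mul_le_mul (Nat.le_sub_one_of_lt (h1 _)) (Nat.le_sub_one_of_lt (h1' _))
        · simp
        · simp
        · simp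
      refine lt_of_le_of_lt (Finset.sum_le_sum h4) (lt_of_le_of_lt (b := len * (b - 1) ^ 2) ?_ ?_)
      · rw [Finset.Nat.sum_antidiagonal_eq_sum_range_succ_mk, ← Finset.sum_filter, Finset.sum_const,
          smul_eq_mul]
        refine Nat.mul_le_mul_right _ ((Finset.card_le_card (t := Finset.range len) ?_).trans (by simp))
        intro x
        simp
      · refine lt_of_lt_of_le (Nat.mul_lt_mul_of_pos_left ?_ hl) hB
        exact Nat.pow_lt_pow_left (Nat.sub_lt hb one_pos) (by norm_num)
    · have h5 : ∀ (d : ℕ → ℕ), ∑ i ∈ Finset.range len, d i * (2 ^ K) ^ i =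
          ((∑ i ∈ Finset.range len, Polynomial.C (d i) * Polynomial.X ^ i : Polynomial ℕ)).eval
            (2 ^ K) := by
        intro d
        simp [Polynomial.eval_finsetSum]
      have h6 : ∀ (d : ℕ → ℕ) (j : ℕ), (∑ i ∈ Finset.range len, Polynomial.C (d i) *
          Polynomial.X ^ i : Polynomial ℕ).coeff j = if j < len then d j else 0 := by
        intro d j
        rw [Polynomial.finsetSum_coeff]
        simp [Polynomial.coeff_X_pow]
      have h7 : ∀ (d : ℕ → ℕ), (∑ i ∈ Finset.range len, Polynomial.C (d i) *
          Polynomial.X ^ i : Polynomial ℕ).natDegree < len := by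
        intro d
        by_contra! hc
        have h8 := (h6 d _).trans (if_neg (not_lt.mpr hc))
        rw [Polynomial.coeff_natDegree, Polynomial.leadingCoeff_eq_zero] at h8
        rw [h8, Polynomial.natDegree_zero] at hc
        omega
      rw [h2, h2', h5, h5, ← Polynomial.eval_mul, Polynomial.eval_eq_sum_range' (n := 2 * len)]
      · refine Finset.sum_congr rfl fun i _ => ?_
        rw [Polynomial.coeff_mul]
        simp only [h6]
      · refine lt_of_le_of_lt Polynomial.natDegree_mul_le ?_
        have := h7 d
        have := h7 e
        omega
  refine ((key.trunc (by omega) hK).congr fun i hi => ?_)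
  rw [PowerSeries.coeff_mul]
  push_cast
  refine Finset.sum_congr rfl fun q hq => ?_
  have := Finset.HasAntidiagonal.mem_antidiagonal.mp hq
  rw [if_pos (by omega), if_pos (by omega), h3 _ (by omega), h3' _ (by omega)]

/-- List lookup with default value. -/
def getAt {α : Type} (d : α) (l : List α) : Nat → α :=
  List.rec (fun _ => d) (fun x _ ih n => Nat.rec x (fun m _ => ih m) n) l

theorem getAt_eq {α : Type} (d : α) (l : List α) : ∀ n, getAt d l n = l.getD n d := by
  induction l with
  | nil => intro n; rfl
  | cons x l ih =>
    intro n
    cases n with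
    | zero => rfl
    | succ n => exact ih n

/-- Descending factorial. -/
def dfac (n k : Nat) : Nat := Nat.rec 1 (fun j ih => Nat.mul (Nat.sub n j) ih) k

theorem dfac_eq (n k : ℕ) : dfac n k = n.descFactorial k := by
  induction k with
  | zero => rfl
  | succ k ih =>
    rw [Nat.descFactorial_succ, ← ih]
    rfl

/-- Binomial coefficient. -/
def binom (n k : Nat) : Nat := Nat.div (dfac n k) (dfac k k)

theorem binom_eq (n k : ℕ) : binom n k = n.choose k := by
  rw [Nat.choose_eq_descFactorial_div_factorial, ← Nat.descFactorial_self k, ← dfac_eq, ← dfac_eq]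
  rfl

/-- Coefficients of a transvectant, modulo 8191. -/
def ncoef (m n r i a b : Nat) : Nat :=
  force (Nat.mod (Nat.mul (Nat.mul (dfac (Nat.sub m i) (Nat.sub r i))
      (dfac (Nat.add (Nat.sub n r) i) i))
    (Nat.mul (binom (Nat.add i a) a) (binom (Nat.add (Nat.sub r i) b) b))) 8191) fun c =>
  Bool.rec (Nat.sub 8191 c) c (Nat.beq (Nat.mod i 2) 0)

theorem ncoef_le (m n r i a b : ℕ) : ncoef m n r i a b ≤ 8191 := by
  unfold ncoef
  rw [force_eq]
  cases Nat.beq (Nat.mod i 2) 0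
  · exact Nat.sub_le _ _
  · exact (Nat.mod_lt _ (by norm_num)).le

theorem ncoef_cast (m n r i a b : ℕ) : (ncoef m n r i a b : ZMod 8191) =
    ((tcoef m n r i * ((i + a).choose a * (r - i + b).choose b : ℕ) : ℤ) : ZMod 8191) := by
  unfold ncoef
  rw [force_eq]
  simp only [dfac_eq, binom_eq, Nat.add_eq, Nat.sub_eq, Nat.mul_eq]
  set c := (m - i).descFactorial (r - i) * (n - r + i).descFactorial i *
    ((i + a).choose a * (r - i + b).choose b)
  have h1 : tcoef m n r i * ((i + a).choose a * (r - i + b).choose b : ℕ) = (-1) ^ i * (c : ℤ) := by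
    simp only [tcoef, c]
    push_cast
    ring
  have h2 : ((c.mod 8191 : ℕ) : ZMod 8191) = c := ZMod.natCast_mod c 8191
  have h3 : ((8191 : ℕ) : ZMod 8191) = 0 := ZMod.natCast_self _
  rw [h1]
  rcases Nat.mod_two_eq_zero_or_one i with h | h
  · rw [show Nat.beq (Nat.mod i 2) 0 = true from by rw [show Nat.mod i 2 = 0 from h]; rfl]
    change ((c.mod 8191 : ℕ) : ZMod 8191) = _
    rw [h2, (Nat.even_iff.mpr h).neg_one_pow]
    simp
  · rw [show Nat.beq (Nat.mod i 2) 0 = false from by rw [show Nat.mod i 2 = 1 from h]; rfl]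
    change ((8191 - c.mod 8191 : ℕ) : ZMod 8191) = _
    rw [Nat.cast_sub (show c.mod 8191 ≤ 8191 from (Nat.mod_lt _ (by norm_num)).le), h2, h3, (Nat.odd_iff.mpr h).neg_one_pow]
    simp

/-- The 225 low digits. -/
def low (n : Nat) : Nat := Nat.land n (Nat.sub (Nat.pow 2 8100) 1)

/-- The periodic mask for rows of 225 digits. -/
def rowMask : Nat := Nat.mul 8191 (Nat.div (Nat.sub (Nat.pow 2 8100) 1) 68719476735)

theorem digitMask_eq (K len : ℕ) (hK : 0 < K) :
    8191 * (((2 ^ K) ^ len - 1) / (2 ^ K - 1)) = digitMask K len := by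
  rw [← Nat.geomSum_eq (Nat.pow_le_pow_right (by norm_num : 0 < 2) hK), Finset.mul_sum]
  rfl

theorem mask_eq {K len e a : ℕ} (hK : 0 < K) (he : K * len = e) (ha : 2 ^ K - 1 = a) :
    Nat.mul 8191 (Nat.div (Nat.sub (Nat.pow 2 e) 1) a) = digitMask K len := by
  subst he ha
  rw [← digitMask_eq K len hK, ← pow_mul]
  rfl

theorem rowMask_eq : rowMask = digitMask 36 225 := by
  unfold rowMask
  exact mask_eq (by norm_num) (by norm_num) (by norm_num)

attribute [irreducible] rowMask low

theorem land_low' {k e n : ℕ} (h : k = e) : Nat.land n (Nat.sub (Nat.pow 2 e) 1) = n % 2 ^ k := by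
  subst h
  exact land_low _ _

/-- Truncated product of two rows. -/
def rowMul {α : Type} (x y : Nat) (K : Nat → α) : α := foldTwice rowMask (low (Nat.mul x y)) K

/-- Truncated product of two rows. -/
def rmul (x y : ℕ) : ℕ :=
  foldOnce rowMask (foldOnce rowMask (low (Nat.mul x y)))

theorem rowMul_eq {α : Type} (x y : ℕ) (K : ℕ → α) : rowMul x y K = K (rmul x y) :=
  foldTwice_eq _ _ _

/-- A row of 225 small digits representing a power series. -/
def RowP (n : ℕ) (f : PowerSeries (ZMod 8191)) : Prop :=
  Row 36 225 (2 ^ 14) n fun i => PowerSeries.coeff i f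

theorem RowP.mul {x y : ℕ} {f g : PowerSeries (ZMod 8191)} (hx : RowP x f) (hy : RowP y g) :
    RowP (rmul x y) (f * g) := by
  have h : low (Nat.mul x y) = x * y % 2 ^ (36 * 225) := by
    unfold low
    exact land_low' (by norm_num)
  have := (Row.mul (B := 2 ^ 36) hx hy (by norm_num) (by norm_num) (by norm_num) le_rfl).foldTwice
    le_rfl
  unfold rmul
  rw [h, rowMask_eq]
  exact this

/-- One summand added to a transvectant. -/
def rowAdd {α : Type} (x c y : Nat) (K : Nat → α) : α :=
  foldTwice rowMask (Nat.add x (Nat.mul c y)) K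

theorem RowP.add_mul {x y c : ℕ} {f g : PowerSeries (ZMod 8191)} (hx : RowP x f) (hc : c ≤ 8191)
    (hy : RowP y g) : RowP (rowAdd x c y fun n => n) (f + PowerSeries.C (c : ZMod 8191) * g) := by
  unfold rowAdd
  rw [foldTwice_eq, rowMask_eq]
  have h1 := (Row.add hx (Row.smul hy hc (by norm_num))).foldTwice (by norm_num)
  refine Row.congr h1 fun i _ => ?_
  rw [map_add, PowerSeries.coeff_C_mul]
  rfl

theorem RowP.zero : RowP 0 0 :=
  (Row.zero (by norm_num)).congr fun i _ => by simp

theorem RowP.congr {x : ℕ} {f g : PowerSeries (ZMod 8191)} (h : RowP x f) (hfg : f = g) :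
    RowP x g := hfg ▸ h

/-- Inner sum in a transvectant. -/
def ntrvAux (m n r : Nat) (u v : List Nat) (s i x t : Nat) : Nat :=
  Nat.rec x (fun a ih =>
    rowMul (getAt 0 u (Nat.add i a)) (getAt 0 v (Nat.add (Nat.sub r i) (Nat.sub s a))) fun x =>
    rowAdd ih (ncoef m n r i a (Nat.sub s a)) x fun n => n) t

/-- Values of a transvectant of strings. -/
def ntrv (m n r : Nat) (u v : List Nat) (s : Nat) : Nat :=
  Nat.rec 0 (fun i ih => ntrvAux m n r u v s i ih (Nat.succ s)) (Nat.succ r)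

theorem ntrvAux_row {m n r : ℕ} {u v : List ℕ} {f g : ℕ → PowerSeries (ZMod 8191)}
    (hu : ∀ s, RowP (getAt 0 u s) (f s)) (hv : ∀ s, RowP (getAt 0 v s) (g s)) (s i x : ℕ)
    {h : PowerSeries (ZMod 8191)} (hx : RowP x h) (t : ℕ) :
    RowP (ntrvAux m n r u v s i x t) (h + ∑ a ∈ Finset.range t,
      ((tcoef m n r i * ((i + a).choose a * (r - i + (s - a)).choose (s - a) : ℕ) : ℤ) :
        PowerSeries (ZMod 8191)) * (f (i + a) * g (r - i + (s - a)))) := by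
  induction t with
  | zero => exact hx.congr (by simp)
  | succ a iha =>
    rw [Finset.sum_range_succ, ← add_assoc]
    change RowP (rowMul _ _ _) _
    rw [rowMul_eq]
    refine (iha.add_mul (ncoef_le _ _ _ _ _ _) ((hu _).mul (hv _))).congr ?_
    rw [ncoef_cast]
    simp only [Nat.add_eq, Nat.sub_eq, map_intCast]

theorem ntrv_row {m n r : ℕ} {u v : List ℕ} {f g : ℕ → PowerSeries (ZMod 8191)}
    (hu : ∀ s, RowP (getAt 0 u s) (f s)) (hv : ∀ s, RowP (getAt 0 v s) (g s)) (s : ℕ) :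
    RowP (ntrv m n r u v s) (trv m n r f g s) := by
  unfold ntrv trv
  generalize h : Nat.succ r = t
  rw [show r + 1 = t from h]
  clear h
  induction t with
  | zero => exact RowP.zero
  | succ i ih =>
    rw [Finset.sum_range_succ, Finset.Nat.sum_antidiagonal_eq_sum_range_succ_mk]
    exact ntrvAux_row hu hv s i _ ih _

/-- A covariant with its degrees and the list of its coefficients. -/
structure NGen where
  d1 : Nat
  d2 : Nat
  k : Nat
  u : List Nat

/-- Build a list by decreasing index. -/
def nstring {α : Type} (f : Nat → Nat) (k : Nat) (K : List Nat → α) : α :=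
  Nat.rec (fun acc => K acc) (fun s ih acc => force (f s) fun x => ih (x :: acc)) (Nat.succ k) []

theorem nstring_eq {α : Type} (f : ℕ → ℕ) (k : ℕ) (K : List ℕ → α) :
    nstring f k K = K ((List.range (k + 1)).map f) := by
  have : ∀ n acc, (Nat.rec (motive := fun _ => List ℕ → α) (fun acc => K acc)
      (fun s ih acc => force (f s) fun x => ih (x :: acc)) n) acc =
      K ((List.range n).map f ++ acc) := by
    intro n
    induction n with
    | zero => intro acc; simp
    | succ n ih =>
      intro acc
      change force (f n) _ = _
      rw [force_eq, ih, List.range_succ, List.map_append, List.append_assoc]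
      rfl
  unfold nstring
  exact (this (k + 1) []).trans (by rw [List.append_nil])

/-- Conjunction, evaluated from the left. -/
def andThen (a b : Bool) : Bool := Bool.rec false b a

theorem andThen_eq_true {a b : Bool} : andThen a b = true ↔ a = true ∧ b = true := by
  cases a <;> simp [andThen]

/-- Numerical transvectant. -/
def ncomb (x y : NGen) (r : Nat) (K : NGen → Bool) : Bool :=
  NGen.rec (fun a1 a2 m u => NGen.rec (fun b1 b2 n v =>
    andThen (Nat.ble r m) (andThen (Nat.ble r n) (
    force (Nat.add a1 b1) fun c1 => force (Nat.add a2 b2) fun c2 =>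
    force (Nat.sub (Nat.add m n) (Nat.mul 2 r)) fun k =>
    nstring (ntrv m n r u v) k fun w => K ⟨c1, c2, k, w⟩))) y) x

/-- The zero covariant. -/
def NGen.zero : NGen := ⟨0, 0, 0, []⟩

/-- Follow a list of recipes. -/
def ngens (rs : List Nat) (l : List NGen) (K : List NGen → Bool) : Bool :=
  List.rec (fun l => K l) (fun c _ ih l =>
    force (Nat.mod c 256) fun x => force (Nat.mod (Nat.div c 256) 256) fun y =>
    force (Nat.div c 65536) fun r =>
    ncomb (getAt NGen.zero l x) (getAt NGen.zero l y) r fun g => ih (g :: l)) rs l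

/-- A covariant with its degrees and coefficients, in a ring. -/
structure GenData (R : Type) where
  d1 : ℕ
  d2 : ℕ
  k : ℕ
  u : ℕ → R

variable {R : Type} [CommRing R]

/-- Transvectant. -/
def GenData.comb (x y : GenData R) (r : ℕ) : GenData R :=
  ⟨x.d1 + y.d1, x.d2 + y.d2, x.k + y.k - 2 * r, trv x.k y.k r x.u y.u⟩

/-- The zero covariant. -/
def GenData.zero : GenData R := ⟨0, 0, 0, fun _ => 0⟩

/-- Follow one recipe. -/
def recipeStep (l : List (GenData R)) (c : ℕ) : List (GenData R) :=
  (l.getD (c % 256) GenData.zero).comb (l.getD (c / 256 % 256) GenData.zero) (c / 65536) :: l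

/-- Polynomials with integral coefficients. -/
abbrev ZPoly : Type := MvPolynomial Idx ℤ

/-- Extension of scalars. -/
abbrev toC : ZPoly →+* MvPolynomial Idx ℂ := MvPolynomial.map (Int.castRingHom ℂ)

theorem map_trv {R S : Type*} [CommRing R] [CommRing S] (φ : R →+* S) (m n r : ℕ) (u v : ℕ → R)
    (s : ℕ) : φ (trv m n r u v s) = trv m n r (fun i => φ (u i)) (fun i => φ (v i)) s := by
  simp [trv, map_sum]

/-- An integral covariant which is a string of the right degree. -/
structure GenData.IsCov (y : GenData ZPoly) : Prop where
  mem : toC (y.u 0) ∈ Ssp y.d1 y.d2 y.k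
  str : ∀ s, toC (y.u s) = strOf (toC (y.u 0)) s

theorem GenData.IsCov.comb {x y : GenData ZPoly} (hx : x.IsCov) (hy : y.IsCov) {r : ℕ}
    (hm : r ≤ x.k) (hn : r ≤ y.k) : (x.comb y r).IsCov := by
  have h : ∀ s, toC ((x.comb y r).u s) =
      trv x.k y.k r (strOf (toC (x.u 0))) (strOf (toC (y.u 0))) s := by
    intro s
    unfold GenData.comb
    rw [map_trv, show (fun i => toC (x.u i)) = _ from funext hx.str,
      show (fun i => toC (y.u i)) = _ from funext hy.str]
  refine ⟨?_, fun s => ?_⟩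
  · rw [h 0]
    have := tvt_mem hx.mem hy.mem hm hn
    have h2 : ((x.comb y r).k : ℤ) = x.k + y.k - 2 * r := by
      unfold GenData.comb
      dsimp only
      omega
    rw [h2]
    exact this
  · rw [h s, h 0]
    exact (strOf_tvt _ _ _ _ _ _).symm

theorem GenData.IsCov.zero_of_lt {y : GenData ZPoly} (h : y.IsCov) {s : ℕ} (hs : y.k < s) :
    y.u s = 0 := by
  have h1 := (isStr_strOf h.mem).zero s hs
  rw [← h.str] at h1
  exact map_injective _ (RingHom.injective_int _) (h1.trans (map_zero _).symm)

/-- A numerical covariant representing an integral one. -/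
structure NGen.Rep (φ : ZPoly →+* PowerSeries (ZMod 8191)) (x : NGen) (y : GenData ZPoly) : Prop where
  d1 : x.d1 = y.d1
  d2 : x.d2 = y.d2
  k : x.k = y.k
  cov : y.IsCov
  row : ∀ s, RowP (getAt 0 x.u s) (φ (y.u s))

theorem NGen.Rep.zero (φ : ZPoly →+* PowerSeries (ZMod 8191)) :
    NGen.Rep φ NGen.zero (GenData.zero : GenData ZPoly) where
  d1 := rfl
  d2 := rfl
  k := rfl
  cov := by
    constructor
    · simp [GenData.zero]
    · intro s
      simp [GenData.zero, strOf]
  row s := RowP.zero.congr (by simp [GenData.zero])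

theorem NGen.Rep.comb {φ : ZPoly →+* PowerSeries (ZMod 8191)} {x x' : NGen} {y y' : GenData ZPoly}
    (h : x.Rep φ y) (h' : x'.Rep φ y') {r : ℕ} {K : NGen → Bool} (hK : ncomb x x' r K = true) :
    ∃ z : NGen, z.Rep φ (y.comb y' r) ∧ K z = true := by
  obtain ⟨a1, a2, m, u⟩ := x
  obtain ⟨b1, b2, n, v⟩ := x'
  unfold ncomb at hK
  simp only [andThen_eq_true, force_eq, nstring_eq, Nat.ble_eq] at hK
  obtain ⟨hm, hn, hK⟩ := hK
  have e1 := h.k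
  have e2 := h'.k
  dsimp only at e1 e2
  have hc := h.cov.comb h'.cov (e1 ▸ hm : r ≤ y.k) (e2 ▸ hn : r ≤ y'.k)
  refine ⟨_, ⟨?_, ?_, ?_, hc, fun s => ?_⟩, hK⟩
  · exact congrArg₂ (· + ·) h.d1 h'.d1
  · exact congrArg₂ (· + ·) h.d2 h'.d2
  · change m + n - 2 * r = y.k + y'.k - 2 * r
    rw [e1, e2]
  · rw [getAt_eq, List.getD_eq_getElem?_getD, List.getElem?_map]
    have hk : (y.comb y' r).k = m + n - 2 * r := by
      rw [e1, e2]
      rfl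
    change RowP (Option.getD (Option.map _ (List.range (m + n - 2 * r + 1))[s]?) 0) _
    by_cases hs : s < m + n - 2 * r + 1
    · rw [List.getElem?_range hs]
      refine (ntrv_row h.row h'.row s).congr ?_
      rw [e1, e2, ← map_trv]
      rfl
    · rw [List.getElem?_eq_none (by rw [List.length_range]; omega), hc.zero_of_lt (by omega)]
      exact RowP.zero.congr (map_zero _).symm

theorem Forall₂_getAt {α β : Type} {R : α → β → Prop} {l : List α} {l' : List β}
    (h : List.Forall₂ R l l') {a : α} {b : β} (hab : R a b) (n : ℕ) :
    R (getAt a l n) (l'.getD n b) := by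
  rw [getAt_eq]
  induction h generalizing n with
  | nil => simpa using hab
  | cons h1 _ ih =>
    cases n with
    | zero => simpa using h1
    | succ n => simpa using ih n

theorem ngens_rep {φ : ZPoly →+* PowerSeries (ZMod 8191)} {K : List NGen → Bool} (rs : List ℕ) :
    ∀ {l : List NGen} {l' : List (GenData ZPoly)}, List.Forall₂ (NGen.Rep φ) l l' →
      ngens rs l K = true →
      ∃ L, List.Forall₂ (NGen.Rep φ) L (rs.foldl recipeStep l') ∧ K L = true := by
  induction rs with
  | nil => exact fun h hK => ⟨_, h, hK⟩
  | cons c rs ih =>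
    intro l l' h hK
    change (force (c % 256) fun x => force (c / 256 % 256) fun y => force (c / 65536) fun r =>
      ncomb (getAt NGen.zero l x) (getAt NGen.zero l y) r fun g => ngens rs (g :: l) K) = true at hK
    simp only [force_eq] at hK
    obtain ⟨z, hz, hK⟩ := NGen.Rep.comb (Forall₂_getAt h (NGen.Rep.zero φ) _)
      (Forall₂_getAt h (NGen.Rep.zero φ) _) hK
    exact ih (.cons hz h) hK

/-- The sextic. -/
def sexticData (R : Type) [CommRing R] : GenData (MvPolynomial Idx R) := ⟨1, 0, 6, ca R⟩

/-- The quartic. -/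
def quarticData (R : Type) [CommRing R] : GenData (MvPolynomial Idx R) := ⟨0, 1, 4, cb R⟩

theorem toC_ca (s : ℕ) : toC (ca ℤ s) = ca ℂ s := by
  unfold ca
  split_ifs <;> simp

theorem toC_cb (s : ℕ) : toC (cb ℤ s) = cb ℂ s := by
  unfold cb
  split_ifs <;> simp

theorem sexticData_isCov : (sexticData ℤ).IsCov := by
  constructor
  · change toC (ca ℤ 0) ∈ _
    rw [toC_ca]
    exact a0_mem
  · intro s
    change toC (ca ℤ s) = strOf (toC (ca ℤ 0)) s
    rw [toC_ca, toC_ca]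
    exact eq_strOf (isStr_ca ℂ).F_eq s

theorem quarticData_isCov : (quarticData ℤ).IsCov := by
  constructor
  · change toC (cb ℤ 0) ∈ _
    rw [toC_cb]
    exact b0_mem
  · intro s
    change toC (cb ℤ s) = strOf (toC (cb ℤ 0)) s
    rw [toC_cb, toC_cb]
    exact eq_strOf (isStr_cb ℂ).F_eq s

/-- A pseudo-random row: digits of a power of seven. -/
def series (i : Nat) : Nat := Nat.land (Nat.pow 7 (Nat.add 2900 i)) rowMask

/-- The sextic at the chosen point. -/
def startF (K : NGen → Bool) : Bool :=
  force (series 0) fun a1 => force (series 1) fun a2 => force (series 2) fun a3 =>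
  force (series 3) fun a4 => force (series 4) fun a5 =>
  rowMul a1 a5 fun x => rowMul a2 a4 fun y => rowMul a3 a3 fun z =>
  foldTwice rowMask (Nat.add (Nat.add (Nat.mul 6 x) (Nat.mul 8176 y)) (Nat.mul 10 z)) fun a6 =>
  foldTwice rowMask (Nat.mul 6 a1) fun a1 => foldTwice rowMask (Nat.mul 15 a2) fun a2 =>
  foldTwice rowMask (Nat.mul 20 a3) fun a3 => foldTwice rowMask (Nat.mul 15 a4) fun a4 =>
  foldTwice rowMask (Nat.mul 6 a5) fun a5 =>
  K ⟨1, 0, 6, [1, a1, a2, a3, a4, a5, a6]⟩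

/-- The quartic at the chosen point. -/
def startG (K : NGen → Bool) : Bool :=
  force (series 5) fun a1 => force (series 6) fun a2 => force (series 7) fun a3 =>
  rowMul a1 a3 fun x => rowMul a2 a2 fun y =>
  foldTwice rowMask (Nat.add (Nat.mul 4 x) (Nat.mul 8188 y)) fun a4 =>
  foldTwice rowMask (Nat.mul 4 a1) fun a1 => foldTwice rowMask (Nat.mul 6 a2) fun a2 =>
  foldTwice rowMask (Nat.mul 4 a3) fun a3 =>
  K ⟨0, 1, 4, [1, a1, a2, a3, a4]⟩

/-- The integral power series represented by `series i`. -/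
def serZ (i : ℕ) : PowerSeries ℤ :=
  PowerSeries.mk fun j => ((7 ^ (2900 + i) / (2 ^ 36) ^ j % 2 ^ 13 : ℕ) : ℤ)

/-- Reduction modulo 8191. -/
abbrev redP : PowerSeries ℤ →+* PowerSeries (ZMod 8191) :=
  PowerSeries.map (Int.castRingHom (ZMod 8191))

theorem redP_ofNat (n : ℕ) [n.AtLeastTwo] :
    redP (OfNat.ofNat n : PowerSeries ℤ) = (OfNat.ofNat n : PowerSeries (ZMod 8191)) :=
  map_ofNat redP n

theorem sum_digits (B n len : ℕ) :
    ∑ i ∈ Finset.range len, (n / B ^ i % B) * B ^ i = n % B ^ len := by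
  induction len with
  | zero => simp [Nat.mod_one]
  | succ len ih =>
    rw [Finset.sum_range_succ, ih, Nat.mod_pow_succ, mul_comm]

theorem land_mask (K len n : ℕ) (hK : 13 ≤ K) : Nat.land n (digitMask K len) =
    ∑ i ∈ Finset.range len, (n / (2 ^ K) ^ i % 2 ^ 13) * (2 ^ K) ^ i := by
  have h1 : digitMask K len < 2 ^ (K * len) := by
    rw [pow_mul]
    exact sum_lt_base K len (fun _ => 8191) fun _ =>
      lt_of_lt_of_le (by norm_num : 8191 < 2 ^ 13) (Nat.pow_le_pow_right (by norm_num) hK)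
  have h2 := land_add_mul (x := n / 2 ^ (K * len)) (y := 0)
    (Nat.mod_lt n (by positivity : 0 < 2 ^ (K * len))) h1
  rw [Nat.mod_add_div, mul_zero, add_zero, Nat.and_zero, mul_zero, add_zero] at h2
  refine Eq.trans h2 ?_
  rw [pow_mul, ← sum_digits]
  have := land_sum K len (fun i => n / (2 ^ K) ^ i % 2 ^ K) (fun _ => 8191)
    (fun i => Nat.mod_lt _ (by positivity)) fun _ =>
      lt_of_lt_of_le (by norm_num : 8191 < 2 ^ 13) (Nat.pow_le_pow_right (by norm_num) hK)
  refine Eq.trans this (Finset.sum_congr rfl fun i _ => ?_)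
  congr 1
  refine (Nat.and_two_pow_sub_one_eq_mod _ 13).trans (Nat.mod_mod_of_dvd _ ?_)
  exact pow_dvd_pow 2 hK

theorem series_row (i : ℕ) : RowP (series i) (redP (serZ i)) := by
  refine ⟨fun j => 7 ^ (2900 + i) / (2 ^ 36) ^ j % 2 ^ 13, fun j => ?_, ?_, fun j _ => ?_⟩
  · exact (Nat.mod_lt _ (by norm_num)).trans (by norm_num)
  · unfold series
    rw [rowMask_eq]
    exact land_mask 36 225 _ (by norm_num)
  · dsimp only
    rw [PowerSeries.coeff_map, serZ, PowerSeries.coeff_mk]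
    simp only [Int.coe_castRingHom, Int.cast_natCast]

attribute [irreducible] series

/-- The point at which covariants are evaluated. -/
def pt : Idx → PowerSeries ℤ :=
  Sum.elim ![1, 6 * serZ 0, 15 * serZ 1, 20 * serZ 2, 15 * serZ 3, 6 * serZ 4,
      6 * (serZ 0 * serZ 4) - 15 * (serZ 1 * serZ 3) + 10 * (serZ 2 * serZ 2)]
    ![1, 4 * serZ 5, 6 * serZ 6, 4 * serZ 7, 4 * (serZ 5 * serZ 7) - 3 * (serZ 6 * serZ 6)]

/-- Evaluation at the point. -/
def psi : ZPoly →+* PowerSeries ℤ := (aeval pt : ZPoly →ₐ[ℤ] PowerSeries ℤ).toRingHom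

/-- Evaluation at the point, modulo 8191. -/
def psiP : ZPoly →+* PowerSeries (ZMod 8191) := redP.comp psi

theorem psi_X (i : Idx) : psi (X i) = pt i := by
  change aeval pt (X i) = _
  rw [aeval_X]

theorem RowP.one : RowP 1 1 := by
  refine ⟨fun i => if i = 0 then 1 else 0, fun i => ?_, ?_, fun i _ => ?_⟩
  · dsimp only
    split_ifs <;> norm_num
  · simp
  · dsimp only
    rw [PowerSeries.coeff_one]
    split_ifs <;> simp

theorem Row.fold {b n : ℕ} {f : PowerSeries (ZMod 8191)}
    (h : Row 36 225 b n fun i => PowerSeries.coeff i f) (hb : b ≤ 2 ^ 36) :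
    RowP (_root_.foldOnce rowMask (_root_.foldOnce rowMask n)) f := by
  rw [rowMask_eq]
  exact h.foldTwice hb

theorem RowP.smul {n : ℕ} {f : PowerSeries (ZMod 8191)} (h : RowP n f) (c : ℕ) (hc : 0 < c) :
    Row 36 225 (c * 2 ^ 14) (c * n) fun i => PowerSeries.coeff i ((c : PowerSeries (ZMod 8191)) * f) := by
  refine (Row.smul h le_rfl hc).congr fun i _ => ?_
  rw [← map_natCast (PowerSeries.C (R := ZMod 8191)) c, PowerSeries.coeff_C_mul]

theorem Row.add' {b b' n n' : ℕ} {f g : PowerSeries (ZMod 8191)}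
    (h : Row 36 225 b n fun i => PowerSeries.coeff i f)
    (h' : Row 36 225 b' n' fun i => PowerSeries.coeff i g) :
    Row 36 225 (b + b') (n + n') fun i => PowerSeries.coeff i (f + g) := by
  refine (Row.add h h').congr fun i _ => ?_
  rw [map_add]
  rfl

theorem startF_rep {K : NGen → Bool} (h : startF K = true) :
    ∃ x : NGen, x.Rep psiP (sexticData ℤ) ∧ K x = true := by
  unfold startF at h
  simp only [force_eq, foldTwice_eq, rowMul_eq] at h
  refine ⟨_, ⟨rfl, rfl, rfl, sexticData_isCov, fun s => ?_⟩, h⟩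
  change RowP _ (psiP (ca ℤ s))
  have key : psiP (ca ℤ s) = redP (if h : s < 7 then pt (Sum.inl ⟨s, h⟩) else 0) := by
    unfold ca psiP
    split_ifs
    · rw [RingHom.comp_apply, psi_X]
    · simp only [map_zero]
  rw [key]
  rcases s with _ | _ | _ | _ | _ | _ | _ | s
  · exact RowP.one.congr (by simp [pt])
  · exact (((series_row 0).smul 6 (by norm_num)).fold (by norm_num)).congr
      (by change _ = redP (6 * serZ 0); rw [map_mul, redP_ofNat, Nat.cast_ofNat])
  · exact (((series_row 1).smul 15 (by norm_num)).fold (by norm_num)).congr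
      (by change _ = redP (15 * serZ 1); rw [map_mul, redP_ofNat, Nat.cast_ofNat])
  · exact (((series_row 2).smul 20 (by norm_num)).fold (by norm_num)).congr
      (by change _ = redP (20 * serZ 2); rw [map_mul, redP_ofNat, Nat.cast_ofNat])
  · exact (((series_row 3).smul 15 (by norm_num)).fold (by norm_num)).congr
      (by change _ = redP (15 * serZ 3); rw [map_mul, redP_ofNat, Nat.cast_ofNat])
  · exact (((series_row 4).smul 6 (by norm_num)).fold (by norm_num)).congr
      (by change _ = redP (6 * serZ 4); rw [map_mul, redP_ofNat, Nat.cast_ofNat])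
  · refine RowP.congr (Row.fold (Row.add' (Row.add'
      (((series_row 0).mul (series_row 4)).smul 6 (by norm_num))
      (((series_row 1).mul (series_row 3)).smul 8176 (by norm_num)))
      (((series_row 2).mul (series_row 2)).smul 10 (by norm_num))) (by norm_num)) ?_
    have h8 : ((8176 : ℕ) : PowerSeries (ZMod 8191)) = -15 := by
      rw [← map_natCast (PowerSeries.C (R := ZMod 8191)), show ((8176 : ℕ) : ZMod 8191) = -15 by decide,
        map_neg, map_ofNat]
    rw [h8]
    change _ = redP (6 * (serZ 0 * serZ 4) - 15 * (serZ 1 * serZ 3) + 10 * (serZ 2 * serZ 2))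
    simp only [map_mul, map_add, map_sub]
    rw [redP_ofNat, redP_ofNat, redP_ofNat, Nat.cast_ofNat, Nat.cast_ofNat]
    ring
  · exact RowP.zero.congr (by rw [dif_neg (by omega), map_zero])

theorem startG_rep {K : NGen → Bool} (h : startG K = true) :
    ∃ x : NGen, x.Rep psiP (quarticData ℤ) ∧ K x = true := by
  unfold startG at h
  simp only [force_eq, foldTwice_eq, rowMul_eq] at h
  refine ⟨_, ⟨rfl, rfl, rfl, quarticData_isCov, fun s => ?_⟩, h⟩
  change RowP _ (psiP (cb ℤ s))
  have key : psiP (cb ℤ s) = redP (if h : s < 5 then pt (Sum.inr ⟨s, h⟩) else 0) := by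
    unfold cb psiP
    split_ifs
    · rw [RingHom.comp_apply, psi_X]
    · simp only [map_zero]
  rw [key]
  rcases s with _ | _ | _ | _ | _ | s
  · exact RowP.one.congr (by simp [pt])
  · exact (((series_row 5).smul 4 (by norm_num)).fold (by norm_num)).congr
      (by change _ = redP (4 * serZ 5); rw [map_mul, redP_ofNat, Nat.cast_ofNat])
  · exact (((series_row 6).smul 6 (by norm_num)).fold (by norm_num)).congr
      (by change _ = redP (6 * serZ 6); rw [map_mul, redP_ofNat, Nat.cast_ofNat])
  · exact (((series_row 7).smul 4 (by norm_num)).fold (by norm_num)).congr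
      (by change _ = redP (4 * serZ 7); rw [map_mul, redP_ofNat, Nat.cast_ofNat])
  · refine RowP.congr (Row.fold (Row.add'
      (((series_row 5).mul (series_row 7)).smul 4 (by norm_num))
      (((series_row 6).mul (series_row 6)).smul 8188 (by norm_num))) (by norm_num)) ?_
    have h8 : ((8188 : ℕ) : PowerSeries (ZMod 8191)) = -3 := by
      rw [← map_natCast (PowerSeries.C (R := ZMod 8191)), show ((8188 : ℕ) : ZMod 8191) = -3 by decide,
        map_neg, map_ofNat]
    rw [h8]
    change _ = redP (4 * (serZ 5 * serZ 7) - 3 * (serZ 6 * serZ 6))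
    simp only [map_mul, map_sub]
    rw [redP_ofNat, redP_ofNat, Nat.cast_ofNat]
    ring
  · exact RowP.zero.congr (by rw [dif_neg (by omega), map_zero])

/-- The quadratic invariant of the sextic. -/
def invA : ZPoly := trv 6 6 6 (ca ℤ) (ca ℤ) 0

/-- The quadratic invariant of the quartic. -/
def invI : ZPoly := trv 4 4 4 (cb ℤ) (cb ℤ) 0

theorem psi_invA : psi invA = 0 := by
  rw [invA, map_trv]
  simp [trv_zero, Finset.sum_range_succ, tcoef, Nat.descFactorial, ca, psi_X, pt]
  ring

theorem psi_invI : psi invI = 0 := by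
  rw [invI, map_trv]
  simp [trv_zero, Finset.sum_range_succ, tcoef, Nat.descFactorial, cb, psi_X, pt]
  ring

instance : Fact (Nat.Prime 8191) := ⟨by norm_num⟩

/-- The number with the given digits in base `2 ^ 36`. -/
def rowNum (E : ℕ) (d : ℕ → ℕ) : ℕ := ∑ i ∈ Finset.range E, d i * (2 ^ 36) ^ i

/-- The number with the given matrix of digits. -/
def matNum (E n : ℕ) (D : ℕ → ℕ → ℕ) : ℕ :=
  ∑ j ∈ Finset.range n, rowNum E (D j) * (2 ^ (36 * E)) ^ j

theorem rowNum_lt {E : ℕ} {d : ℕ → ℕ} (h : ∀ i, d i < 2 ^ 36) : rowNum E d < 2 ^ (36 * E) := by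
  rw [pow_mul]
  exact sum_lt_base 36 E d h

theorem matNum_succ (E n : ℕ) (D : ℕ → ℕ → ℕ) : matNum E (n + 1) D =
    rowNum E (D 0) + 2 ^ (36 * E) * matNum E n fun j => D (j + 1) :=
  sum_range_succ_base (36 * E) n fun j => rowNum E (D j)

theorem matNum_flat (E n : ℕ) (hE : 0 < E) (D : ℕ → ℕ → ℕ) : matNum E n D =
    ∑ k ∈ Finset.range (n * E), D (k / E) (k % E) * (2 ^ 36) ^ k := by
  induction n with
  | zero => simp [matNum]
  | succ n ih =>
    unfold matNum at ih ⊢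
    rw [Finset.sum_range_succ, ih, add_mul, one_mul, Finset.sum_range_add, rowNum, Finset.sum_mul]
    congr 1
    refine Finset.sum_congr rfl fun i hi => ?_
    rw [Finset.mem_range] at hi
    rw [mul_comm n E, Nat.mul_add_div hE, Nat.div_eq_of_lt hi, add_zero, Nat.mul_add_mod,
      Nat.mod_eq_of_lt hi, pow_add, pow_mul 2 36 E, pow_mul _ E n]
    ring

/-- Partial reduction of a digit modulo 8191. -/
def foldDigit (d : ℕ) : ℕ := d % 2 ^ 13 + d / 2 ^ 13

theorem foldDigit_cast (d : ℕ) : (foldDigit d : ZMod 8191) = d := by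
  conv_rhs => rw [← Nat.mod_add_div d (2 ^ 13)]
  unfold foldDigit
  push_cast
  have : (8192 : ZMod 8191) = 1 := by decide
  rw [this, one_mul]

theorem foldDigit_lt {d : ℕ} (h : d < 2 ^ 36) : foldDigit d < 2 ^ 24 := by
  unfold foldDigit
  omega

theorem foldDigit_lt' {d : ℕ} (h : d < 2 ^ 24) : foldDigit d < 2 ^ 14 := by
  unfold foldDigit
  omega

theorem matNum_foldOnce {E n N : ℕ} (hE : 0 < E) (hn : n ≤ N) {D : ℕ → ℕ → ℕ}
    (hD : ∀ j i, D j i < 2 ^ 36) :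
    foldOnce (digitMask 36 (N * E)) (matNum E n D) = matNum E n fun j i => foldDigit (D j i) := by
  have h0 : ∀ D : ℕ → ℕ → ℕ, matNum E n D = ∑ k ∈ Finset.range (N * E),
      (if k < n * E then D (k / E) (k % E) else 0) * (2 ^ 36) ^ k := by
    intro D
    rw [matNum_flat E n hE]
    have h2 : Finset.range (n * E) ⊆ Finset.range (N * E) :=
      Finset.range_subset_range.mpr (Nat.mul_le_mul_right _ hn)
    rw [← Finset.sum_subset h2]
    · refine Finset.sum_congr rfl fun k hk => ?_
      rw [if_pos (Finset.mem_range.mp hk)]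
    · intro k _ hk
      rw [if_neg (fun h => hk (Finset.mem_range.mpr h)), zero_mul]
  rw [h0 D, foldOnce_sum (by norm_num), h0]
  · refine Finset.sum_congr rfl fun k _ => ?_
    split_ifs <;> simp [foldDigit]
  · intro k
    split_ifs
    · exact hD _ _
    · positivity

/-- A number whose digits represent the rows of a matrix. -/
def MatR (E n A : ℕ) (V : ℕ → ℕ → ZMod 8191) : Prop :=
  ∃ D : ℕ → ℕ → ℕ, (∀ j i, D j i < 2 ^ 14) ∧ A = matNum E n D ∧
    ∀ j < n, ∀ i < E, (D j i : ZMod 8191) = V j i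

/-- The column mask. -/
def colMask (E N : ℕ) : ℕ := ∑ j ∈ Finset.range N, 68719476735 * (2 ^ (36 * E)) ^ j

theorem rowNum_div {E m : ℕ} (hm : m < E) {d : ℕ → ℕ} (h : ∀ i, d i < 2 ^ 36) :
    rowNum E d / (2 ^ 36) ^ m % 2 ^ 36 = d m := by
  obtain ⟨c, rfl⟩ := Nat.exists_eq_add_of_le (Nat.succ_le_of_lt hm)
  unfold rowNum
  rw [Finset.sum_range_add, Finset.sum_range_succ]
  have h1 : ∑ x ∈ Finset.range c, d (m.succ + x) * (2 ^ 36) ^ (m.succ + x) =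
      (2 ^ 36) ^ m * (2 ^ 36 * ∑ x ∈ Finset.range c, d (m.succ + x) * (2 ^ 36) ^ x) := by
    rw [Finset.mul_sum, Finset.mul_sum]
    refine Finset.sum_congr rfl fun i _ => ?_
    rw [Nat.succ_eq_add_one]
    ring
  rw [h1, mul_comm (d m), add_assoc, ← mul_add, Nat.add_mul_div_left _ _ (by positivity),
    Nat.div_eq_of_lt (sum_lt_base 36 m d h), zero_add, Nat.add_mul_mod_self_left,
    Nat.mod_eq_of_lt (h m)]

theorem add_mul_div_mod {Q b c w T : ℕ} (hb : 0 < b) (hQ : Q = b * (2 ^ 36 * c)) :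
    (w + Q * T) / b % 2 ^ 36 = w / b % 2 ^ 36 := by
  rw [hQ, mul_assoc, Nat.add_mul_div_left _ _ hb, mul_assoc, Nat.add_mul_mod_self_left]

theorem land_colMask {E m n N : ℕ} (hm : m < E) (hn : n ≤ N) : ∀ {D : ℕ → ℕ → ℕ},
    (∀ j i, D j i < 2 ^ 36) → Nat.land (matNum E n D / (2 ^ 36) ^ m) (colMask E N) =
      ∑ j ∈ Finset.range n, D j m * (2 ^ (36 * E)) ^ j := by
  induction n generalizing N with
  | zero =>
    intro D _
    rw [matNum, Finset.range_zero, Finset.sum_empty, Finset.sum_empty, Nat.zero_div]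
    exact Nat.zero_and _
  | succ n ih =>
    intro D hD
    obtain ⟨N, rfl⟩ : ∃ N', N = N' + 1 := ⟨N - 1, by omega⟩
    obtain ⟨c, hc⟩ := Nat.exists_eq_add_of_le (Nat.succ_le_of_lt hm)
    have hQ : 2 ^ (36 * E) = (2 ^ 36) ^ m * (2 ^ 36 * 2 ^ (36 * c)) := by
      rw [← pow_mul, ← pow_add, ← pow_add]
      congr 1
      omega
    have hpos : 0 < 2 ^ (36 * E) := by positivity
    have hM : colMask E (N + 1) = 68719476735 + 2 ^ (36 * E) * colMask E N :=
      sum_range_succ_base (36 * E) N fun _ => 68719476735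
    have hlt : 68719476735 < 2 ^ (36 * E) := lt_of_lt_of_le (by norm_num : _ < 2 ^ 36)
      (Nat.pow_le_pow_right (by norm_num) (by omega))
    have key := land_add_mul (x := matNum E (n + 1) D / (2 ^ 36) ^ m / 2 ^ (36 * E))
      (y := colMask E N) (Nat.mod_lt (matNum E (n + 1) D / (2 ^ 36) ^ m) hpos) hlt
    rw [Nat.mod_add_div, ← hM] at key
    refine Eq.trans key ?_
    have h1 : matNum E (n + 1) D / (2 ^ 36) ^ m / 2 ^ (36 * E) =
        (matNum E n fun j => D (j + 1)) / (2 ^ 36) ^ m := by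
      rw [Nat.div_div_eq_div_mul, mul_comm, ← Nat.div_div_eq_div_mul, matNum_succ,
        Nat.add_mul_div_left _ _ hpos, Nat.div_eq_of_lt (rowNum_lt (hD 0)), zero_add]
    have h2 : (matNum E (n + 1) D / (2 ^ 36) ^ m % 2 ^ (36 * E)) &&& 68719476735 = D 0 m := by
      refine (Nat.and_two_pow_sub_one_eq_mod _ 36).trans ?_
      rw [Nat.mod_mod_of_dvd _ (pow_dvd_pow 2 (by omega)), matNum_succ,
        add_mul_div_mod (by positivity) hQ, rowNum_div hm (hD 0)]
    rw [h1, h2, sum_range_succ_base (36 * E) n fun j => D j m]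
    congr 2
    exact ih (by omega) fun j i => hD _ _

/-- Push rows onto a packed matrix. -/
def pack (sh mask : Nat) (rows : List Nat) (K : Nat → Bool) (A : Nat) : Bool :=
  List.rec (fun A => K A)
    (fun r _ ih A => force (Nat.add (Nat.shiftLeft A sh) (Nat.land r mask)) ih) rows A

/-- Gaussian elimination of a packed matrix. -/
def elim (sh mask cmask F C : Nat) (n A : Nat) : Bool :=
  Nat.rec (fun _ => true) (fun m ih A =>
    force (Nat.shiftRight A (Nat.mul 36 m)) fun Am =>
    force (Nat.land Am 68719476735) fun lead =>
    Bool.rec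
     (foldTwice F (Nat.add (Nat.mul lead (Nat.shiftRight A sh))
         (Nat.mul (Nat.land (Nat.shiftRight Am sh) cmask) (Nat.sub C (Nat.land A mask)))) ih) false
      (Nat.beq (Nat.mod lead 8191) 0)) n A

/-- Length of a list. -/
def lenN (l : List Nat) : Nat := List.rec 0 (fun _ _ ih => Nat.succ ih) l

/-- Check that `E` rows are independent in the first `E` columns. -/
def rank (E : Nat) (rows : List Nat) : Bool :=
  force (Nat.mul 36 E) fun sh => force (Nat.sub (Nat.pow 2 sh) 1) fun mask =>
  force (Nat.mul 8191 (Nat.div (Nat.sub (Nat.pow 2 (Nat.mul sh E)) 1) 68719476735)) fun F =>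
  force (Nat.mul 68719476735 (Nat.div (Nat.sub (Nat.pow 2 (Nat.mul sh E)) 1) mask)) fun cmask =>
  force (Nat.mul 32764 (Nat.div mask 68719476735)) fun C =>
  andThen (Nat.ble 1 E) (andThen (Nat.ble E 225) (andThen (Nat.beq (lenN rows) E)
    (pack sh mask rows (elim sh mask cmask F C E) 0)))

theorem lenN_eq (l : List ℕ) : lenN l = l.length := by
  induction l with
  | nil => rfl
  | cons x l ih => exact congrArg Nat.succ ih

theorem MatR.cons {E n A r : ℕ} {V : ℕ → ℕ → ZMod 8191} {v : ℕ → ZMod 8191}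
    (h : MatR E n A V) (hr : Row 36 E (2 ^ 14) r v) {V' : ℕ → ℕ → ZMod 8191} (h0 : V' 0 = v)
    (hs : ∀ j, V' (j + 1) = V j) : MatR E (n + 1) (2 ^ (36 * E) * A + r) V' := by
  obtain ⟨D, h1, h2, h3⟩ := h
  obtain ⟨d, h4, h5, h6⟩ := hr
  refine ⟨fun j => Nat.casesOn j d D, ?_, ?_, ?_⟩
  · rintro (_ | j)
    · exact h4
    · exact h1 j
  · rw [matNum_succ, h2, h5, add_comm]
    rfl
  · rintro (_ | j) hj i hi
    · rw [h0]
      exact h6 i hi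
    · rw [hs]
      exact h3 j (by omega) i hi

theorem pack_sound {E : ℕ} (hE' : E ≤ 225) {K : ℕ → Bool} :
    ∀ {rows : List ℕ} {vs : List (PowerSeries (ZMod 8191))}, List.Forall₂ RowP rows vs →
    ∀ {A : ℕ} {acc : List (PowerSeries (ZMod 8191))},
    MatR E acc.length A (fun j i => PowerSeries.coeff i (acc.getD j 0)) →
    pack (36 * E) (2 ^ (36 * E) - 1) rows K A = true →
    ∃ A', MatR E (acc.length + rows.length) A'
      (fun j i => PowerSeries.coeff i ((vs.reverse ++ acc).getD j 0)) ∧ K A' = true := by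
  intro rows vs h
  induction h with
  | nil => exact fun {A acc} hA hK => ⟨A, hA, hK⟩
  | @cons r v rows vs hr _ ih =>
    intro A acc hA hK
    change force (Nat.add (Nat.shiftLeft A (36 * E)) (Nat.land r (2 ^ (36 * E) - 1)))
      (pack (36 * E) (2 ^ (36 * E) - 1) rows K) = true at hK
    rw [force_eq] at hK
    have h1 : Nat.add (Nat.shiftLeft A (36 * E)) (Nat.land r (2 ^ (36 * E) - 1)) =
        2 ^ (36 * E) * A + r % 2 ^ (36 * E) := by
      have := land_low (36 * E) r
      change A <<< (36 * E) + Nat.land r (Nat.sub (2 ^ (36 * E)) 1) = _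
      rw [this, Nat.shiftLeft_eq, mul_comm]
    rw [h1] at hK
    have h2 : MatR E (v :: acc).length (2 ^ (36 * E) * A + r % 2 ^ (36 * E))
        (fun j i => PowerSeries.coeff i ((v :: acc).getD j 0)) :=
      hA.cons (Row.trunc hr hE' (by norm_num)) rfl fun _ => rfl
    obtain ⟨A', h3, h4⟩ := ih h2 hK
    refine ⟨A', ?_, h4⟩
    rw [List.length_cons] at h3 ⊢
    rw [List.reverse_cons, List.append_assoc, ← add_assoc, add_right_comm]
    exact h3

theorem rowNum_mod {E m : ℕ} (hm : m < E) {d : ℕ → ℕ} (h : ∀ i, d i < 2 ^ 36) (T : ℕ) :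
    (rowNum E d + 2 ^ (36 * E) * T) / (2 ^ 36) ^ m % 2 ^ 36 = d m := by
  obtain ⟨c, hc⟩ := Nat.exists_eq_add_of_le (Nat.succ_le_of_lt hm)
  have hQ : 2 ^ (36 * E) = (2 ^ 36) ^ m * (2 ^ 36 * 2 ^ (36 * c)) := by
    rw [← pow_mul, ← pow_add, ← pow_add]
    congr 1
    omega
  rw [add_mul_div_mod (by positivity) hQ, rowNum_div hm h]

theorem rowNum_sub {E : ℕ} {d : ℕ → ℕ} {c : ℕ} (h : ∀ i, d i ≤ c) :
    rowNum E (fun _ => c) - rowNum E d = rowNum E fun i => c - d i := by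
  have : rowNum E (fun _ => c) = rowNum E (fun i => c - d i) + rowNum E d := by
    unfold rowNum
    rw [← Finset.sum_add_distrib]
    refine Finset.sum_congr rfl fun i _ => ?_
    rw [← add_mul, Nat.sub_add_cancel (h i)]
  omega

theorem matNum_comb (E m a : ℕ) (D : ℕ → ℕ → ℕ) (b : ℕ → ℕ) (d : ℕ → ℕ) :
    a * matNum E m D + (∑ j ∈ Finset.range m, b j * (2 ^ (36 * E)) ^ j) * rowNum E d =
      matNum E m fun j i => a * D j i + b j * d i := by
  unfold matNum rowNum
  rw [Finset.mul_sum, Finset.sum_mul, ← Finset.sum_add_distrib]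
  refine Finset.sum_congr rfl fun j _ => ?_
  simp only [add_mul, Finset.sum_add_distrib, mul_assoc, ← Finset.mul_sum]
  ring

theorem elim_succ (sh mask cmask F C m A : ℕ) : elim sh mask cmask F C (m + 1) A =
    (Bool.rec (elim sh mask cmask F C m (foldOnce F (foldOnce F
      (Nat.land (Nat.shiftRight A (36 * m)) 68719476735 * (Nat.shiftRight A sh) +
      (Nat.land (Nat.shiftRight (Nat.shiftRight A (36 * m)) sh) cmask) * (C - (Nat.land A mask))))))
      false (Nat.beq (Nat.mod (Nat.land (Nat.shiftRight A (36 * m)) 68719476735) 8191) 0) : Bool) := by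
  rw [← foldTwice_eq F _ (elim sh mask cmask F C m)]
  have : elim sh mask cmask F C (m + 1) A = force (Nat.shiftRight A (Nat.mul 36 m)) fun Am =>
      force (Nat.land Am 68719476735) fun lead => (Bool.rec (foldTwice F
        (Nat.add (Nat.mul lead (Nat.shiftRight A sh)) (Nat.mul (Nat.land (Nat.shiftRight Am sh) cmask)
          (Nat.sub C (Nat.land A mask)))) (elim sh mask cmask F C m)) false
        (Nat.beq (Nat.mod lead 8191) 0) : Bool) := rfl
  rw [this, force_eq, force_eq]
  rfl

theorem elim_sound {E : ℕ} (hE : 0 < E) : ∀ {n A : ℕ} {V : ℕ → ℕ → ZMod 8191},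
    n ≤ E → MatR E n A V →
    elim (36 * E) (2 ^ (36 * E) - 1) (colMask E E) (digitMask 36 (E * E))
      (rowNum E fun _ => 32764) n A = true →
    ∀ c : ℕ → ZMod 8191, (∀ i < E, ∑ j ∈ Finset.range n, c j * V j i = 0) → ∀ j < n, c j = 0 := by
  intro n
  induction n with
  | zero => intro A V _ _ _ c _ j hj; omega
  | succ m ih =>
    intro A V hn ⟨D, hD, hA, hV⟩ hel c hc
    have hD' : ∀ j i, D j i < 2 ^ 36 := fun j i => (hD j i).trans (by norm_num)
    rw [elim_succ] at hel
    have hAm : Nat.shiftRight A (36 * m) = A / (2 ^ 36) ^ m := by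
      rw [← pow_mul]
      exact Nat.shiftRight_eq_div_pow A (36 * m)
    have hsh : ∀ x, Nat.shiftRight x (36 * E) = x / 2 ^ (36 * E) := fun x =>
      Nat.shiftRight_eq_div_pow x (36 * E)
    have hpos : 0 < 2 ^ (36 * E) := by positivity
    have hlead : Nat.land (A / (2 ^ 36) ^ m) 68719476735 = D 0 m := by
      refine (Nat.and_two_pow_sub_one_eq_mod _ 36).trans ?_
      rw [hA, matNum_succ, rowNum_mod hn (hD' 0)]
    have hT : A / 2 ^ (36 * E) = matNum E m fun j => D (j + 1) := by
      rw [hA, matNum_succ, Nat.add_mul_div_left _ _ hpos, Nat.div_eq_of_lt (rowNum_lt (hD' 0)),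
        zero_add]
    have hT' : A / (2 ^ 36) ^ m / 2 ^ (36 * E) = (matNum E m fun j => D (j + 1)) / (2 ^ 36) ^ m := by
      rw [Nat.div_div_eq_div_mul, mul_comm, ← Nat.div_div_eq_div_mul, hT]
    have hR : Nat.land A (2 ^ (36 * E) - 1) = rowNum E (D 0) := by
      refine (Nat.and_two_pow_sub_one_eq_mod _ _).trans ?_
      rw [hA, matNum_succ, Nat.add_mul_mod_self_left, Nat.mod_eq_of_lt (rowNum_lt (hD' 0))]
    rw [hAm, hsh, hsh, hlead, hT, hT', hR, land_colMask hn (by omega) fun j i => hD' _ _,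
      rowNum_sub fun i => ((hD 0 i).trans (by norm_num)).le, matNum_comb] at hel
    have hlt : ∀ j i, D 0 m * D (j + 1) i + D (j + 1) m * (32764 - D 0 i) < 2 ^ 36 := by
      intro j i
      have h1 : D 0 m * D (j + 1) i ≤ 2 ^ 14 * 2 ^ 14 :=
        Nat.mul_le_mul (hD 0 m).le (hD (j + 1) i).le
      have h2 : D (j + 1) m * (32764 - D 0 i) ≤ 2 ^ 14 * 32764 :=
        Nat.mul_le_mul (hD (j + 1) m).le (Nat.sub_le _ _)
      omega
    rw [matNum_foldOnce hE (by omega) hlt, matNum_foldOnce hE (by omega)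
      fun j i => (foldDigit_lt (hlt j i)).trans (by norm_num)] at hel
    have hne : V 0 m ≠ 0 := by
      rw [← hV 0 (by omega) m (by omega)]
      intro h0
      rw [ZMod.natCast_eq_zero_iff] at h0
      rw [show Nat.beq (Nat.mod (D 0 m) 8191) 0 = true from by
        rw [show Nat.mod (D 0 m) 8191 = 0 from Nat.mod_eq_zero_of_dvd h0]; rfl] at hel
      exact absurd hel (by simp)
    have hel2 : elim (36 * E) (2 ^ (36 * E) - 1) (colMask E E) (digitMask 36 (E * E))
        (rowNum E fun _ => 32764) m (matNum E m fun j i => foldDigit (foldDigit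
          (D 0 m * D (j + 1) i + D (j + 1) m * (32764 - D 0 i)))) = true := by
      revert hel
      cases Nat.beq (Nat.mod (D 0 m) 8191) 0
      · exact id
      · intro h
        exact absurd h (by simp)
    have hM : MatR E m (matNum E m fun j i => foldDigit (foldDigit
          (D 0 m * D (j + 1) i + D (j + 1) m * (32764 - D 0 i))))
        (fun j i => V 0 m * V (j + 1) i - V (j + 1) m * V 0 i) := by
      refine ⟨_, fun j i => foldDigit_lt' (foldDigit_lt (hlt j i)), rfl, fun j hj i hi => ?_⟩
      rw [foldDigit_cast, foldDigit_cast]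
      have h1 : D 0 i ≤ 32764 := ((hD 0 i).trans (by norm_num)).le
      push_cast [h1]
      rw [hV 0 (by omega) m (by omega), hV _ (by omega) i hi, hV _ (by omega) m (by omega),
        hV 0 (by omega) i hi]
      have h2 : (32764 : ZMod 8191) = 0 := by decide
      rw [h2]
      ring
    have hz := ih (by omega) hM hel2 (fun j => c (j + 1)) fun i hi => by
      have h1 := hc i hi
      have h2 := hc m (by omega)
      rw [Finset.sum_range_succ'] at h1 h2
      have h3 : ∑ j ∈ Finset.range m, c (j + 1) * (V 0 m * V (j + 1) i - V (j + 1) m * V 0 i) =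
          V 0 m * ∑ j ∈ Finset.range m, c (j + 1) * V (j + 1) i -
          V 0 i * ∑ j ∈ Finset.range m, c (j + 1) * V (j + 1) m := by
        rw [Finset.mul_sum, Finset.mul_sum, ← Finset.sum_sub_distrib]
        exact Finset.sum_congr rfl fun j _ => by ring
      rw [h3]
      linear_combination V 0 m * h1 - V 0 i * h2
    have h0 := hc m (by omega)
    rw [Finset.sum_range_succ', Finset.sum_eq_zero fun j hj => by
      rw [hz j (Finset.mem_range.mp hj), zero_mul], zero_add] at h0
    rintro (_ | j) hj
    · exact (mul_eq_zero.mp h0).resolve_right hne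
    · exact hz j (by omega)

theorem mask_eq' {c K len e a : ℕ} (hK : 0 < K) (he : K * len = e) (ha : 2 ^ K - 1 = a) :
    Nat.mul c (Nat.div (Nat.sub (Nat.pow 2 e) 1) a) = ∑ i ∈ Finset.range len, c * (2 ^ K) ^ i := by
  subst he ha
  rw [← Finset.mul_sum, Nat.geomSum_eq (Nat.pow_le_pow_right (by norm_num : 0 < 2) hK), ← pow_mul]
  rfl

theorem rank_sound {E : ℕ} {rows : List ℕ} (h : rank E rows = true)
    {vs : List (PowerSeries (ZMod 8191))} (hvs : List.Forall₂ RowP rows vs) :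
    rows.length = E ∧ ∀ c : ℕ → ZMod 8191,
      (∀ i < E, ∑ j ∈ Finset.range E, c j * PowerSeries.coeff i (vs.reverse.getD j 0) = 0) →
      ∀ j < E, c j = 0 := by
  unfold rank at h
  simp only [force_eq, andThen_eq_true] at h
  obtain ⟨h1, h2, h3, h4⟩ := h
  have hE : 0 < E := Nat.le_of_ble_eq_true h1
  have hlen : rows.length = E := by
    rw [← lenN_eq]
    exact Nat.eq_of_beq_eq_true h3
  have e1 : Nat.mul 8191 (Nat.div (Nat.sub (Nat.pow 2 (Nat.mul (Nat.mul 36 E) E)) 1) 68719476735) =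
      digitMask 36 (E * E) := mask_eq' (by norm_num) (mul_assoc 36 E E).symm (by norm_num)
  have e2 : Nat.mul 68719476735 (Nat.div (Nat.sub (Nat.pow 2 (Nat.mul (Nat.mul 36 E) E)) 1)
      (Nat.sub (Nat.pow 2 (Nat.mul 36 E)) 1)) = colMask E E := mask_eq' (by positivity) rfl rfl
  have e3 : Nat.mul 32764 (Nat.div (Nat.sub (Nat.pow 2 (Nat.mul 36 E)) 1) 68719476735) =
      rowNum E fun _ => 32764 := mask_eq' (by norm_num) rfl (by norm_num)
  rw [e1, e2, e3] at h4
  have hM : MatR E ([] : List (PowerSeries (ZMod 8191))).length 0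
      (fun j i => PowerSeries.coeff i (([] : List (PowerSeries (ZMod 8191))).getD j 0)) :=
    ⟨fun _ _ => 0, fun _ _ => by norm_num, by simp [matNum], fun j hj => by simp at hj⟩
  obtain ⟨A', h5, h6⟩ := pack_sound (Nat.le_of_ble_eq_true h2) hvs hM h4
  rw [List.length_nil, zero_add, hlen, List.append_nil] at h5
  exact ⟨hlen, elim_sound hE le_rfl h5 h6⟩

/-- Rows of products of the generators, in one degree. -/
structure Entry where
  d1 : Nat
  d2 : Nat
  k : Nat
  rows : List Nat

/-- The empty entry. -/
def Entry.empty : Entry := ⟨0, 0, 0, []⟩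

/-- Multiply the selected rows. -/
def select (g : Nat) (src : List Nat) (c : Nat) (acc : List Nat) (K : List Nat → Nat → Bool) :
    Bool :=
  List.rec (fun c acc => K acc c) (fun r _ ih c acc => force (Nat.shiftRight c 1) fun c' =>
    Bool.rec (rowMul g r fun x => ih c' (x :: acc)) (ih c' acc)
      (Nat.beq (Nat.land c 1) 0)) src c acc

/-- Multiply selected rows of an entry by a generator. -/
def group (gs : List NGen) (es : List Entry) (d1 d2 k : Nat) (K : List Nat → Nat → Bool)
    (acc : List Nat) (c : Nat) : Bool :=
  NGen.rec (fun a1 a2 m u => Entry.rec (fun b1 b2 n rows =>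
    andThen (Nat.beq (Nat.add a1 b1) d1) (andThen (Nat.beq (Nat.add a2 b2) d2)
      (andThen (Nat.beq (Nat.add m n) k)
      (force (Nat.shiftRight c 17) fun c => select (getAt 0 u 0) rows c acc K))))
    (getAt Entry.empty es (Nat.land (Nat.shiftRight c 8) 511))) (getAt NGen.zero gs (Nat.land c 255))

/-- A sequence of groups. -/
def groups (gs : List NGen) (es : List Entry) (d1 d2 k ng : Nat) (K : List Nat → Bool)
    (acc : List Nat) (c : Nat) : Bool :=
  Nat.rec (fun acc _ => K acc) (fun _ ih acc c => group gs es d1 d2 k ih acc c) ng acc c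

/-- Compute all entries and check their independence. -/
def table (gs : List NGen) (cs : List Nat) (es : List Entry) : Bool :=
  List.rec (fun _ => true) (fun c _ ih es =>
    force (Nat.land c 63) fun d1 => force (Nat.land (Nat.shiftRight c 6) 63) fun d2 =>
    force (Nat.land (Nat.shiftRight c 12) 63) fun k =>
    force (Nat.land (Nat.shiftRight c 18) 255) fun E =>
    groups gs es d1 d2 k (Nat.land (Nat.shiftRight c 26) 15) (fun rows =>
      andThen (rank E rows) (ih (⟨d1, d2, k, rows⟩ :: es))) [] (Nat.shiftRight c 30)) cs es

/-- The whole computation. -/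
def program (rs cs : List Nat) : Bool :=
  startF fun f => startG fun g => ngens rs [g, f] fun gs => table gs cs [⟨0, 0, 0, [1]⟩]

/-- The subalgebra generated by leading coefficients of covariants. -/
def leadAlg (gs : List (GenData ZPoly)) : Subalgebra ℂ (MvPolynomial Idx ℂ) :=
  Algebra.adjoin ℂ {p | ∃ y ∈ gs, p = toC (y.u 0)}

/-- The row represents a leading coefficient of the given degree in the subalgebra. -/
def RowGood (gs : List (GenData ZPoly)) (d1 d2 k r : ℕ) : Prop :=
  ∃ z : ZPoly, RowP r (psiP z) ∧ toC z ∈ Ssp d1 d2 k ∧ toC z ∈ leadAlg gs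

/-- All rows represent leading coefficients. -/
def Entry.Good (gs : List (GenData ZPoly)) (e : Entry) : Prop :=
  ∀ r ∈ e.rows, RowGood gs e.d1 e.d2 e.k r

/-- Many leading coefficients in the subalgebra, independent modulo the invariants. -/
def Indep (gs : List (GenData ZPoly)) (d1 d2 k E : ℕ) : Prop :=
  ∃ z : ℕ → ZPoly, (∀ j < E, toC (z j) ∈ Ssp d1 d2 k ∧ toC (z j) ∈ leadAlg gs) ∧
    ∀ c : ℕ → ZMod 8191,
      (∀ i < E, ∑ j ∈ Finset.range E, c j * PowerSeries.coeff i (psiP (z j)) = 0) →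
      ∀ j < E, c j = 0

theorem RowGood.mul {gs : List (GenData ZPoly)} {d1 d2 k r d1' d2' k' r' : ℕ}
    (h : RowGood gs d1 d2 k r) (h' : RowGood gs d1' d2' k' r') :
    RowGood gs (d1 + d1') (d2 + d2') (k + k') (rmul r r') := by
  obtain ⟨z, h1, h2, h3⟩ := h
  obtain ⟨z', h1', h2', h3'⟩ := h'
  refine ⟨z * z', ?_, ?_, ?_⟩
  · rw [map_mul]
    exact h1.mul h1'
  · rw [map_mul, Nat.cast_add]
    exact Ssp_mul h2 h2'
  · rw [map_mul]
    exact mul_mem h3 h3'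

theorem select_sound {gs : List (GenData ZPoly)} {d1 d2 k d1' d2' k' g : ℕ}
    (hg : RowGood gs d1 d2 k g) {K : List ℕ → ℕ → Bool} {src : List ℕ}
    (hs : ∀ r ∈ src, RowGood gs d1' d2' k' r) : ∀ {c : ℕ} {acc : List ℕ},
    (∀ r ∈ acc, RowGood gs (d1 + d1') (d2 + d2') (k + k') r) → select g src c acc K = true →
    ∃ acc' c', (∀ r ∈ acc', RowGood gs (d1 + d1') (d2 + d2') (k + k') r) ∧ K acc' c' = true := by
  induction src with
  | nil => exact fun {c acc} ha h => ⟨acc, c, ha, h⟩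
  | cons r src ih =>
    intro c acc ha h
    have ih' := @ih fun x hx => hs x (List.mem_cons_of_mem _ hx)
    change force (Nat.shiftRight c 1) (fun c' => (Bool.rec (rowMul g r fun x =>
      select g src c' (x :: acc) K) (select g src c' acc K) (Nat.beq (Nat.land c 1) 0) : Bool)) =
      true at h
    rw [force_eq, rowMul_eq] at h
    revert h
    cases Nat.beq (Nat.land c 1) 0
    · refine fun h => ih' ?_ h
      intro x hx
      rcases List.mem_cons.mp hx with rfl | hx
      · exact hg.mul (hs r List.mem_cons_self)
      · exact ha x hx
    · exact fun h => ih' ha h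

theorem mem_getAt {α : Type} {P : α → Prop} {d : α} (hd : P d) {l : List α}
    (h : ∀ x ∈ l, P x) (n : ℕ) : P (getAt d l n) := by
  rw [getAt_eq]
  rcases lt_or_ge n l.length with hn | hn
  · rw [List.getD_eq_getElem _ _ hn]
    exact h _ (List.getElem_mem hn)
  · rw [List.getD_eq_default _ _ hn]
    exact hd

theorem rowGood_getAt {ngs : List NGen} {gs : List (GenData ZPoly)}
    (h : List.Forall₂ (NGen.Rep psiP) ngs gs) (i : ℕ) :
    RowGood gs (getAt NGen.zero ngs i).d1 (getAt NGen.zero ngs i).d2 (getAt NGen.zero ngs i).k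
      (getAt 0 (getAt NGen.zero ngs i).u 0) := by
  have h1 := Forall₂_getAt h (NGen.Rep.zero psiP) i
  rw [h1.d1, h1.d2, h1.k]
  refine ⟨_, h1.row 0, h1.cov.mem, ?_⟩
  have h2 := mem_getAt (P := fun y : GenData ZPoly => toC (y.u 0) ∈ leadAlg gs)
    (d := GenData.zero) (by
      change toC 0 ∈ _
      rw [map_zero]
      exact zero_mem _) (l := gs)
      (fun y hy => Algebra.subset_adjoin (Set.mem_ofPred_eq ▸ ⟨y, hy, rfl⟩)) i
  rw [getAt_eq] at h2
  exact h2

theorem group_sound {ngs : List NGen} {gs : List (GenData ZPoly)}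
    (h : List.Forall₂ (NGen.Rep psiP) ngs gs) {es : List Entry} (hes : ∀ e ∈ es, e.Good gs)
    {d1 d2 k : ℕ} {K : List ℕ → ℕ → Bool} {acc : List ℕ} {c : ℕ}
    (ha : ∀ r ∈ acc, RowGood gs d1 d2 k r) (hK : group ngs es d1 d2 k K acc c = true) :
    ∃ acc' c', (∀ r ∈ acc', RowGood gs d1 d2 k r) ∧ K acc' c' = true := by
  unfold group at hK
  have h1 := rowGood_getAt h (Nat.land c 255)
  have h2 := mem_getAt (P := Entry.Good gs) (d := Entry.empty) (fun r hr => by simp [Entry.empty] at hr)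
    hes (Nat.land (Nat.shiftRight c 8) 511)
  revert hK h1 h2
  generalize getAt NGen.zero ngs (Nat.land c 255) = x
  generalize getAt Entry.empty es (Nat.land (Nat.shiftRight c 8) 511) = e
  obtain ⟨a1, a2, m, u⟩ := x
  obtain ⟨b1, b2, n, rows⟩ := e
  intro hK h1 h2
  change andThen (Nat.beq (Nat.add a1 b1) d1) (andThen (Nat.beq (Nat.add a2 b2) d2)
      (andThen (Nat.beq (Nat.add m n) k)
      (force (Nat.shiftRight c 17) fun c => select (getAt 0 u 0) rows c acc K))) = true at hK
  rw [andThen_eq_true, andThen_eq_true, andThen_eq_true, force_eq] at hK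
  obtain ⟨e1, e2, e3, hK⟩ := hK
  have e1 := (Nat.eq_of_beq_eq_true e1).symm
  have e2 := (Nat.eq_of_beq_eq_true e2).symm
  have e3 := (Nat.eq_of_beq_eq_true e3).symm
  subst e1 e2 e3
  exact select_sound h1 h2 ha hK

theorem groups_sound {ngs : List NGen} {gs : List (GenData ZPoly)}
    (h : List.Forall₂ (NGen.Rep psiP) ngs gs) {es : List Entry} (hes : ∀ e ∈ es, e.Good gs)
    {d1 d2 k : ℕ} {K : List ℕ → Bool} : ∀ {ng : ℕ} {acc : List ℕ} {c : ℕ},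
    (∀ r ∈ acc, RowGood gs d1 d2 k r) → groups ngs es d1 d2 k ng K acc c = true →
    ∃ acc', (∀ r ∈ acc', RowGood gs d1 d2 k r) ∧ K acc' = true := by
  intro ng
  induction ng with
  | zero => exact fun {acc c} ha hK => ⟨acc, ha, hK⟩
  | succ ng ih =>
    intro acc c ha hK
    obtain ⟨acc', c', ha', hK'⟩ := group_sound h hes ha hK
    exact ih ha' hK'

theorem indep_of_rank {gs : List (GenData ZPoly)} {d1 d2 k E : ℕ} {rows : List ℕ}
    (h : ∀ r ∈ rows, RowGood gs d1 d2 k r) (hr : rank E rows = true) : Indep gs d1 d2 k E := by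
  have : ∃ zs : List ZPoly, List.Forall₂ (fun r z => RowP r (psiP z)) rows zs ∧
      ∀ z ∈ zs, toC z ∈ Ssp d1 d2 k ∧ toC z ∈ leadAlg gs := by
    clear hr
    induction rows with
    | nil => exact ⟨[], .nil, by simp⟩
    | cons r rows ih =>
      obtain ⟨zs, h1, h2⟩ := ih fun r hr => h r (List.mem_cons_of_mem _ hr)
      obtain ⟨z, h3, h4⟩ := h r List.mem_cons_self
      refine ⟨z :: zs, .cons h3 h1, ?_⟩
      intro x hx
      rcases List.mem_cons.mp hx with rfl | hx
      · exact h4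
      · exact h2 x hx
  obtain ⟨zs, h1, h2⟩ := this
  have h3 : List.Forall₂ RowP rows (zs.map psiP) := List.forall₂_map_right_iff.mpr h1
  obtain ⟨h4, h5⟩ := rank_sound hr h3
  refine ⟨fun j => zs.reverse.getD j 0, fun j hj => ?_, fun c hc => h5 c fun i hi => ?_⟩
  · have hj' : j < zs.reverse.length := by
      rw [List.length_reverse, ← h1.length_eq, h4]
      exact hj
    dsimp only
    rw [List.getD_eq_getElem _ _ hj']
    exact h2 _ (List.mem_reverse.mp (List.getElem_mem hj'))
  · refine Eq.trans (Finset.sum_congr rfl fun j _ => ?_) (hc i hi)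
    rw [← List.map_reverse]
    congr 2
    have := List.getD_map (f := psiP) (l := zs.reverse) (d := 0) (n := j)
    rw [map_zero] at this
    exact this

theorem table_sound {ngs : List NGen} {gs : List (GenData ZPoly)}
    (h : List.Forall₂ (NGen.Rep psiP) ngs gs) {cs : List ℕ} : ∀ {es : List Entry},
    (∀ e ∈ es, e.Good gs) → table ngs cs es = true → ∀ c ∈ cs,
    Indep gs (Nat.land c 63) (Nat.land (Nat.shiftRight c 6) 63) (Nat.land (Nat.shiftRight c 12) 63)
      (Nat.land (Nat.shiftRight c 18) 255) := by
  induction cs with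
  | nil => intro es _ _ c hc; simp at hc
  | cons c cs ih =>
    intro es hes ht
    have ht' : force (Nat.land c 63) (fun d1 => force (Nat.land (Nat.shiftRight c 6) 63) fun d2 =>
      force (Nat.land (Nat.shiftRight c 12) 63) fun k =>
      force (Nat.land (Nat.shiftRight c 18) 255) fun E =>
      groups ngs es d1 d2 k (Nat.land (Nat.shiftRight c 26) 15) (fun rows =>
      andThen (rank E rows) (table ngs cs (⟨d1, d2, k, rows⟩ :: es))) [] (Nat.shiftRight c 30)) =
      true := ht
    rw [force_eq, force_eq, force_eq, force_eq] at ht'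
    obtain ⟨rows, h1, h2⟩ := groups_sound h hes (fun r hr => by simp at hr) ht'
    rw [andThen_eq_true] at h2
    intro x hx
    rcases List.mem_cons.mp hx with rfl | hx
    · exact indep_of_rank h1 h2.1
    · refine ih ?_ h2.2 x hx
      intro e he
      rcases List.mem_cons.mp he with rfl | he
      · exact h1
      · exact hes e he

theorem program_sound {rs cs : List ℕ} (h : program rs cs = true) :
    (∀ c ∈ cs, Indep (rs.foldl recipeStep [quarticData ℤ, sexticData ℤ]) (Nat.land c 63)
      (Nat.land (Nat.shiftRight c 6) 63) (Nat.land (Nat.shiftRight c 12) 63)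
      (Nat.land (Nat.shiftRight c 18) 255)) ∧
    ∀ y ∈ rs.foldl recipeStep [quarticData ℤ, sexticData ℤ], y.IsCov := by
  unfold program at h
  obtain ⟨f, hf, h⟩ := startF_rep h
  obtain ⟨g, hg, h⟩ := startG_rep h
  obtain ⟨L, hL, h⟩ := ngens_rep rs (.cons hg (.cons hf .nil)) h
  refine ⟨fun c hc => table_sound hL ?_ h c hc, ?_⟩
  · intro e he
    rw [List.mem_singleton] at he
    subst he
    intro r hr
    change r ∈ [1] at hr
    rw [List.mem_singleton] at hr
    subst hr
    refine ⟨1, ?_, ?_, ?_⟩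
    · rw [map_one]
      exact RowP.one
    · rw [map_one, mem_Ssp]
      refine ⟨?_, ?_⟩
      · rw [mem_Wsp]
        exact isWeightedHomogeneous_one _ _
      · exact Derivation.map_one_eq_zero _
    · rw [map_one]
      exact one_mem _
  · intro y hy
    clear h
    revert hL hy
    generalize rs.foldl recipeStep [quarticData ℤ, sexticData ℤ] = gs
    intro hL hy
    induction hL with
    | nil => simp at hy
    | cons h1 _ ih =>
      rcases List.mem_cons.mp hy with rfl | hy
      · exact h1.cov
      · exact ih hy

/-- Transvectant recipes. -/
def recipes : List Nat := [
  393473, 262658, 131843, 263171, 197892, 132613, 67334, 263943, 133128, 264711, 133896, 68617,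
  68873, 265483, 200204, 134925, 266253, 69903, 201231, 135952, 70673, 136465, 202257, 71443,
  137235, 71956, 72212, 269074, 72723, 400914, 139028, 73749, 74005, 139543, 270871, 74521,
  205849, 271641, 140827, 75548, 272411, 272665, 272921, 142108, 207899, 77086, 142877, 208668,
  77856, 78112, 143903, 275226, 144414, 144670, 79392, 79648, 276761, 211482, 80667, 277276,
  211997, 277789, 146975, 212767, 81953, 147745, 279073, 279325, 148514, 148770, 214561, 214817,
  84006, 84262, 150053, 150309, 281635, 281886, 150072, 151331, 151587, 217377, 85564, 86822,
  152612, 152863, 87585, 150861, 88351, 154143, 285216, 154402, 220194, 89380, 155172, 286500,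
  286753, 282960, 156197, 156453, 222244, 288034, 288540, 157479, 288797, 289053, 289309, 158501,
  158757, 159013, 224801, 93994, 159779, 291100, 154716, 160546, 160802, 161058, 358173, 292894,
  288601, 293152, 293408, 293917, 293917, 294173, 163362, 163618, 229408, 98597, 295450, 159073,
  159329, 165154, 165410, 165666, 165922, 166178, 297753, 297754, 161376, 167199, 167455, 161882,
  167963, 168219, 299802, 299803, 168989, 103710, 160884, 161140, 170014, 170270, 170526, 302105,
  162416, 162417, 162673, 160370, 291440, 172313, 161133, 173072, 164459, 173330, 304912, 162670,
  162671, 160880, 160881, 174866, 161646, 161647, 162140, 161398, 307468, 307469, 291698, 176909,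
  161391, 159843, 423261, 177926, 162396, 157533, 352608, 163140, 155735, 153670, 149316, 149548]

/-- Selections of products. -/
def selections : List Nat := [
  140943714172992, 141219665829889, 141483806310528, 141493470003328, 142038930825281,
  142312734998593, 142586539171905, 142860343345217, 142868933288001, 143415467851778,
  143689272033282, 143418689110018, 144212184268992, 144485988458688, 143967371165888,
  38022066372379943041, 38093561289194881153, 38165336334514282625, 38237112453575508097,
  37812367814304505985, 146426239909954, 146700044083266, 38528160311093510210,
  38599655227908448322, 10137483055679058591121474, 38743206386920366146, 38028541421052018754,
  148354680233987, 148628484415491, 148902288588803, 146442346078211, 149450970677251,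
  146717224001539, 146441272312064, 149455265628416, 150508606324929, 39526555862048448705,
  39598050778863386817, 20692931952046950111535297, 79080823172931289281, 79224375411053732033,
  39889941443182592130, 39961436359997530242, 721164106909528374819269094631817346,
  722446974210709728878605251552501890, 10908460056532195757759235915906,
  41687800211227135781937282, 84132135011354327609819266, 40396598333997064259,
  10608394050002139822702659, 2785859194210533747109938618435, 2790772379275994851456496730179,
  5543400510022558668178163277891, 21146391598574905236439107, 161334568692445405251,
  156029786783748, 156303590965252, 156577395138564, 40405882098007179268, 157126077227012,
  40477939966923030532, 149466003070980, 40621773680022192132, 154677945844032,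
  41535165471637643521, 10907010168241872509354241, 21258847270526180144472321,
  41753312897178009794, 2874140221820122608869881946306,
  791388149232538140761462931040838128517314, 5822827351197025663864934736139935938,
  47164967196143420842356250134931079362, 160661909012611, 759984786980059787118560959593193603,
  52313217957303121192488242558975258037690581123, 3047389239825668692057223676147493576925315,
  66034864893569773866187151785700393091, 375332396091322176086236227595309981827,
  162319766388804, 42622792417025728580, 769111906118374833876576677955649604,
  770394773420080812904188763945852996, 2937472182195396519455129871910207556,
  22728235464790591526184198905924, 506343645607328677234029491175492, 164247132971013,
  164520937144325, 41198515907302285317, 165069619232773, 10837650987830727536320517,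
  41270573776218144773, 82828946712663220229, 162629004034432, 42705827851909210433,
  11213818500005974109864257, 229823060299486355777, 11490520716649646628012290,
  790905438373751080629289442354667778, 424368082624849242321334405171931516853769748738,
  66158877465957813336596055985899725058, 11566669166672670836392131,
  218839441241290959372956476844354337865052987587,
  229841008772085405655792939285719099967822204956065987,
  581209200620465618617388196449091228332286592704707, 11642891403944314431864964,
  210073323053045542423497901818014906982532,
  231350714813774674610442908031507184460227787713691780,
  9246832153583196181207006289170087802575904858244,
  13369281642909919926386039391606646004508453883117700, 170807695507525,
  3081921512910160703968452288581, 809190100381893226200335634541068357,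
  1106403007987710231798599969656372136534085, 1550938497715216461978687940508829836673093,
  377988261004649734821706691961061941317, 172460184174598, 43285942302826577926,
  45353110106414800902, 10856540525819800155095046, 41342631370256064518,
  43501637281874108258238470, 164278271476097, 445753248457089, 91540610679736893762,
  1651623196922659901765293607120019778, 3434840780651053320113732161952535530039747035458,
  12055288387621734148997379, 478301619431596139186781936218848804200777005269262595,
  258236340878495725763572231318233966493007619779530969749337365113749763,
  1140178408985821972300676622923875659611206082819, 1667331983078429897220372729005867204,
  4134391166948485884238758716627321230580038300715619026268594372,
  15867579289334621414878424650558172392955663206238811924216644124868,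
  148695938566236035644149013226760639057097387387150532, 46567960740167680133,
  60541109396784265178030325947228202560471508883873925,
  33334037310386390756914288171220682306936793358339469323053580421,
  976547780342463652933053028346965488304315096822402021464498309, 46857584316737126470,
  3224923475771423069989109768262, 106452316392914621269000123013102649914284851270,
  426520099121910060030276708046601163019705933894, 49543259591025232615414575103067906737733702,
  47218436615564697607, 180397283753991, 11347149987088166680289287, 11384783432425204567801863,
  43350521266191353703866375, 42920586406519120321, 90151250194693095810, 950901166025926517122,
  6778190736310736197090213599083763784759475454338, 3288541559546430187480338661699,
  150953496952368774911842112887644220625290560282947,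
  1924018123324361470186261072682693362606233002153006984914288963,
  1816083286267556791299959631479903663161604,
  144099487290068652057927558619776503130915515639800578671074299934941444,
  2076344472873082652884570100625925698769920754052768673811129661670310148,
  869880372033433255197889529017270469,
  1360516690157667999529345876985867193145893327436992016243254632645,
  16004971314647393445774997930449199960152149288908109503495864063377605,
  148977524906789412588354346405533828174286064856359109, 6676545586045857995320213110918,
  16554463106949072691906400931221551348197098462933313921158,
  8153258542914227818822693646735886739414929022057494260845408527186149510, 186139655012423,
  1760632895254056297488547334487285831, 484668795991681893529260340048156074122410213447,
  54962273571676765792896836678393926706964467048519, 171972705386504, 187515118297096,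
  11836802233033501795172360, 45153817111636238344, 43048436952894446981382152, 163178759848512,
  42849943589740880385, 116419340011049845186, 49481770514533702389563420844482,
  104280361556369501303865731, 2145702646443229475903075114434141668853732178382954316937306499,
  51470201913189547507682342853874811204,
  90639970889922946414750929591119416959324681574790111699268,
  1124357877309582299292249967421815840577736144730876148084444690346693918459344470340,
  248010321035211550907250043466211965349761646853,
  93096675196275273700266899787384005282851940811266571960028896244320888955141,
  497456258019018987425626129942774144335352430790,
  2526001911323741543393675440116901690136112411323407087047338213740890025631942,
  64131046586869521113520244033428192459332324394423298123127246366458054,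
  3466690219142948292113923571847, 3908221816973418103499381061857157983939422339169718563250311,
  32391528927205899378350698662398992264454887122650860938036213462836723847,
  14982536890239974939566452842173394754970181379884956682838151, 13300221345877921022869576,
  1830545155772380961704496852056416328, 4708875682904637183369976423300285873156913119304,
  44793527492179140617, 51024828751462023177, 11759601681534779300102062497801, 161804370313793,
  1005954423063042, 146499951924440862140408322, 123956333276275541219213763,
  121136953000697161294828520950226054863833319243560568758723,
  1804807584978872015996943816376014499718103428,
  599748767325149863220574064408953760834290058110258190136671662444977061208531332,
  65497223398361795734250439603471966467238022086981,
  330755764164493834140473769852924760494261506067551510937691676179939751704481011976153080133,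
  238048637757566308803178934878583673875727640166662,
  663580458255127376392718214285359071033218493501148812998562344430206949138755934539755561222,
  140076934146292224876240206225297675181564827270649548535058587608745347124743651590,
  515268848747512080864434478263230958567869120711,
  9949012659783402675219892446606609123266499009909591521542788297584798257815712964807,
  1971060412359249366927041102437461321056392,
  4551208622280567950970981102283419675035250291919170046271624,
  3868181321112254938455432117123087361516713394695177416821669118088, 52389981288997060681,
  1854079476226599128059030096961949027569796128841,
  3673261637197313846612107219819578792110502962233884745,
  1269836026439007792344073162654944739417258954874953, 52678774065346379786, 201226801389578,
  23333476646094096091332618, 30990720111090930967142410, 85492475884539969321598986,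
  1005679545156162, 8886978893849154, 354264285192859681283,
  2338612268439547975954155733156419794458008101379,
  7523132524753939861462772025306778494631506137842116,
  298021699190596031843768199715728195222153971732750516101693993374977014187172292,
  14999497042571758890163912379615431537997676764463493,
  828181195242777451109507829652398222574556998875884210573312447612528403063000404500722677994638837028660879891907857359237,
  1009805190810848005735532705227479698717526261139484874113350,
  3022501637209073383740813726009110579055675455537514076686268180873763794628955015547441969958172499515949195590,
  35727500979740788182323955005794269459025506281491267847,
  2692996741470473144254910564279413019571269312920190592006172691233803944951150422174933224005895,
  466574141825942749427788223055366159935220548632776,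
  25384120365491982688207705765456091006731339873389977217644717995879117845610552893640,
  2520712740234162546347434394703675551117312837117000944837538611918350336200,
  1949784752370093670628441781196816521,
  4274181400642897935559113396940180651755234374879087194800774384272561391949324425,
  7457723051994827356874665361482, 538096419096270282694343061503026712031613165642,
  7741312803801673203684480043015731555788876523536446533156938, 24198483020899961325494283,
  12118079261909050163216395, 121702106191543049102319627,
  61949457335657004629808897628304466258259517462282756,
  280682031886009269690517843980096142191644745706686819123949690854815310340,
  27451832416041762150162968294216301418671130654459298245,
  390597925228595766325264806609355027813490542627941612023584204161138552765855698999431032401817116272020748369928645,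
  143030704062193581037459433614773714482534679869452743583165930025185797996934,
  28730181583832472023802961487889766174055685490227851767169855470138639404172776802173973326394558472412801417418187212011938076172493190,
  3982732923724179185961410876762079607137998372686420154515783,
  13421749874912222807217881989048604020193308653797650391495050904002828479085705873323038027037069969358621049006717125226406215,
  22200340528098499017521918705477063806654627982034075912,
  696111368140914069759315322439343872427143117754560622308173529744585021004341345082724153399974306056,
  36828375210517949192639577910228199257778157833324069065,
  57682151958205019832209574383562087825085825137776489455669862985916048283723316064166089,
  1071423013387737038350561185366154,
  4263168238836367264413060094728209395902525211862192686429021996851338,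
  8015531782358765858734878027841279988452360564462749337167725184901726346,
  14620789654552739612196939, 214915177619165265661182162641226820092964725858379,
  47587452212702871564, 55990324692446093324, 45836110930427137559379980,
  2273196713459675397004177179204,
  38292645898472301939966097705489759142944348681881505007848245019035841952345989984771646020,
  14695490411844660522912644455913980692941674354049541,
  206153388039229740635198583298524654332132991560260366408014228488530551753761094038475934802437,
  140688804009907828910897823365646831119177335071724330030139356369387974,
  12450011024905920365737851739801561738491397561244804803350744946327855236491114570252534715512566648860436603334,
  131943967341737690334331321752345851877308589547554853489355082957191,
  243616239456258455337848893919171779395226355296946121074317685152576637860283169419095240706597066919812818539389319,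
  8417508180647170762142766144708759618894285094246521933174734752842056,
  1347606263813838368669567192984264087260265557869184009221136869609163074137863984391027467975786478779769160,
  22164412332633383803491940059949497023517277834117906697,
  43854848268841643837132248514946955018003959792183044036247957946217470874184208099897322148827701760008134921,
  1872173084682751836103476505306466255673353034913808586,
  100868729116609069518572805961907338027481062763204550324895305699772562696405039476908234,
  17270208009692444687924519469408040754872459,
  1115813247349317546474714471701920602765682635399608596465897238206332805259,
  99193542395610322611470412, 7494861691474926195857190055181163694915469713484,
  9818310588176658661760124111491295671066838229376258818124, 49445625107868284359811085,
  23745208904942630820921357, 551680361849836229760147469,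
  5488768792228356021327800707092525796241259299401892358,
  909305247996405759526967201705728205191683581512331564261216171272256926100590108036566229330815150623321680970723479260295913534569012732371462,
  2087513409957887676512114032854638820943287073459236857835619276816839,
  27061219541887428841458266485342188162052677273199111827005329735629589407488261423040127299196612642841195499587616906781545489208048474601300423,
  74373802764878391733378811568549656100973356993666646414665751363684589087228296,
  24256164708631971556924879082017453443995576953836773002984590240956776122891066452192669692380773970476393114374399128727545085960584,
  16031216119609013450927841169835112650292907311915221409251721545,
  1626271721871164415561370685997696539148681270912898096956582721474251177709504552360916360807716596647673600414136955705601302857,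
  259677076147798584533248246711470279837858856112928905156451805954314,
  10743845768908926616297889520550907725959727983554585787691848228627230693805613362207782207637257789120778,
  57850692747570290599383858922054085222038220984811723,
  2531328275291805944112931367253903405406949464608288907833797096080603993010046789133765490812657867,
  3626139313428433963237350764447867531576213644,
  137044776801540366480866075464518043202059295977553398262388092771521536140,
  30790070632012833847509069, 3645151587717927202627617384852639392582464761241677,
  445751100964878, 46650701016308654094, 190030076042745055984780253609998,
  1169614967631051312213170420644724625718395655576089210151364580261738023842594685384,
  12080952425625956265718561305223580881670666680405550093664438723329723957347035462874003694992362340699536939760336075779281871229337682972508439483878604017667505968307638116636792474871092160613761425864,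
  15951316160556431255643972683422747912225837363289366752697023614636728254857,
  19613177171709432275068931810982216175047460820667019866280078806226383675699222675882125771834299157916654065636212880326605574239365508977003331361998373050391782578804533502345,
  9356811357127327696601831029348845569701655040215937915066359110131670642868355402,
  57873921569051776697320594363428122185643454790829873685430885425519720697360143874439628310880704330640138350655781028141277542975773522657717187518794,
  1769383775248773317425220714617331004002699741193879701160203,
  6870978768473619722063720944870824659881816331646189719454435361360676223564666746029593367142523585485438633231820834064033793188107,
  1955471595533194007883362825230814204770596158400158419534217420,
  2592862935774604350041951232786966884759696399339752508601180371815708416401537261292179177406763430643769548,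
  1106853079809956486143282630921181724813,
  4751616482618140048691562753630896791181839583573230162693952582050370764478974694006925,
  101318149697288999645954329804878, 448325898185054452480695634473518102269931601010766,
  229248241762319, 93016095010822840961474575, 93016095010822840961482767,
  51833514319104857160600478315529817452140738440779161181778278087572259348069022704672702858,
  16761827257672328917156795919775905856833989175679654509275699853544689253018163131724586306587823100061725312684922746887207658607382675799856288965619869314955217795009587029200268018326064812731597592111358346,
  20828899580145468998986529129346756222231814630472403803235930865995,
  846256014243278522325415727454261390076427529713334697197605116077912277217726560464426837066695584094374088507998487499528798804508111277104819046543383737085332774196312974705041739,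
  35128011673033361003793163908973188865321977320320020397662353864361032810764,
  73673009084425040301048260798330997773770825677351514402125858294589603487795036152344825183702057019745416000808768223081746202305301324044,
  167867928647824633863816186040163737267540514046157,
  263313205455400399781370783559710441537097025079477840206351328033443596996357350992189723859038575783280074022568983797965,
  1871821201427420374033970297696182726217164869109022862,
  188802296136579098025451333344761191348552148868773901100852347443689189916549262,
  94809362980608860656762959, 246529797694575022680274841651466013017387532237686208208975,
  90707442272624705552, 90707442272624713744, 743640661814582121988765010378768,
  890838903936313329408859469278246761532781306992132252305371609971096000741122205548876,
  8993192035320526114720656826486087050748745906458223222926035232024955304387200963076033392404047051694880704548424386568339912935004033984959264700321346543613834858727071084517345734296743949701488582988,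
  24146237613511585839422257334904761778275778690138481402239703580941,
  3226149416767350799913704984008279833824587105640001940274449965180849246918896424210866434604154616539790666720772578389606108988636197386337474747264484446576909,
  134007747791055801229735489453362685274877163938427004831751964721358,
  8829684105741743307131209234012593334806878150993001774491342853316472842552804381241109445036617480894730100547790,
  13152070478942876352525060192541062463631,
  162817755279141135427764242951410353344791335449951005008961538392678748229268415145405769794400821391,
  425537481170774532690500231257588236368,
  7313226318058137278916527095809597564963187522312057397328, 101774326071538303948527632916497,
  47341131301127078027583955943441,
  25842020937302608757192637903529821677176954544112288094330396822716358066446,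
  4139144656278959782061586511185653492527839770957471814024377507607223869731681664262069807826163377151331969785042865355598623086041262588126068551042302641827963740430,
  3777459869386459873020449699803391068805917713105040,
  18636600662734144232031406187847837169249132720853880166403018378844898246257601562217291920,
  246229467978372218361741393, 243212695427143799688674411250913146430529896836539787791048785,
  87248672261246025746, 22871715941367516354322450, 1920543810292985030381158418,
  31443493678706829920923485984678954816622465938045729504167630488376443088,
  410503974755552181056105020446642551129460946872490903283249818619179192394324249643685180930466889818923354410085723486659078287209702105296,
  13287120310649458372251705705758802,
  893728074169504210859168006348081612815770205217089780981842, 152456373993491,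
  714967330813197050992926739, 181441830662042346959739662909459,
  886408257991819697904072440578602848846133184984121082002,
  2443073670575091929519873684416361681633477077679191649648345920467822720038473615786395945151617310866,
  190827517543535607828, 43552186450266568025972756, 44347809303765154908991667999621140,
  95686476842335514420812611507638370304084,
  949312206598479267283194233799228936394470814355346885555172559822932, 155142876037141,
  1331095661524900961199333397, 1395753799936343168634819904552981, 159221251785236676630,
  90048460905170190827789661773846, 144759792599063, 5500658036676037281573419713306647,
  5420756066586001758117015457906711, 309219264950200172568, 162119985965480696996438040,
  41365705962868441113, 21556408660753018706115155439919129,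
  11219308303506273226790467915132528246809, 305184038859442487322,
  83888086485066287775118430052378, 37931711246998437915, 172736490206811945157637998994792475,
  605756529515085430812, 3746239091218608373547671580, 424585502130205,
  682016467356331169412331592595546141, 2597075496590734860230590494,
  1329530326784134430128813793615902, 75575329657595887647, 5445747142657400869741166275032260639,
  1206901511101248962592, 179425846319006952077147761213763837239328, 75431214469520031777,
  43482895216661284171466250910389772321, 2413803160841758965794, 153069331120835788835,
  347198567561155049817781123417646309411, 149997875625213296677,
  23899441023089840844676703299754612275294005370917]

set_option maxRecDepth 100000 in
theorem program_eq : program recipes selections = true := by decide +kernel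

section Counting
variable {r : ℕ}

/-- Multiplicities with prescribed total of the first coordinates. -/
def soln (v : Fin r → ℕ × ℕ) (n : ℕ) : Finset (Fin r → ℕ) :=
  (Fintype.piFinset fun _ => Finset.range (n + 1)).filter fun f => ∑ i, f i * (v i).1 = n

theorem mem_soln {v : Fin r → ℕ × ℕ} (hv : ∀ i, 0 < (v i).1) {n : ℕ} {f : Fin r → ℕ} :
    f ∈ soln v n ↔ ∑ i, f i * (v i).1 = n := by
  unfold soln
  rw [Finset.mem_filter, Fintype.mem_piFinset, and_iff_right_iff_imp]
  intro h i
  rw [Finset.mem_range, ← h]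
  refine Nat.lt_succ_of_le ((Nat.le_mul_of_pos_right _ (hv i)).trans ?_)
  exact Finset.single_le_sum (f := fun i => f i * (v i).1) (fun _ _ => Nat.zero_le _)
    (Finset.mem_univ i)

/-- Weighted count of multiplicities. -/
def genNum (v : Fin r → ℕ × ℕ) (B n : ℕ) : ℕ := ∑ f ∈ soln v n, B ^ ∑ i, f i * (v i).2

theorem genNum_cons {v : Fin (r + 1) → ℕ × ℕ} (hv : ∀ i, 0 < (v i).1) (B n : ℕ) :
    genNum v B n = genNum (fun i => v i.succ) B n +
      if (v 0).1 ≤ n then B ^ (v 0).2 * genNum v B (n - (v 0).1) else 0 := by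
  have hv' : ∀ i : Fin r, 0 < (v i.succ).1 := fun i => hv _
  unfold genNum
  rw [← Finset.sum_filter_add_sum_filter_not _ fun f => f 0 = 0]
  congr 1
  · refine Finset.sum_bij' (fun f _ => fun i => f (Fin.succ i)) (fun f _ => Fin.cons 0 f) ?_ ?_ ?_ ?_ ?_
    · intro f hf
      rw [Finset.mem_filter, mem_soln hv, Fin.sum_univ_succ] at hf
      rw [mem_soln hv']
      rw [hf.2, zero_mul, zero_add] at hf
      exact hf.1
    · intro f hf
      rw [mem_soln hv'] at hf
      rw [Finset.mem_filter, mem_soln hv, Fin.sum_univ_succ]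
      simp [hf]
    · intro f hf
      rw [Finset.mem_filter] at hf
      funext i
      refine Fin.cases ?_ (fun i => ?_) i
      · simp [hf.2]
      · simp
    · intro f hf
      funext i
      simp
    · intro f hf
      rw [Finset.mem_filter] at hf
      rw [Fin.sum_univ_succ, hf.2, zero_mul, zero_add]
  · have key : ∀ (f : Fin (r + 1) → ℕ) (w : Fin (r + 1) → ℕ),
        ∑ i, Function.update f 0 (f 0 + 1) i * w i = ∑ i, f i * w i + w 0 := by
      intro f w
      rw [Fin.sum_univ_succ, Fin.sum_univ_succ]
      simp only [Function.update_self, ne_eq, Fin.succ_ne_zero, not_false_eq_true,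
        Function.update_of_ne]
      ring
    have hup : ∀ f : Fin (r + 1) → ℕ, f 0 ≠ 0 →
        ∃ g : Fin (r + 1) → ℕ, f = Function.update g 0 (g 0 + 1) := by
      intro f hf
      refine ⟨Function.update f 0 (f 0 - 1), ?_⟩
      funext i
      by_cases hi : i = 0
      · subst hi
        simp only [Function.update_self]
        omega
      · simp [Function.update_of_ne hi]
    split_ifs with hn
    · rw [Finset.mul_sum]
      symm
      refine Finset.sum_bij (fun f _ => Function.update f 0 (f 0 + 1)) ?_ ?_ ?_ ?_
      · intro f hf
        rw [mem_soln hv] at hf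
        rw [Finset.mem_filter, mem_soln hv, key, hf]
        exact ⟨Nat.sub_add_cancel hn, by simp⟩
      · intro f _ g _ hfg
        funext i
        have := congrFun hfg i
        by_cases hi : i = 0
        · subst hi
          simpa using this
        · simpa [Function.update_of_ne hi] using this
      · intro f hf
        rw [Finset.mem_filter, mem_soln hv] at hf
        obtain ⟨g, rfl⟩ := hup f hf.2
        refine ⟨g, ?_, rfl⟩
        rw [key] at hf
        rw [mem_soln hv]
        omega
      · intro f _
        rw [key, pow_add, mul_comm]
    · refine Finset.sum_eq_zero fun f hf => ?_
      rw [Finset.mem_filter, mem_soln hv] at hf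
      obtain ⟨g, rfl⟩ := hup f hf.2
      rw [key] at hf
      omega

theorem genNum_zero (v : Fin 0 → ℕ × ℕ) (B n : ℕ) : genNum v B n = if n = 0 then 1 else 0 := by
  have hv : ∀ i, 0 < (v i).1 := fun i => i.elim0
  unfold genNum
  split_ifs with h
  · subst h
    have : soln v 0 = {fun i => i.elim0} := by
      ext f
      rw [mem_soln hv]
      simp only [Finset.univ_eq_empty, Finset.sum_empty, Finset.mem_singleton, true_iff]
      exact Subsingleton.elim _ _
    rw [this]
    simp
  · refine Finset.sum_eq_zero fun f hf => ?_
    rw [mem_soln hv] at hf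
    simp at hf
    exact absurd hf.symm h

theorem digit_sum {α : Type*} [DecidableEq α] (s : Finset α) (g : α → ℕ) (b e : ℕ)
    (h : s.card < 2 ^ b) :
    (∑ x ∈ s, (2 ^ b) ^ g x) / (2 ^ b) ^ e % 2 ^ b = (s.filter fun x => g x = e).card := by
  classical
  obtain ⟨M, hM⟩ : ∃ M, ∀ x ∈ s, g x < M :=
    ⟨s.sup g + 1, fun x hx => Nat.lt_succ_of_le (Finset.le_sup hx)⟩
  have hM' : ∀ x ∈ s, g x ∈ Finset.range (e + 1 + M) := fun x hx =>
    Finset.mem_range.mpr ((hM x hx).trans_le (by omega))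
  have h1 : ∑ x ∈ s, (2 ^ b) ^ g x =
      ∑ i ∈ Finset.range (e + 1 + M), (s.filter fun x => g x = i).card * (2 ^ b) ^ i := by
    rw [← Finset.sum_fiberwise_of_maps_to hM']
    refine Finset.sum_congr rfl fun i _ => ?_
    rw [Finset.sum_congr rfl fun x hx => by rw [(Finset.mem_filter.mp hx).2], Finset.sum_const,
      smul_eq_mul]
  have hd : ∀ i, (s.filter fun x => g x = i).card < 2 ^ b := fun i =>
    (Finset.card_filter_le _ _).trans_lt h
  rw [h1, Finset.sum_range_add, Finset.sum_range_succ]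
  have h2 : ∑ x ∈ Finset.range M, (s.filter fun y => g y = e + 1 + x).card * (2 ^ b) ^ (e + 1 + x) =
      (2 ^ b) ^ e * (2 ^ b * ∑ x ∈ Finset.range M,
        (s.filter fun y => g y = e + 1 + x).card * (2 ^ b) ^ x) := by
    rw [Finset.mul_sum, Finset.mul_sum]
    refine Finset.sum_congr rfl fun i _ => ?_
    ring
  rw [h2, mul_comm ((s.filter fun x => g x = e).card), add_assoc, ← mul_add,
    Nat.add_mul_div_left _ _ (by positivity), Nat.div_eq_of_lt (sum_lt_base b e _ hd), zero_add,
    Nat.add_mul_mod_self_left, Nat.mod_eq_of_lt (hd e)]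

theorem genNum_digit (v : Fin r → ℕ × ℕ) (b n e : ℕ) (h : genNum v 1 n < 2 ^ b) :
    genNum v (2 ^ b) n / (2 ^ b) ^ e % 2 ^ b =
      ((soln v n).filter fun f => ∑ i, f i * (v i).2 = e).card := by
  refine digit_sum _ _ b e ?_
  simpa [genNum] using h

/-- The values of the counting function, in decreasing order. -/
def countList (v : Fin r → ℕ × ℕ) (B : ℕ) : ℕ → List ℕ
  | 0 => []
  | n + 1 => genNum v B n :: countList v B n

theorem getAt_countList (v : Fin r → ℕ × ℕ) (B len j : ℕ) :
    getAt 0 (countList v B len) j = if j < len then genNum v B (len - 1 - j) else 0 := by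
  induction len generalizing j with
  | zero => rfl
  | succ n ih =>
    cases j with
    | zero => simp [countList, getAt]
    | succ j =>
      change getAt 0 (countList v B n) j = _
      rw [ih]
      have : n - 1 - j = n + 1 - 1 - (j + 1) := by omega
      rw [this]
      simp

end Counting

/-- Add one variable to a table of counts. -/
def countStep (b m e : Nat) (T : List Nat) (K : List Nat → Bool) : Bool :=
  List.rec (fun K => K []) (fun x _ ih K => ih fun T =>
    force (Nat.add x (Nat.mul (Nat.pow (Nat.pow 2 b) e) (getAt 0 T (Nat.sub m 1)))) fun y => K (y :: T)) T K

theorem countStep_eq {r : ℕ} {v : Fin (r + 1) → ℕ × ℕ} (hv : ∀ i, 0 < (v i).1) (b len : ℕ)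
    (K : List ℕ → Bool) :
    countStep b (v 0).1 (v 0).2 (countList (fun i => v i.succ) (2 ^ b) len) K =
      K (countList v (2 ^ b) len) := by
  induction len generalizing K with
  | zero => rfl
  | succ n ih =>
    change countStep b (v 0).1 (v 0).2 (countList (fun i => v i.succ) (2 ^ b) n) (fun T =>
      force _ fun y => K (y :: T)) = _
    rw [ih, force_eq, getAt_countList]
    change K _ = K (genNum v (2 ^ b) n :: countList v (2 ^ b) n)
    congr 2
    rw [genNum_cons hv (2 ^ b) n]
    change _ + (2 ^ b) ^ (v 0).2 * _ = _
    congr 1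
    have := hv 0
    by_cases h : (v 0).1 ≤ n
    · rw [if_pos h, if_pos (by rw [Nat.sub_eq]; omega), Nat.sub_eq]
      congr 2
      omega
    · rw [if_neg h, if_neg (by rw [Nat.sub_eq]; omega), mul_zero]

/-- The table of counts without variables. -/
def countBase (len : Nat) (K : List Nat → Bool) : Bool :=
  Nat.rec (fun K => K []) (fun n ih K => ih fun T =>
    Bool.rec (K (0 :: T)) (K (1 :: T)) (Nat.beq n 0)) len K

theorem countBase_eq (v : Fin 0 → ℕ × ℕ) (B len : ℕ) (K : List ℕ → Bool) :
    countBase len K = K (countList v B len) := by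
  induction len generalizing K with
  | zero => rfl
  | succ n ih =>
    change countBase n (fun T => Bool.rec (K (0 :: T)) (K (1 :: T)) (Nat.beq n 0)) = _
    rw [ih, countList, genNum_zero]
    cases n <;> rfl

/-- Compute a table of counts. -/
def countTab (b : Nat) (L : List (ℕ × ℕ)) (len : Nat) (K : List Nat → Bool) : Bool :=
  List.rec (fun K => countBase len K) (fun g _ ih K => ih fun T =>
    Prod.rec (fun m e => countStep b m e T K) g) L K

theorem countTab_eq {L : List (ℕ × ℕ)} (hL : ∀ g ∈ L, 0 < g.1) (b len : ℕ) (K : List ℕ → Bool) :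
    countTab b L len K = K (countList L.get (2 ^ b) len) := by
  induction L generalizing K with
  | nil => exact countBase_eq _ _ _ _
  | cons g L ih =>
    change countTab b L len (fun T => countStep b g.1 g.2 T K) = _
    rw [ih fun x hx => hL x (List.mem_cons_of_mem _ hx)]
    exact countStep_eq (v := (g :: L).get) (fun i => hL _ (List.get_mem _ _)) b len K

/-- The coefficients, each with the code of its degree and weight. -/
def coefCodes : List (ℕ × ℕ) :=
  [(1, 0), (1, 1), (1, 2), (1, 3), (1, 4), (1, 5), (1, 6), (1, 256), (1, 257), (1, 258), (1, 259),
    (1, 260)]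

/-- The codes as a function on `Fin 12`. -/
def coefCode : Fin 12 → ℕ × ℕ := coefCodes.get

theorem coefCode_pos : ∀ i, 0 < (coefCode i).1 := by decide

/-- Homogeneous polynomials as combinations of monomials. -/
def weightedHomogeneousEquiv {σ M : Type*} [AddCommMonoid M] (w : σ → M) (m : M) :
    weightedHomogeneousSubmodule ℂ w m ≃ₗ[ℂ] ({s : σ →₀ ℕ | Finsupp.weight w s = m} →₀ ℂ) :=
  (LinearEquiv.ofEq _ _ (weightedHomogeneousSubmodule_eq_finsupp_supported ℂ w m)).trans
    (AddMonoidAlgebra.supportedEquivFinsupp (R := ℂ) (S := ℂ)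
      {s : σ →₀ ℕ | Finsupp.weight w s = m})

theorem finrank_weightedHomogeneous {σ M : Type*} [AddCommMonoid M] (w : σ → M) (m : M) :
    Module.finrank ℂ (weightedHomogeneousSubmodule ℂ w m) =
      Nat.card {s : σ →₀ ℕ // Finsupp.weight w s = m} := by
  rw [(weightedHomogeneousEquiv w m).finrank_eq, Module.finrank, rank_finsupp_self,
    Cardinal.toNat_lift]
  rfl

/-- The exponent of a monomial, as a function on `Fin 12`. -/
def expEquiv : (Idx →₀ ℕ) ≃ (Fin 12 → ℕ) :=
  Finsupp.equivFunOnFinite.trans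
    (Equiv.arrowCongr (finSumFinEquiv : Fin 7 ⊕ Fin 5 ≃ Fin 12) (Equiv.refl ℕ))

theorem sum_expEquiv (s : Idx →₀ ℕ) (w : Fin 12 → ℕ) :
    ∑ i, expEquiv s i * w i = ∑ i : Fin 7, s (Sum.inl i) * w (Fin.castAdd 5 i) +
      ∑ i : Fin 5, s (Sum.inr i) * w (Fin.natAdd 7 i) := by
  rw [← Equiv.sum_comp (finSumFinEquiv : Fin 7 ⊕ Fin 5 ≃ Fin 12), Fintype.sum_sum_type]
  congr 1

theorem sum_smul_sub {m : ℕ} (f : Fin m → ℕ) (c : ℤ) : ∑ i, f i • (c - 2 * ((i : ℕ) : ℤ)) =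
    c * ((∑ i, f i : ℕ) : ℤ) - 2 * ((∑ i, f i * (i : ℕ) : ℕ) : ℤ) := by
  push_cast
  rw [Finset.mul_sum, Finset.mul_sum, ← Finset.sum_sub_distrib]
  refine Finset.sum_congr rfl fun i _ => ?_
  rw [nsmul_eq_mul]
  ring

theorem weight_eq_sums (s : Idx →₀ ℕ) :
    Finsupp.weight wt s = (∑ i : Fin 7, s (Sum.inl i), ∑ i : Fin 5, s (Sum.inr i),
      6 * ((∑ i : Fin 7, s (Sum.inl i) : ℕ) : ℤ) + 4 * ((∑ i : Fin 5, s (Sum.inr i) : ℕ) : ℤ) -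
      2 * ((∑ i : Fin 7, s (Sum.inl i) * (i : ℕ) : ℕ) : ℤ) -
      2 * ((∑ i : Fin 5, s (Sum.inr i) * (i : ℕ) : ℕ) : ℤ)) := by
  rw [Finsupp.weight_apply, Finsupp.sum_fintype _ _ (by simp), Fintype.sum_sum_type]
  ext
  · simp [wt, Prod.fst_sum]
  · simp [wt, Prod.fst_sum, Prod.snd_sum]
  · simp only [wt, Sum.elim_inl, Sum.elim_inr, Prod.snd_add, Prod.snd_sum, Prod.smul_snd]
    rw [sum_smul_sub, sum_smul_sub]
    ring

/-- The number of monomials of given degrees and weight. -/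
def monoCount (d₁ d₂ w : ℕ) : ℕ :=
  ((soln coefCode (d₁ + d₂)).filter fun f =>
    ∑ i, f i * (coefCode i).2 = d₂ * 256 + w).card

theorem expEquiv_mem_soln (s : Idx →₀ ℕ) (n : ℕ) : expEquiv s ∈ soln coefCode n ↔
    (∑ i : Fin 7, s (Sum.inl i)) + ∑ i : Fin 5, s (Sum.inr i) = n := by
  rw [mem_soln coefCode_pos]
  have := sum_expEquiv s fun i => (coefCode i).1
  rw [show (∑ i, expEquiv s i * (coefCode i).1) = _ from this]
  have h1 : ∀ i : Fin 7, (coefCode (Fin.castAdd 5 i)).1 = 1 := by decide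
  have h2 : ∀ i : Fin 5, (coefCode (Fin.natAdd 7 i)).1 = 1 := by decide
  simp only [h1, h2, mul_one]

theorem sum_code (s : Idx →₀ ℕ) : ∑ i, expEquiv s i * (coefCode i).2 =
    ∑ i : Fin 7, s (Sum.inl i) * (i : ℕ) + ∑ i : Fin 5, s (Sum.inr i) * (i : ℕ) +
      256 * ∑ i : Fin 5, s (Sum.inr i) := by
  rw [show (∑ i, expEquiv s i * (coefCode i).2) = _ from
    sum_expEquiv s fun i => (coefCode i).2]
  have h1 : ∀ i : Fin 7, (coefCode (Fin.castAdd 5 i)).2 = i := by decide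
  have h2 : ∀ i : Fin 5, (coefCode (Fin.natAdd 7 i)).2 = i + 256 := by decide
  simp only [h1, h2, mul_add, Finset.sum_add_distrib, ← Finset.sum_mul]
  ring

theorem sum_mul_le {m c : ℕ} (f : Fin m → ℕ) (hm : m ≤ c + 1) :
    ∑ i, f i * (i : ℕ) ≤ c * ∑ i, f i := by
  rw [Finset.mul_sum]
  refine Finset.sum_le_sum fun i _ => ?_
  rw [mul_comm]
  exact Nat.mul_le_mul_right _ (by omega)

instance (d₁ d₂ : ℕ) (h : ℤ) : Module.Finite ℂ (Wsp d₁ d₂ h) := by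
  have : Finite {s : Idx →₀ ℕ | Finsupp.weight wt s = ((d₁, d₂, h) : Deg)} := by
    refine Finite.of_injective (β := soln coefCode (d₁ + d₂)) (fun s => ⟨expEquiv s.1, ?_⟩) ?_
    · have := s.2
      rw [Set.mem_ofPred_eq, weight_eq_sums, Prod.mk.injEq, Prod.mk.injEq] at this
      rw [expEquiv_mem_soln, this.1, this.2.1]
    · intro s t hst
      exact Subtype.ext (expEquiv.injective (congrArg Subtype.val hst))
  exact Module.Finite.equiv (weightedHomogeneousEquiv wt ((d₁, d₂, h) : Deg)).symm

theorem finrank_Wsp {d₁ d₂ w : ℕ} (hd : d₁ + d₂ < 42) (hw : w < 256) {h : ℤ}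
    (hh : h = 6 * d₁ + 4 * d₂ - 2 * w) :
    Module.finrank ℂ (Wsp d₁ d₂ h) = monoCount d₁ d₂ w := by
  unfold Wsp
  rw [finrank_weightedHomogeneous, monoCount, ← Fintype.card_coe, ← Nat.card_eq_fintype_card]
  refine Nat.card_congr (expEquiv.subtypeEquiv fun s => ?_)
  rw [Finset.mem_filter, expEquiv_mem_soln]
  rw [show (∑ i, expEquiv s i * (coefCode i).2) = _ from sum_code s, weight_eq_sums,
    Prod.mk.injEq, Prod.mk.injEq]
  have h1 := sum_mul_le (fun i : Fin 7 => s (Sum.inl i)) (c := 6) le_rfl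
  have h2 := sum_mul_le (fun i : Fin 5 => s (Sum.inr i)) (c := 4) le_rfl
  generalize (∑ i : Fin 7, s (Sum.inl i) * (i : ℕ)) = Wa at *
  generalize (∑ i : Fin 5, s (Sum.inr i) * (i : ℕ)) = Wb at *
  generalize (∑ i : Fin 7, s (Sum.inl i)) = Sa at *
  generalize (∑ i : Fin 5, s (Sum.inr i)) = Sb at *
  subst hh
  constructor
  · rintro ⟨rfl, rfl, h⟩
    omega
  · rintro ⟨h, h'⟩
    have : Sb = d₂ := by omega
    omega

instance (d₁ d₂ : ℕ) (h : ℤ) : Module.Finite ℂ (Ssp d₁ d₂ h) :=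
  Submodule.finiteDimensional_of_le (S₂ := Wsp d₁ d₂ h) inf_le_left

theorem finrank_Ssp_add {d₁ d₂ : ℕ} {h : ℤ} (hh : -1 ≤ h) :
    Module.finrank ℂ (Ssp d₁ d₂ h) + Module.finrank ℂ (Wsp d₁ d₂ (h + 2)) =
      Module.finrank ℂ (Wsp d₁ d₂ h) := by
  have H := slPair d₁ d₂
  set φ : Wsp d₁ d₂ h →ₗ[ℂ] Wsp d₁ d₂ (h + 2) :=
    (opE ℂ).toLinearMap.restrict (fun x hx => H.E_mem hx) with hφ
  have hsurj : LinearMap.range φ = ⊤ := by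
    rw [LinearMap.range_eq_top]
    rintro ⟨x, hx⟩
    obtain ⟨r, hr, hrx⟩ := H.exists_EF (by omega) hx
    refine ⟨⟨opF ℂ r, ?_⟩, Subtype.ext hrx⟩
    have := H.F_mem hr
    rwa [add_sub_cancel_right] at this
  have hker : Module.finrank ℂ (LinearMap.ker φ) = Module.finrank ℂ (Ssp d₁ d₂ h) := by
    have e : (LinearMap.ker φ).map (Wsp d₁ d₂ h).subtype = Ssp d₁ d₂ h := by
      ext x
      rw [Submodule.mem_map]
      constructor
      · rintro ⟨y, hy, rfl⟩
        exact ⟨y.2, congrArg Subtype.val (LinearMap.mem_ker.mp hy)⟩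
      · intro hx
        exact ⟨⟨x, hx.1⟩, LinearMap.mem_ker.mpr (Subtype.ext hx.2), rfl⟩
    rw [← e]
    exact ((LinearMap.ker φ).equivMapOfInjective _ (Submodule.injective_subtype _)).finrank_eq
  rw [← hker, ← LinearMap.finrank_range_add_finrank_ker φ, hsurj, finrank_top, add_comm]

/-- The degrees to be checked, together with the expected number of independent rows. -/
def candidates : List Nat := [
  128, 8320, 278656, 24704, 262336, 8384, 16576, 286912, 8448, 278784, 24832, 295168, 270401,
  278593, 286785, 294977, 129, 532609, 540801, 548993, 557185, 565377, 262337, 532673, 540865,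
  1073345, 819393, 827585, 257, 532737, 803073, 1073409, 321, 532801, 803137, 1073473, 2, 8194,
  278530, 24578, 294914, 40962, 262210, 270402, 540738, 548930, 819266, 565314, 524418, 532610,
  1327234, 1335426, 1605762, 1351810, 1360002, 524482, 1056962, 2113730, 2121922, 2654402,
  786690, 1319170, 2638082, 2908418, 786754, 1581378, 2900290, 786818, 1581442, 3162498, 786882,
  1581506, 270339, 16387, 286723, 294915, 303107, 311299, 532547, 802883, 1073219, 1081411,
  1351747, 1097795, 1105987, 262275, 1319043, 1851523, 2646147, 2654339, 3186819, 786627,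
  2367683, 3162307, 4743363, 786691, 3416323, 4997379, 6578435, 1048899, 4202819, 6308163,
  1573251, 4727171, 1311171, 4989379, 1311235, 5251587, 262148, 8196, 278532, 286724, 557060,
  303108, 573444, 319492, 589828, 262212, 532548, 1327172, 1335364, 1867844, 1876036, 2146372,
  786564, 1581188, 3162244, 3432580, 4751492, 1573060, 3154116, 5521604, 7102660, 2097412,
  4989188, 8929540, 2621764, 6824260, 12075332, 3670404, 8397188, 3670468, 9707972, 3932676,
  10494468, 4457028, 11018820, 5, 270341, 278533, 548869, 294917, 827397, 573445, 843781,
  262213, 1056837, 1327173, 2121797, 2392133, 2924613, 524421, 2629765, 3686533, 5529733,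
  1310917, 4989125, 7618757, 10510533, 2359557, 8134917, 3670341, 11542853, 4456837, 14950789,
  5505477, 17834437, 6291973, 20193797, 262150, 8198, 540678, 548870, 819206, 565254, 1097734,
  524358, 1056838, 2113606, 2383942, 3440710, 1310854, 2891910, 5521542, 2621638, 6037702,
  10502342, 3932422, 10232070, 18104582, 5767494, 15475014, 8126854, 20980102, 9437638,
  26485190, 11272710, 31203846, 7, 532487, 278535, 811015, 819207, 1089543, 262215, 1581127,
  2375751, 3432519, 1048711, 4202631, 6307975, 9199751, 2621639, 8396999, 4194567, 14426375,
  6553927, 21766471, 9699719, 30155143, 12321223, 38805959, 262152, 270344, 802824, 548872,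
  1343496, 786504, 1581128, 3162184, 2097288, 4464776, 8405128, 3670216, 9707720, 17055944,
  6553864, 17047816, 9699656, 26747208, 13631880, 38019464, 18088392, 50602440, 9, 532489,
  540681, 1335305, 524361, 2367561, 3424329, 5005385, 1573001, 6299785, 3932361, 12591305,
  6553865, 22028553, 10748233, 34349385, 15991177, 49553801, 524298, 270346, 1064970, 1073162,
  1605642, 1048650, 2367562, 4472906, 2621578, 6561930, 12075146, 5505226, 14164170, 9175306,
  25174282, 14418250, 40378698, 21234058, 58990986, 11, 794635, 802827, 1597451, 786507,
  3153995, 2359435, 8659083, 5243083, 17572043, 9699595, 31203595, 15728971, 49291595, 524300,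
  532492, 1327116, 1310796, 3153996, 6045772, 3670156, 8921228, 7340236, 19407052, 12583180,
  34873612, 19661132, 56369484, 13, 1056781, 1064973, 2121741, 1048653, 4202573, 3145869,
  11280525, 7340237, 23339213, 12845325, 41689357, 524302, 532494, 1851406, 1835086, 4202574,
  4718734, 11804814, 9175246, 25436366, 16515342, 45883662, 262159, 1318927, 1327119, 1310799,
  5251151, 3932303, 14426255, 786448, 794640, 2113552, 2097232, 5251152, 5767312, 14950544,
  11796688, 32252112, 17, 1581073, 1851409, 1835089, 6561873, 786450, 1056786, 2637842, 2621522,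
  6561874, 7078034, 18358418, 262163, 1843219, 2113555, 1048596, 1318932, 3162132, 3145812,
  7872596, 262165, 2105365, 2637845, 1048598, 1581078, 262167, 2629655, 3162135, 1310744,
  1843224, 524313, 2891801, 3686425, 1310746, 2105370, 524315, 3416091, 1572892, 2629660,
  524317, 3678237, 1835038, 2891806, 786463, 4202527, 1835040, 3416096, 786465, 4726817,
  1048611, 5251107, 1048613, 5775397]

/-- Degrees of the generators. -/
def degs : List (ℕ × ℕ × ℕ) := [
  (15, 0, 0), (13, 1, 0), (11, 2, 0), (9, 3, 0), (11, 1, 0), (12, 0, 2), (7, 4, 0), (9, 2, 0),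
  (10, 1, 2), (10, 1, 0), (5, 5, 0), (7, 3, 0), (8, 2, 2), (8, 2, 0), (9, 1, 0), (10, 0, 2),
  (10, 0, 0), (3, 6, 0), (5, 4, 0), (5, 4, 0), (6, 3, 2), (6, 3, 0), (6, 3, 0), (7, 2, 0), (7, 2, 0), (8, 1, 2), (8, 1, 2), (8, 1, 0), (9, 0, 4), (3, 5, 0), (4, 4, 2), (4, 4, 0), (4, 4, 0),
  (5, 3, 0), (5, 3, 0), (5, 3, 0), (6, 2, 2), (6, 2, 2), (6, 2, 2), (6, 2, 2), (6, 2, 0), (6, 2, 0), (7, 1, 4), (7, 1, 2), (7, 1, 0), (8, 0, 2), (2, 5, 2), (2, 5, 2), (2, 5, 0), (3, 4, 2),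
  (3, 4, 2), (3, 4, 0), (3, 4, 0), (4, 3, 2), (4, 3, 2), (4, 3, 2), (4, 3, 2), (4, 3, 2), (4, 3, 2), (4, 3, 0), (4, 3, 0), (4, 3, 0), (5, 2, 4), (5, 2, 2), (5, 2, 2), (5, 2, 2), (5, 2, 0),
  (5, 2, 0), (6, 1, 2), (6, 1, 2), (6, 1, 2), (6, 1, 0), (7, 0, 4), (7, 0, 2), (2, 4, 2), (2, 4, 2), (2, 4, 2), (2, 4, 0), (2, 4, 0), (3, 3, 4), (3, 3, 4), (3, 3, 2), (3, 3, 2), (3, 3, 2),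
  (3, 3, 2), (3, 3, 0), (3, 3, 0), (3, 3, 0), (4, 2, 4), (4, 2, 2), (4, 2, 2), (4, 2, 2), (4, 2, 2), (4, 2, 2), (4, 2, 0), (4, 2, 0), (5, 1, 4), (5, 1, 4), (5, 1, 4), (5, 1, 2), (5, 1, 2),
  (5, 1, 0), (6, 0, 6), (6, 0, 6), (6, 0, 0), (1, 4, 4), (1, 4, 2), (2, 3, 4), (2, 3, 4), (2, 3, 2), (2, 3, 2), (2, 3, 2), (2, 3, 2), (2, 3, 0), (2, 3, 0), (3, 2, 4), (3, 2, 4), (3, 2, 4),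
  (3, 2, 4), (3, 2, 4), (3, 2, 2), (3, 2, 2), (3, 2, 2), (3, 2, 2), (3, 2, 0), (4, 1, 6), (4, 1, 6), (4, 1, 6), (4, 1, 4), (4, 1, 4), (4, 1, 2), (4, 1, 2), (4, 1, 0), (5, 0, 8), (5, 0, 4),
  (5, 0, 2), (1, 3, 4), (1, 3, 4), (1, 3, 2), (1, 3, 2), (1, 3, 0), (2, 2, 6), (2, 2, 6), (2, 2, 6), (2, 2, 4), (2, 2, 4), (2, 2, 4), (2, 2, 2), (2, 2, 2), (2, 2, 0), (2, 2, 0), (3, 1, 8),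
  (3, 1, 8), (3, 1, 6), (3, 1, 4), (3, 1, 4), (3, 1, 4), (3, 1, 2), (3, 1, 2), (4, 0, 10), (4, 0, 6), (4, 0, 4), (4, 0, 0), (0, 3, 6), (0, 3, 0), (1, 2, 8), (1, 2, 6), (1, 2, 4), (1, 2, 4),
  (1, 2, 2), (1, 2, 2), (2, 1, 10), (2, 1, 8), (2, 1, 6), (2, 1, 6), (2, 1, 4), (2, 1, 4), (2, 1, 2), (2, 1, 0), (3, 0, 12), (3, 0, 8), (3, 0, 6), (3, 0, 2), (0, 2, 4), (0, 2, 0), (1, 1, 8), (1, 1, 6), (1, 1, 4), (1, 1, 2), (2, 0, 8), (2, 0, 4), (2, 0, 0), (0, 1, 4), (1, 0, 6)]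

/-- Degrees obtained by following one recipe. -/
def shapeStep (l : List (ℕ × ℕ × ℕ)) (c : ℕ) : List (ℕ × ℕ × ℕ) :=
  ((l.getD (c % 256) 0).1 + (l.getD (c / 256 % 256) 0).1,
   (l.getD (c % 256) 0).2.1 + (l.getD (c / 256 % 256) 0).2.1,
   (l.getD (c % 256) 0).2.2 + (l.getD (c / 256 % 256) 0).2.2 - 2 * (c / 65536)) :: l

set_option maxRecDepth 100000 in
theorem shapes_eq : recipes.foldl shapeStep [(0, 1, 4), (1, 0, 6)] = degs := by decide +kernel

/-- The digit of a table of counts. -/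
def digit (T : List Nat) (n e : Nat) : Nat :=
  Nat.mod (Nat.div (getAt 0 T (Nat.sub 37 n)) (Nat.pow (Nat.pow 2 40) e)) (Nat.pow 2 40)

/-- Dimensions of spaces of highest weight vectors, from a table of counts. -/
def tabDim (T : List Nat) (a b k : Nat) : Nat :=
  bif Nat.ble k (6 * a + 4 * b) then
    digit T (a + b) (b * 256 + (6 * a + 4 * b - k) / 2) -
      bif Nat.ble (6 * a + 4 * b) (k + 1) then 0 else
        digit T (a + b) (b * 256 + (6 * a + 4 * b - k) / 2 - 1)
  else 0

/-- The dimension estimate needed in one degree. -/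
def estimate (T : List Nat) (a b k E : Nat) : Bool :=
  Nat.ble (a + b) 37 && Nat.beq (k % 2) 0 &&
  Nat.ble (tabDim T a b k + bif Nat.ble 2 a && Nat.ble 2 b then tabDim T (a - 2) (b - 2) k else 0)
    (E + (bif Nat.ble 2 a then tabDim T (a - 2) b k else 0) +
      bif Nat.ble 2 b then tabDim T a (b - 2) k else 0)

/-- All dimension estimates. -/
def estimates (T : List Nat) (cs : List Nat) : Bool :=
  cs.all fun c => estimate T (Nat.land c 63) (Nat.land (Nat.shiftRight c 6) 63)
    (Nat.land (Nat.shiftRight c 12) 63) (Nat.land (Nat.shiftRight c 18) 255)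

theorem counts_lt : countTab 0 coefCodes 38 (fun T => T.all fun x => Nat.ble x 1000000000000) =
    true := by decide +kernel

theorem estimates_true : countTab 40 coefCodes 38 (fun T => estimates T candidates) = true := by
  decide +kernel

theorem candidates_selected : candidates.all (fun c => Nat.beq (Nat.land (Nat.shiftRight c 18) 255) 0
    || selections.any fun s => Nat.beq (Nat.land s 67108863) c) = true := by decide +kernel

theorem countTab_coef (b : ℕ) (K : List ℕ → Bool) :
    countTab b coefCodes 38 K = K (countList coefCode (2 ^ b) 38) :=
  countTab_eq (L := coefCodes) (by decide) b 38 K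

theorem genNum_coef_lt {n : ℕ} (hn : n < 38) : genNum coefCode 1 n < 2 ^ 40 := by
  have h := counts_lt
  rw [countTab_coef, pow_zero, List.all_eq_true] at h
  have h1 : getAt 0 (countList coefCode 1 38) (37 - n) ∈ countList coefCode 1 38 := by
    have h0 := getAt_countList coefCode 1 38 (37 - n)
    have hlen : ∀ m, (countList coefCode 1 m).length = m := by
      intro m
      induction m with
      | zero => rfl
      | succ m ih => rw [countList, List.length_cons, ih]
    rw [getAt_eq, List.getD_eq_getElem _ _ (by rw [hlen]; omega)]
    exact List.getElem_mem _
  have h2 := Nat.le_of_ble_eq_true (h _ h1)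
  rw [getAt_countList, if_pos (by omega), show 38 - 1 - (37 - n) = n by omega] at h2
  exact h2.trans_lt (by norm_num)

theorem digit_eq {d₁ d₂ : ℕ} (hn : d₁ + d₂ < 38) (w : ℕ) :
    digit (countList coefCode (2 ^ 40) 38) (d₁ + d₂) (d₂ * 256 + w) = monoCount d₁ d₂ w := by
  unfold digit monoCount
  rw [getAt_countList, if_pos (by rw [Nat.sub_eq]; omega),
    show 38 - 1 - Nat.sub 37 (d₁ + d₂) = d₁ + d₂ by rw [Nat.sub_eq]; omega]
  exact genNum_digit coefCode 40 _ _ (genNum_coef_lt hn)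

theorem Wsp_eq_bot {d₁ d₂ : ℕ} {h : ℤ} (hh : (6 * d₁ + 4 * d₂ : ℤ) < h) : Wsp d₁ d₂ h = ⊥ := by
  rw [eq_bot_iff]
  intro x hx
  exact (slPair d₁ d₂).bound (by push_cast; rw [lt_abs]; exact Or.inl hh) hx

theorem tabDim_eq {a b k : ℕ} (hab : a + b ≤ 37) (hk : k % 2 = 0) :
    tabDim (countList coefCode (2 ^ 40) 38) a b k = Module.finrank ℂ (Ssp a b k) := by
  unfold tabDim
  by_cases h : k ≤ 6 * a + 4 * b
  · obtain ⟨w, hw⟩ : ∃ w, 6 * a + 4 * b = k + 2 * w := ⟨(6 * a + 4 * b - k) / 2, by omega⟩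
    rw [Nat.ble_eq.mpr h, cond_true, show (6 * a + 4 * b - k) / 2 = w by omega,
      digit_eq (by omega)]
    have e1 := finrank_Ssp_add (d₁ := a) (d₂ := b) (h := (k : ℤ)) (by omega)
    rw [finrank_Wsp (h := (k : ℤ)) (w := w) (by omega) (by omega) (by omega)] at e1
    by_cases h' : 6 * a + 4 * b ≤ k + 1
    · rw [Nat.ble_eq.mpr h', cond_true]
      rw [Wsp_eq_bot (h := (k : ℤ) + 2) (by omega), finrank_bot] at e1
      omega
    · rw [Bool.eq_false_iff.mpr (fun hc => h' (Nat.le_of_ble_eq_true hc)), cond_false,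
        Nat.add_sub_assoc (by omega), digit_eq (by omega)]
      rw [finrank_Wsp (h := (k : ℤ) + 2) (w := w - 1) (by omega) (by omega) (by omega)] at e1
      omega
  · rw [Bool.eq_false_iff.mpr (fun hc => h (Nat.le_of_ble_eq_true hc)), cond_false]
    symm
    rw [eq_bot_iff.mpr (le_trans inf_le_left (Wsp_eq_bot (h := (k : ℤ)) (by omega)).le : Ssp a b k ≤ ⊥),
      finrank_bot]

/-- The dimension of the highest weight vectors of shifted degree. -/
def shiftDim (s t a b k : ℕ) : ℕ :=
  if s ≤ a ∧ t ≤ b then Module.finrank ℂ (Ssp (a - s) (b - t) k) else 0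

/-- The degree encoded by a number. -/
def decode (c : ℕ) : ℕ × ℕ × ℕ :=
  (Nat.land c 63, Nat.land (Nat.shiftRight c 6) 63, Nat.land (Nat.shiftRight c 12) 63)

theorem candidate_bound {c : ℕ} (hc : c ∈ candidates) {a b k : ℕ} (h : decode c = (a, b, k)) :
    ∃ E : ℕ, (E = 0 ∨ ∃ s ∈ selections, decode s = (a, b, k) ∧
      Nat.land (Nat.shiftRight s 18) 255 = E) ∧
      Module.finrank ℂ (Ssp a b k) + shiftDim 2 2 a b k ≤
        E + shiftDim 2 0 a b k + shiftDim 0 2 a b k := by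
  refine ⟨Nat.land (Nat.shiftRight c 18) 255, ?_, ?_⟩
  · have h1 := List.all_eq_true.mp candidates_selected c hc
    rw [Bool.or_eq_true] at h1
    rcases h1 with h1 | h1
    · exact Or.inl (Nat.eq_of_beq_eq_true h1)
    · obtain ⟨s, hs, h2⟩ := List.any_eq_true.mp h1
      have h3 : c = s % 2 ^ 26 := by
        rw [← Nat.eq_of_beq_eq_true h2, ← Nat.and_two_pow_sub_one_eq_mod]
        rfl
      refine Or.inr ⟨s, hs, ?_, ?_⟩
      · rw [← h]
        unfold decode
        have e : ∀ x, Nat.land x 63 = x % 64 := fun x => Nat.and_two_pow_sub_one_eq_mod x 6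
        have e' : ∀ x i, Nat.shiftRight x i = x / 2 ^ i := Nat.shiftRight_eq_div_pow
        simp only [e, e', Prod.mk.injEq]
        omega
      · have e : ∀ x, Nat.land x 255 = x % 256 := fun x => Nat.and_two_pow_sub_one_eq_mod x 8
        have e' : ∀ x i, Nat.shiftRight x i = x / 2 ^ i := Nat.shiftRight_eq_div_pow
        simp only [e, e']
        omega
  · have h1 := estimates_true
    rw [countTab_coef] at h1
    have h2 := List.all_eq_true.mp h1 c hc
    unfold decode at h
    simp only [Prod.mk.injEq] at h
    rw [h.1, h.2.1, h.2.2] at h2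
    unfold estimate at h2
    simp only [Bool.and_eq_true] at h2
    obtain ⟨⟨h3, h4⟩, h5⟩ := h2
    have h3 := Nat.le_of_ble_eq_true h3
    have h4 := Nat.eq_of_beq_eq_true h4
    have h5 := Nat.le_of_ble_eq_true h5
    rw [tabDim_eq h3 h4, tabDim_eq (by omega) h4, tabDim_eq (by omega) h4,
      tabDim_eq (by omega) h4] at h5
    have hs : ∀ (x : Bool) (p : Prop) [Decidable p] (n : ℕ), (x = true ↔ p) →
        (bif x then n else 0) = if p then n else 0 := by
      intro x p _ n hx
      cases x
      · rw [cond_false, if_neg (fun hp => by simpa using hx.mpr hp)]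
      · rw [cond_true, if_pos (hx.mp rfl)]
    rw [hs _ (2 ≤ a ∧ 2 ≤ b) _ (by rw [Bool.and_eq_true, Nat.ble_eq, Nat.ble_eq]),
      hs _ (2 ≤ a ∧ 0 ≤ b) _ (by rw [Nat.ble_eq]; simp),
      hs _ (0 ≤ a ∧ 2 ≤ b) _ (by rw [Nat.ble_eq]; simp)] at h5
    exact h5

/-- The integral covariants given by the recipes. -/
def zGens : List (GenData ZPoly) := recipes.foldl recipeStep [quarticData ℤ, sexticData ℤ]

/-- The degrees of a covariant. -/
def GenData.shape {R : Type} (y : GenData R) : ℕ × ℕ × ℕ := (y.d1, y.d2, y.k)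

theorem foldl_shape (rs : List ℕ) (L : List (GenData ZPoly)) :
    (rs.foldl recipeStep L).map GenData.shape = rs.foldl shapeStep (L.map GenData.shape) := by
  induction rs generalizing L with
  | nil => rfl
  | cons c rs ih =>
    rw [List.foldl_cons, List.foldl_cons, ih]
    congr 1
    have h : ∀ i, (L.map GenData.shape).getD i 0 = (L.getD i GenData.zero).shape := by
      intro i
      rw [show (0 : ℕ × ℕ × ℕ) = (GenData.zero : GenData ZPoly).shape from rfl, List.getD_map]
    unfold recipeStep shapeStep
    rw [List.map_cons, h, h]
    rfl

theorem zGens_shape : zGens.map GenData.shape = degs := by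
  rw [← shapes_eq]
  exact foldl_shape _ _

theorem degs_length : degs.length = 194 := by decide +kernel

theorem zGens_length : zGens.length = 194 := by
  rw [← degs_length, ← zGens_shape, List.length_map]

theorem mem_foldl_recipeStep (rs : List ℕ) {L : List (GenData ZPoly)} {y : GenData ZPoly}
    (h : y ∈ L) : y ∈ rs.foldl recipeStep L := by
  induction rs generalizing L with
  | nil => exact h
  | cons c rs ih => exact ih (List.mem_cons_of_mem _ h)

theorem mem_zGens_of_take (n : ℕ) {y : GenData ZPoly}
    (h : y ∈ (recipes.take n).foldl recipeStep [quarticData ℤ, sexticData ℤ]) : y ∈ zGens := by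
  unfold zGens
  rw [← List.take_append_drop n recipes, List.foldl_append]
  exact mem_foldl_recipeStep _ h

/-- The generators. -/
def zGen (i : Fin 194) : GenData ZPoly := zGens.get (i.cast zGens_length.symm)

/-- The generating highest weight vectors. -/
def gam (i : Fin 194) : MvPolynomial Idx ℂ := toC ((zGen i).u 0)

/-- The degrees of the generators. -/
def dgam (i : Fin 194) : ℕ × ℕ × ℕ := (zGen i).shape

theorem zGen_isCov (i : Fin 194) : (zGen i).IsCov :=
  (program_sound program_eq).2 _ (List.get_mem _ _)

theorem gam_mem (i : Fin 194) : gam i ∈ Sd (dgam i) := (zGen_isCov i).mem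

theorem dgam_eq (i : Fin 194) : dgam i = degs.get (i.cast degs_length.symm) := by
  unfold dgam zGen
  simp only [List.get_eq_getElem, ← zGens_shape, List.getElem_map]
  rfl

theorem dgam_mem (i : Fin 194) : dgam i ∈ degs := by
  rw [dgam_eq]
  exact List.get_mem _ _

theorem exists_zGen {y : GenData ZPoly} (h : y ∈ zGens) : ∃ i, zGen i = y := by
  obtain ⟨i, hi⟩ := List.get_of_mem h
  exact ⟨i.cast zGens_length, hi⟩

/-- The algebra generated by the generators. -/
def genAlg : Subalgebra ℂ (MvPolynomial Idx ℂ) := Algebra.adjoin ℂ (Set.range gam)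

theorem leadAlg_le : leadAlg zGens ≤ genAlg := by
  refine Algebra.adjoin_mono ?_
  rintro p ⟨y, hy, rfl⟩
  obtain ⟨i, rfl⟩ := exists_zGen hy
  exact ⟨i, rfl⟩

theorem gam_mem_genAlg (i : Fin 194) : gam i ∈ genAlg := Algebra.subset_adjoin ⟨i, rfl⟩

theorem mem_genAlg {y : GenData ZPoly} (h : y ∈ zGens) : toC (y.u 0) ∈ genAlg := by
  obtain ⟨i, rfl⟩ := exists_zGen h
  exact gam_mem_genAlg i

theorem ca_mem_genAlg : ca ℂ 0 ∈ genAlg := by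
  have := mem_genAlg (mem_zGens_of_take 0 (y := sexticData ℤ) (by simp))
  simpa [sexticData, ca] using this

theorem cb_mem_genAlg : cb ℂ 0 ∈ genAlg := by
  have := mem_genAlg (mem_zGens_of_take 0 (y := quarticData ℤ) (by simp))
  simpa [quarticData, cb] using this

theorem invA_mem : (sexticData ℤ).comb (sexticData ℤ) 6 ∈ zGens :=
  mem_zGens_of_take 1 (List.mem_cons_self ..)

theorem invI_mem : (quarticData ℤ).comb (quarticData ℤ) 4 ∈ zGens :=
  mem_zGens_of_take 8 (List.mem_cons_self ..)

theorem invA_mem_Ssp : toC invA ∈ Ssp 2 0 0 := by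
  have h := (GenData.IsCov.comb sexticData_isCov sexticData_isCov (r := 6) le_rfl le_rfl).mem
  unfold invA
  simpa [GenData.comb, sexticData] using h

theorem invI_mem_Ssp : toC invI ∈ Ssp 0 2 0 := by
  have h := (GenData.IsCov.comb quarticData_isCov quarticData_isCov (r := 4) le_rfl le_rfl).mem
  unfold invI
  simpa [GenData.comb, quarticData] using h

theorem invA_mem_genAlg : toC invA ∈ genAlg := by
  have h := mem_genAlg invA_mem
  have e : ((sexticData ℤ).comb (sexticData ℤ) 6).u 0 = invA := by
    unfold invA GenData.comb sexticData
    rfl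
  rwa [e] at h

theorem invI_mem_genAlg : toC invI ∈ genAlg := by
  have h := mem_genAlg invI_mem
  have e : ((quarticData ℤ).comb (quarticData ℤ) 4).u 0 = invI := by
    unfold invI GenData.comb quarticData
    rfl
  rwa [e] at h

section LinearAlgebra

theorem finrank_add_le {M : Type*} [AddCommGroup M] [Module ℂ M] {E : ℕ}
    (Ψ : M →ₗ[ℂ] (Fin E → ℂ)) {J P : Submodule ℂ M} [FiniteDimensional ℂ P] (hJ : J ≤ P)
    (hk : ∀ x ∈ J, Ψ x = 0) {z : Fin E → M} (hz : ∀ i, z i ∈ P)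
    (hi : LinearIndependent ℂ fun i => Ψ (z i)) :
    Module.finrank ℂ J + E ≤ Module.finrank ℂ P := by
  have h1 := (Ψ.comp P.subtype).finrank_range_add_finrank_ker
  have h2 : E ≤ Module.finrank ℂ (LinearMap.range (Ψ.comp P.subtype)) := by
    have h3 : LinearIndependent ℂ fun i =>
        (⟨Ψ (z i), ⟨⟨z i, hz i⟩, rfl⟩⟩ : LinearMap.range (Ψ.comp P.subtype)) :=
      LinearIndependent.of_comp (Submodule.subtype _) hi
    simpa using h3.fintype_card_le_finrank
  have h4 : Module.finrank ℂ J ≤ Module.finrank ℂ (LinearMap.ker (Ψ.comp P.subtype)) := by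
    have h5 : ∀ x : J, Submodule.inclusion hJ x ∈ LinearMap.ker (Ψ.comp P.subtype) :=
      fun x => hk x x.2
    refine LinearMap.finrank_le_finrank_of_injective
      (f := (Submodule.inclusion hJ).codRestrict _ h5) ?_
    intro x y hxy
    exact Submodule.inclusion_injective hJ (congrArg Subtype.val hxy)
  omega

theorem prime_8191 : Nat.Prime 8191 := by norm_num

theorem linearIndependent_of_mod {E : ℕ} (m : Fin E → Fin E → ℤ)
    (h : ∀ c : Fin E → ZMod 8191, (∀ i, ∑ j, c j * (m j i : ZMod 8191) = 0) → c = 0) :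
    LinearIndependent ℂ fun j i => (m j i : ℂ) := by
  have : Fact (Nat.Prime 8191) := ⟨prime_8191⟩
  have h1 : ((Matrix.of m).map (Int.cast : ℤ → ZMod 8191)).det ≠ 0 := by
    intro h0
    obtain ⟨v, hv, h2⟩ := Matrix.exists_vecMul_eq_zero_iff.mpr h0
    refine hv (h v fun i => ?_)
    have := congrFun h2 i
    simpa [Matrix.vecMul, dotProduct] using this
  have h2 : (Matrix.of m).det ≠ 0 := by
    intro h0
    apply h1
    have := (Int.castRingHom (ZMod 8191)).map_det (Matrix.of m)
    rw [h0, map_zero] at this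
    exact this.symm
  have h3 : ((Matrix.of m).map (Int.cast : ℤ → ℂ)).det ≠ 0 := by
    have := (Int.castRingHom ℂ).map_det (Matrix.of m)
    intro h0
    refine h2 (RingHom.injective_int (Int.castRingHom ℂ) ?_)
    rw [this, map_zero]
    exact h0
  exact Matrix.linearIndependent_rows_of_det_ne_zero h3

end LinearAlgebra

theorem toC_injective : Function.Injective toC := map_injective _ (RingHom.injective_int _)

theorem invA_ne_zero : toC invA ≠ 0 := by
  intro h
  have h1 : invA = 0 := toC_injective (h.trans (map_zero _).symm)
  have h2 := congrArg (aeval (Sum.elim ![0, 0, 0, 1, 0, 0, 0] (fun _ => 0) : Idx → ℤ)).toRingHom h1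
  rw [invA, map_trv] at h2
  simp [trv_zero, Finset.sum_range_succ, tcoef, Nat.descFactorial, ca] at h2

theorem invI_ne_zero : toC invI ≠ 0 := by
  intro h
  have h1 : invI = 0 := toC_injective (h.trans (map_zero _).symm)
  have h2 := congrArg (aeval (Sum.elim (fun _ => 0) ![0, 0, 1, 0, 0] : Idx → ℤ)).toRingHom h1
  rw [invI, map_trv] at h2
  simp [trv_zero, Finset.sum_range_succ, tcoef, Nat.descFactorial, cb] at h2

theorem weight_fst (s : Idx →₀ ℕ) :
    (Finsupp.weight wt s).1 = Finsupp.weight (fun i => (wt i).1) s := by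
  simp [Finsupp.weight_apply, Finsupp.sum, Prod.fst_sum]

theorem weight_snd (s : Idx →₀ ℕ) :
    (Finsupp.weight wt s).2.1 = Finsupp.weight (fun i => (wt i).2.1) s := by
  simp [Finsupp.weight_apply, Finsupp.sum, Prod.fst_sum, Prod.snd_sum]

theorem degreeOf_inl_le {d₁ d₂ : ℕ} {h : ℤ} {p : MvPolynomial Idx ℂ} (hp : p ∈ Wsp d₁ d₂ h)
    (i : Fin 7) : degreeOf (Sum.inl i) p ≤ d₁ := by
  rw [degreeOf_eq_sup]
  refine Finset.sup_le fun s hs => ?_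
  have h1 := congrArg Prod.fst (hp (mem_support_iff.mp hs))
  rw [weight_fst] at h1
  rw [← show _ = d₁ from h1]
  exact Finsupp.le_weight _ (by simp [wt]) s

theorem degreeOf_inr_le {d₁ d₂ : ℕ} {h : ℤ} {p : MvPolynomial Idx ℂ} (hp : p ∈ Wsp d₁ d₂ h)
    (i : Fin 5) : degreeOf (Sum.inr i) p ≤ d₂ := by
  rw [degreeOf_eq_sup]
  refine Finset.sup_le fun s hs => ?_
  have h1 := congrArg (fun x => x.2.1) (hp (mem_support_iff.mp hs))
  dsimp only at h1
  rw [weight_snd] at h1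
  rw [← h1]
  exact Finsupp.le_weight _ (by simp [wt]) s

theorem degreeOf_le_of_dvd {p q : MvPolynomial Idx ℂ} (hq : q ≠ 0) (h : p ∣ q) (i : Idx) :
    degreeOf i p ≤ degreeOf i q := by
  obtain ⟨r, rfl⟩ := h
  rw [degreeOf_mul_eq (left_ne_zero_of_mul hq) (right_ne_zero_of_mul hq)]
  exact Nat.le_add_right _ _

theorem isRelPrime_inv : IsRelPrime (toC invI) (toC invA) := by
  intro d hI hA
  have h0 : d.vars = ∅ := by
    refine Finset.eq_empty_of_forall_notMem fun i hi => mem_vars_iff_degreeOf_ne_zero.mp hi ?_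
    rcases i with i | i
    · exact Nat.le_zero.mp ((degreeOf_le_of_dvd invI_ne_zero hI _).trans
        (degreeOf_inl_le invI_mem_Ssp.1 i))
    · exact Nat.le_zero.mp ((degreeOf_le_of_dvd invA_ne_zero hA _).trans
        (degreeOf_inr_le invA_mem_Ssp.1 i))
  rw [vars_eq_empty_iff_eq_C] at h0
  have h1 : d.coeff 0 ≠ 0 := by
    intro h2
    rw [h2, map_zero] at h0
    rw [h0, zero_dvd_iff] at hI
    exact invI_ne_zero hI
  rw [h0]
  exact (isUnit_iff_ne_zero.mpr h1).map C

theorem mem_Ssp_of_mul {d₁ d₂ e₁ e₂ : ℕ} {h l : ℤ} {a p : MvPolynomial Idx ℂ}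
    (ha : a ∈ Ssp e₁ e₂ l) (ha0 : a ≠ 0) (hp : a * p ∈ Ssp (d₁ + e₁) (d₂ + e₂) (h + l)) :
    p ∈ Ssp d₁ d₂ h := by
  have h1 : opE ℂ p = 0 := by
    have := (mem_Ssp.mp hp).2
    rw [Derivation.leibniz] at this
    have h3 : opE ℂ a = 0 := (mem_Ssp.mp ha).2
    rw [h3, smul_zero, add_zero, smul_eq_mul] at this
    exact (mul_eq_zero.mp this).resolve_left ha0
  have h2 := comp_mul (mem_Wsp.mp ha.1) ((d₁, d₂, h) : Deg) p
  rw [comp_of_mem (mem_Wsp.mp hp.1), if_pos (by simp)] at h2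
  rw [mul_left_cancel₀ ha0 h2]
  exact comp_mem_Ssp _ _ _ h1

/-- Evaluation at the point, over the complex numbers. -/
def psiC : MvPolynomial Idx ℂ →ₐ[ℂ] PowerSeries ℂ :=
  aeval fun i => PowerSeries.map (Int.castRingHom ℂ) (pt i)

theorem psiC_toC (p : ZPoly) : psiC (toC p) = PowerSeries.map (Int.castRingHom ℂ) (psi p) := by
  have : (psiC.toRingHom.comp toC) = (PowerSeries.map (Int.castRingHom ℂ)).comp psi := by
    refine MvPolynomial.ringHom_ext (fun r => ?_) (fun i => ?_)
    · simp
    · rw [RingHom.comp_apply, RingHom.comp_apply, psi_X]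
      simp [psiC]
  exact congrArg (fun f => f p) this

/-- Initial coefficients of the value at the point. -/
def leading (E : ℕ) : MvPolynomial Idx ℂ →ₗ[ℂ] (Fin E → ℂ) :=
  LinearMap.pi fun i => (PowerSeries.coeff (R := ℂ) (i : ℕ)).comp psiC.toLinearMap

theorem leading_toC {E : ℕ} (p : ZPoly) (i : Fin E) :
    leading E (toC p) i = (PowerSeries.coeff (i : ℕ) (psi p) : ℤ) := by
  change PowerSeries.coeff (i : ℕ) (psiC (toC p)) = _
  rw [psiC_toC, PowerSeries.coeff_map]
  rfl

theorem leading_mul {E : ℕ} {a : ZPoly} (ha : psi a = 0) (p : MvPolynomial Idx ℂ) :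
    leading E (toC a * p) = 0 := by
  ext i
  change PowerSeries.coeff (i : ℕ) (psiC (toC a * p)) = _
  rw [map_mul, psiC_toC, ha, map_zero, zero_mul, map_zero]
  rfl

/-- The multiples of a fixed polynomial by highest weight vectors. -/
def multiples (a : MvPolynomial Idx ℂ) (s t d₁ d₂ k : ℕ) : Submodule ℂ (MvPolynomial Idx ℂ) :=
  if s ≤ d₁ ∧ t ≤ d₂ then (Ssp (d₁ - s) (d₂ - t) k).map (LinearMap.mulLeft ℂ a) else ⊥

theorem mulLeft_injective {a : MvPolynomial Idx ℂ} (ha : a ≠ 0) :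
    Function.Injective (LinearMap.mulLeft ℂ a) := fun _ _ h => mul_left_cancel₀ ha h

theorem finrank_multiples {a : MvPolynomial Idx ℂ} (ha : a ≠ 0) (s t d₁ d₂ k : ℕ) :
    Module.finrank ℂ (multiples a s t d₁ d₂ k) = shiftDim s t d₁ d₂ k := by
  unfold multiples shiftDim
  split_ifs with h
  · rw [if_pos h]
    exact (Submodule.equivMapOfInjective _ (mulLeft_injective ha) _).finrank_eq.symm
  · rw [if_neg h]
    exact finrank_bot ℂ _

instance (a : MvPolynomial Idx ℂ) (s t d₁ d₂ k : ℕ) :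
    FiniteDimensional ℂ (multiples a s t d₁ d₂ k) := by
  unfold multiples
  by_cases h : s ≤ d₁ ∧ t ≤ d₂
  · rw [if_pos h]
    infer_instance
  · rw [if_neg h]
    infer_instance

theorem mem_multiples {a x : MvPolynomial Idx ℂ} {s t d₁ d₂ k : ℕ} :
    x ∈ multiples a s t d₁ d₂ k ↔
      x = 0 ∨ s ≤ d₁ ∧ t ≤ d₂ ∧ ∃ y ∈ Ssp (d₁ - s) (d₂ - t) k, a * y = x := by
  unfold multiples
  split_ifs with h
  · simp only [Submodule.mem_map, LinearMap.mulLeft_apply]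
    constructor
    · exact fun hx => Or.inr ⟨h.1, h.2, hx⟩
    · rintro (rfl | ⟨-, -, hx⟩)
      · exact ⟨0, zero_mem _, mul_zero _⟩
      · exact hx
  · simp only [Submodule.mem_bot]
    constructor
    · exact Or.inl
    · rintro (rfl | ⟨h1, h2, -⟩)
      · rfl
      · exact absurd ⟨h1, h2⟩ h

theorem multiples_inf_le (d₁ d₂ k : ℕ) :
    multiples (toC invA) 2 0 d₁ d₂ k ⊓ multiples (toC invI) 0 2 d₁ d₂ k ≤
      multiples (toC invA * toC invI) 2 2 d₁ d₂ k := by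
  rintro x ⟨hx1, hx2⟩
  rw [SetLike.mem_coe, mem_multiples] at hx1 hx2
  rw [mem_multiples]
  rcases hx1 with rfl | ⟨h1, -, y, hy, rfl⟩
  · exact Or.inl rfl
  rcases hx2 with hx | ⟨-, h2, z, hz, he⟩
  · exact Or.inl hx
  obtain ⟨w, rfl⟩ := isRelPrime_inv.dvd_of_dvd_mul_left (Dvd.intro _ he)
  refine Or.inr ⟨h1, h2, w, ?_, mul_assoc _ _ _⟩
  refine mem_Ssp_of_mul invI_mem_Ssp invI_ne_zero ?_
  rw [add_zero, add_zero, Nat.sub_add_cancel h2]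
  exact hy

theorem shiftDim_le_finrank_sup (d₁ d₂ k : ℕ) :
    shiftDim 2 0 d₁ d₂ k + shiftDim 0 2 d₁ d₂ k ≤ Module.finrank ℂ
      ↥(multiples (toC invA) 2 0 d₁ d₂ k ⊔ multiples (toC invI) 0 2 d₁ d₂ k) +
        shiftDim 2 2 d₁ d₂ k := by
  have h1 := Submodule.finrank_sup_add_finrank_inf_eq (multiples (toC invA) 2 0 d₁ d₂ k)
    (multiples (toC invI) 0 2 d₁ d₂ k)
  have h2 := Submodule.finrank_mono (multiples_inf_le d₁ d₂ k)
  rw [finrank_multiples invA_ne_zero, finrank_multiples invI_ne_zero] at h1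
  rw [finrank_multiples (mul_ne_zero invA_ne_zero invI_ne_zero)] at h2
  omega

theorem multiples_le {a : MvPolynomial Idx ℂ} {s t : ℕ} (ha : a ∈ Ssp s t 0) (hg : a ∈ genAlg)
    (hst : 0 < s + t) {d₁ d₂ k : ℕ} (ih : ∀ (c₁ c₂ : ℕ) (h : ℤ), c₁ + c₂ < d₁ + d₂ →
      Ssp c₁ c₂ h ≤ Subalgebra.toSubmodule genAlg) :
    multiples a s t d₁ d₂ k ≤ Subalgebra.toSubmodule genAlg ⊓ Ssp d₁ d₂ k := by
  intro x hx
  rw [mem_multiples] at hx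
  rcases hx with rfl | ⟨h1, h2, y, hy, rfl⟩
  · exact zero_mem _
  · refine ⟨genAlg.mul_mem hg (ih _ _ _ (by omega) hy), ?_⟩
    have := Ssp_mul ha hy
    rwa [Nat.add_sub_cancel' h1, Nat.add_sub_cancel' h2, zero_add] at this

/-- A degree in which generation has been checked by a rank computation. -/
def Checked (δ : ℕ × ℕ × ℕ) : Prop := ∃ c ∈ candidates, decode c = δ

theorem Checked.le {δ : ℕ × ℕ × ℕ} (hδ : Checked δ)
    (ih : ∀ (c₁ c₂ : ℕ) (h : ℤ), c₁ + c₂ < δ.1 + δ.2.1 →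
      Ssp c₁ c₂ h ≤ Subalgebra.toSubmodule genAlg) :
    Sd δ ≤ Subalgebra.toSubmodule genAlg := by
  obtain ⟨c, hc, hcd⟩ := hδ
  obtain ⟨a, b, k⟩ := δ
  obtain ⟨E, hE, hbound⟩ := candidate_bound hc hcd
  dsimp only at ih ⊢
  have hfin : FiniteDimensional ℂ ↥(Subalgebra.toSubmodule genAlg ⊓ Ssp a b (k : ℤ)) :=
    Submodule.finiteDimensional_of_le inf_le_right
  have hJ : multiples (toC invA) 2 0 a b k ⊔ multiples (toC invI) 0 2 a b k ≤
      Subalgebra.toSubmodule genAlg ⊓ Ssp a b (k : ℤ) :=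
    sup_le (multiples_le invA_mem_Ssp invA_mem_genAlg (by norm_num) ih)
      (multiples_le invI_mem_Ssp invI_mem_genAlg (by norm_num) ih)
  have key : Module.finrank ℂ
      ↥(multiples (toC invA) 2 0 a b k ⊔ multiples (toC invI) 0 2 a b k) + E ≤
      Module.finrank ℂ ↥(Subalgebra.toSubmodule genAlg ⊓ Ssp a b (k : ℤ)) := by
    rcases hE with rfl | ⟨s, hs, hsd, rfl⟩
    · exact Submodule.finrank_mono hJ
    · obtain ⟨z, hz, hi⟩ := (program_sound program_eq).1 s hs
      unfold decode at hsd
      simp only [Prod.mk.injEq] at hsd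
      rw [hsd.1, hsd.2.1, hsd.2.2] at hz
      generalize Nat.land (Nat.shiftRight s 18) 255 = E at *
      refine finrank_add_le (leading E) hJ ?_ (z := fun j => toC (z j)) ?_ ?_
      · intro x hx
        obtain ⟨y, hy, w, hw, rfl⟩ := Submodule.mem_sup.mp hx
        rw [mem_multiples] at hy hw
        rw [map_add]
        have h1 : leading E y = 0 := by
          rcases hy with rfl | ⟨-, -, y, -, rfl⟩
          · exact map_zero _
          · exact leading_mul psi_invA _
        have h2 : leading E w = 0 := by
          rcases hw with rfl | ⟨-, -, y, -, rfl⟩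
          · exact map_zero _
          · exact leading_mul psi_invI _
        rw [h1, h2, add_zero]
      · exact fun j => ⟨leadAlg_le (hz j j.2).2, (hz j j.2).1⟩
      · have e : (fun j : Fin E => leading E (toC (z j))) =
            fun (j i : Fin E) => ((PowerSeries.coeff (i : ℕ) (psi (z j)) : ℤ) : ℂ) := by
          funext j i
          exact leading_toC _ _
        rw [e]
        refine linearIndependent_of_mod _ fun c hc => ?_
        have h3 := hi (fun j => if h : j < E then c ⟨j, h⟩ else 0) ?_
        · funext j
          have := h3 j j.2
          rwa [dif_pos j.2] at this
        · intro i hi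
          rw [← Fin.sum_univ_eq_sum_range
            (fun j => (if h : j < E then c ⟨j, h⟩ else 0) * PowerSeries.coeff i (psiP (z j))) E,
            ← hc ⟨i, hi⟩]
          refine Finset.sum_congr rfl fun j _ => ?_
          rw [dif_pos j.2]
          rfl
  have h1 := shiftDim_le_finrank_sup a b k
  have h2 := Submodule.eq_of_le_of_finrank_le
    (inf_le_right : Subalgebra.toSubmodule genAlg ⊓ Ssp a b (k : ℤ) ≤ Ssp a b (k : ℤ)) (by omega)
  exact inf_eq_right.mp h2

/-- The set of checked degrees as a bit mask. -/
def candidateMask : ℕ :=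
  candidates.foldr (fun c m => Nat.lor (Nat.shiftLeft 1 (c % 2 ^ 18)) m) 0

/-- Look up a degree in a bit mask. -/
def inMask (m a b k : ℕ) : Bool :=
  Nat.testBit m (a + 64 * b + 4096 * k) && (Nat.blt a 64 && (Nat.blt b 64 && Nat.blt k 64))

theorem exists_of_testBit (l : List ℕ) {n : ℕ} (h : Nat.testBit
    (l.foldr (fun c m => Nat.lor (Nat.shiftLeft 1 (c % 2 ^ 18)) m) 0) n = true) :
    ∃ c ∈ l, c % 2 ^ 18 = n := by
  induction l with
  | nil => simp at h
  | cons c l ih =>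
    rw [List.foldr_cons] at h
    have h1 := Nat.testBit_or (Nat.shiftLeft 1 (c % 2 ^ 18))
      (l.foldr (fun c m => Nat.lor (Nat.shiftLeft 1 (c % 2 ^ 18)) m) 0) n
    rw [show Nat.lor (Nat.shiftLeft 1 (c % 2 ^ 18)) (l.foldr
      (fun c m => Nat.lor (Nat.shiftLeft 1 (c % 2 ^ 18)) m) 0) =
        Nat.shiftLeft 1 (c % 2 ^ 18) ||| (l.foldr
      (fun c m => Nat.lor (Nat.shiftLeft 1 (c % 2 ^ 18)) m) 0) from rfl, h1, Bool.or_eq_true] at h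
    rcases h with h | h
    · refine ⟨c, List.mem_cons_self, ?_⟩
      rw [show Nat.shiftLeft 1 (c % 2 ^ 18) = 2 ^ (c % 2 ^ 18) from Nat.one_shiftLeft _,
        Nat.testBit_two_pow] at h
      exact of_decide_eq_true h
    · obtain ⟨e, he, h2⟩ := ih h
      exact ⟨e, List.mem_cons_of_mem _ he, h2⟩

theorem checked_of_inMask {a b k : ℕ} (h : inMask candidateMask a b k = true) :
    Checked (a, b, k) := by
  unfold inMask at h
  simp only [Bool.and_eq_true, Nat.blt_eq] at h
  obtain ⟨h, ha, hb, hk⟩ := h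
  obtain ⟨c, hc, h1⟩ := exists_of_testBit _ h
  refine ⟨c, hc, ?_⟩
  have e : ∀ x, Nat.land x 63 = x % 64 := fun x => Nat.and_two_pow_sub_one_eq_mod x 6
  have e' : ∀ x i, Nat.shiftRight x i = x / 2 ^ i := Nat.shiftRight_eq_div_pow
  unfold decode
  simp only [e, e', Prod.mk.injEq]
  omega

/-- Equality of triples of numbers. -/
def beq3 (x y : ℕ × ℕ × ℕ) : Bool := Nat.beq x.1 y.1 && (Nat.beq x.2.1 y.2.1 && Nat.beq x.2.2 y.2.2)

theorem beq3_self (x : ℕ × ℕ × ℕ) : beq3 x x = true := by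
  simp [beq3]

/-- Implication of Booleans. -/
def impl (a b : Bool) : Bool := bif a then b else true

theorem impl_mp {a b : Bool} (h : impl a b = true) (ha : a = true) : b = true := by
  subst ha
  exact h

/-- All checks on degrees needed for generation. -/
def degreeChecks : Bool := force candidateMask fun m =>
  degs.all (fun x => Nat.beq (x.2.2 % 2) 0 && Nat.blt 0 (x.1 + x.2.1)) &&
  (degs.all (fun x => [1, 2, 3, 4].all fun r => impl (Nat.ble r x.2.2)
    (inMask m x.1 (x.2.1 + 1) (x.2.2 + 4 - 2 * r))) &&
  (degs.all (fun x => impl (Nat.beq x.2.2 2) (impl (degs.any (beq3 (x.1, x.2.1 + 1, 2)))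
    (degs.all fun y => impl (Nat.beq y.2.2 2) ((inMask m (x.1 + y.1) (x.2.1 + y.2.1 + 1) 2 &&
      inMask m (x.1 + y.1) (x.2.1 + y.2.1 + 1) 0) ||
        !(degs.any (beq3 (y.1, y.2.1 + 1, 2))))))) &&
  (degs.all (fun x => impl (Nat.beq x.2.1 0) ([1, 2, 3, 4, 5, 6].all fun r =>
    impl (Nat.ble r x.2.2) (inMask m (x.1 + 1) 0 (x.2.2 + 6 - 2 * r)))) &&
  (degs.all (fun x => impl (Nat.beq x.2.1 0) (degs.all fun y => impl (Nat.beq y.2.1 0)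
    ([1, 2, 3, 4, 5, 6].all fun r => impl (Nat.blt x.2.2 r && (Nat.blt y.2.2 r &&
      Nat.ble r (x.2.2 + y.2.2))) (inMask m (x.1 + y.1 + 1) 0 (x.2.2 + y.2.2 + 6 - 2 * r))))) &&
  degs.all (fun x => impl (Nat.beq x.2.1 0 && Nat.beq x.2.2 2) (degs.all fun y =>
    impl (Nat.beq y.2.1 0 && Nat.beq y.2.2 2) (degs.all fun z =>
      impl (Nat.beq z.2.1 0 && Nat.beq z.2.2 2) (inMask m (x.1 + y.1 + z.1 + 1) 0 2 &&
        inMask m (x.1 + y.1 + z.1 + 1) 0 0)))))))) 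

theorem degreeChecks_eq : degreeChecks = true := by decide +kernel

theorem dgam_even (i : Fin 194) : Even (dgam i).2.2 := by
  have h := degreeChecks_eq
  unfold degreeChecks at h
  rw [force_eq, Bool.and_eq_true] at h
  have := List.all_eq_true.mp h.1 _ (dgam_mem i)
  simp only [Bool.and_eq_true, Nat.beq_eq] at this
  exact Nat.even_iff.mpr this.1

theorem dgam_pos (i : Fin 194) : 0 < (dgam i).1 + (dgam i).2.1 := by
  have h := degreeChecks_eq
  unfold degreeChecks at h
  rw [force_eq, Bool.and_eq_true] at h
  have := List.all_eq_true.mp h.1 _ (dgam_mem i)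
  simp only [Bool.and_eq_true, Nat.blt_eq] at this
  exact this.2

/-- The generators generate the algebra of highest weight vectors. -/
theorem Ssp_le_genAlg (d₁ d₂ : ℕ) (h : ℤ) : Ssp d₁ d₂ h ≤ Subalgebra.toSubmodule genAlg := by
  have H := degreeChecks_eq
  unfold degreeChecks at H
  rw [force_eq] at H
  simp only [Bool.and_eq_true] at H
  obtain ⟨-, hg₁, hg₂, hf₁, hf₂, hf₃⟩ := H
  refine generation gam_mem dgam_pos ca_mem_genAlg cb_mem_genAlg dgam_even Checked
    (fun δ hδ ih => hδ.le ih) ?_ ?_ ?_ ?_ ?_ _ d₁ d₂ h rfl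
  · intro i r h1 h2 h3
    have := List.all_eq_true.mp (List.all_eq_true.mp hg₁ _ (dgam_mem i)) r
      (by interval_cases r <;> simp)
    exact checked_of_inMask (impl_mp this (Nat.ble_eq.mpr h3))
  · intro i j r hr hi hj
    by_cases h1 : degs.any (beq3 ((dgam i).1, (dgam i).2.1 + 1, 2)) = true
    · have := List.all_eq_true.mp (impl_mp (impl_mp (List.all_eq_true.mp hg₂ _ (dgam_mem i))
        (Nat.beq_eq.mpr hi)) h1) _ (dgam_mem j)
      have := impl_mp this (Nat.beq_eq.mpr hj)
      rw [Bool.or_eq_true, Bool.and_eq_true] at this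
      rcases this with h2 | h2
      · left
        rcases hr with rfl | rfl
        · exact checked_of_inMask h2.1
        · exact checked_of_inMask h2.2
      · right; right
        intro l hl
        have h3 : degs.any (beq3 ((dgam j).1, (dgam j).2.1 + 1, 2)) = true :=
          List.any_eq_true.mpr ⟨_, dgam_mem l, by rw [hl]; exact beq3_self _⟩
        rw [h3] at h2
        exact absurd h2 (by decide)
    · right; left
      intro l hl
      exact h1 (List.any_eq_true.mpr ⟨_, dgam_mem l, by rw [hl]; exact beq3_self _⟩)
  · intro i r hi h1 h2 h3
    have := List.all_eq_true.mp (impl_mp (List.all_eq_true.mp hf₁ _ (dgam_mem i))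
      (Nat.beq_eq.mpr hi)) r (by interval_cases r <;> simp)
    exact checked_of_inMask (impl_mp this (Nat.ble_eq.mpr h3))
  · intro i j r hi hj h1 h2 h3 h4
    have := List.all_eq_true.mp (impl_mp (List.all_eq_true.mp (impl_mp
      (List.all_eq_true.mp hf₂ _ (dgam_mem i)) (Nat.beq_eq.mpr hi)) _ (dgam_mem j))
      (Nat.beq_eq.mpr hj)) r (by interval_cases r <;> simp_all)
    refine checked_of_inMask (impl_mp this ?_)
    simp only [Bool.and_eq_true, Nat.blt_eq, Nat.ble_eq]
    exact ⟨h1, h2, h4⟩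
  · intro i j l r hi hj hl hi2 hj2 hl2 hr
    have := impl_mp (List.all_eq_true.mp (impl_mp (List.all_eq_true.mp (impl_mp
      (List.all_eq_true.mp hf₃ _ (dgam_mem i)) (by rw [hi, hi2]; rfl)) _ (dgam_mem j))
      (by rw [hj, hj2]; rfl)) _ (dgam_mem l)) (by rw [hl, hl2]; rfl)
    rw [Bool.and_eq_true] at this
    rcases hr with rfl | rfl
    · exact checked_of_inMask this.1
    · exact checked_of_inMask this.2

theorem multiset_sum_eq {M : Type*} [AddCommMonoid M] (s : Multiset (Fin 194)) (g : Fin 194 → M) :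
    (s.map g).sum = ∑ i, s.count i • g i := by
  rw [Finset.sum_multiset_map_count]
  refine Finset.sum_subset (Finset.subset_univ _) fun i _ hi => ?_
  rw [Multiset.mem_toFinset] at hi
  rw [Multiset.count_eq_zero_of_notMem hi, zero_smul]

theorem ncard_le_digit {w : ℕ × ℕ × ℕ → ℕ × ℕ} (hw : ∀ i, 0 < (w (dgam i)).1) {n e b : ℕ}
    (hb : genNum (degs.map w).get 1 n < 2 ^ b) {S : Set (Multiset (Fin 194))}
    (hS : ∀ s ∈ S, (s.map fun i => w (dgam i)).sum = (n, e)) :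
    S.Finite ∧ S.ncard ≤ genNum (degs.map w).get (2 ^ b) n / (2 ^ b) ^ e % 2 ^ b := by
  have hl : (degs.map w).length = 194 := by rw [List.length_map, degs_length]
  have hget : ∀ j, (degs.map w).get j = w (dgam (j.cast hl)) := by
    intro j
    rw [dgam_eq]
    simp
  have hpos : ∀ j, 0 < ((degs.map w).get j).1 := fun j => by rw [hget]; exact hw _
  have hsum : ∀ (g : Fin 194 → ℕ), ∑ j : Fin (degs.map w).length, g (j.cast hl) = ∑ i, g i :=
    fun g => (finCongr hl).sum_comp g
  let f : Multiset (Fin 194) → (Fin (degs.map w).length → ℕ) := fun s j => s.count (j.cast hl)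
  have hf : ∀ s ∈ S, f s ∈ ((soln (degs.map w).get n).filter fun f =>
      ∑ i, f i * ((degs.map w).get i).2 = e) := by
    intro s hs
    have h1 := hS s hs
    rw [multiset_sum_eq] at h1
    rw [Finset.mem_filter, mem_soln hpos]
    simp only [hget]
    constructor
    · rw [hsum fun i => s.count i * (w (dgam i)).1]
      have := congrArg Prod.fst h1
      simpa [Prod.fst_sum] using this
    · rw [hsum fun i => s.count i * (w (dgam i)).2]
      have := congrArg Prod.snd h1
      simpa [Prod.snd_sum] using this
  have hinj : Set.InjOn f S := by
    intro s _ t _ h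
    refine Multiset.ext.mpr fun i => ?_
    exact congrFun h (i.cast hl.symm)
  rw [genNum_digit _ _ _ _ hb, ← Set.ncard_coe_finset]
  have hf' : Set.MapsTo f S ((soln (degs.map w).get n).filter fun f =>
      ∑ i, f i * ((degs.map w).get i).2 = e : Finset (Fin (degs.map w).length → ℕ)) :=
    fun s hs => Finset.mem_coe.mpr (hf s hs)
  exact ⟨Set.Finite.of_injOn hf' hinj (Finset.finite_toSet _),
    Set.ncard_le_ncard_of_injOn f hf' hinj (Finset.finite_toSet _)⟩

/-- Encoding of degrees by pairs of numbers. -/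
def degCode : ℕ × ℕ × ℕ →+ ℕ × ℕ where
  toFun x := (x.1 + x.2.1, x.2.1 * 256 + x.2.2)
  map_zero' := rfl
  map_add' x y := by
    simp only [Prod.fst_add, Prod.snd_add, Prod.mk_add_mk, Prod.mk.injEq]
    constructor <;> ring

/-- Encoding of degrees by pairs of numbers. -/
def fullCode (x : ℕ × ℕ × ℕ) : ℕ × ℕ := (Nat.add x.1 x.2.1, Nat.add (Nat.mul x.2.1 256) x.2.2)

/-- Degrees of covariants which may be nonzero at the special point. -/
def survives (x : ℕ × ℕ × ℕ) : Bool :=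
  Nat.ble (2 * x.2.1) (x.2.2 + 4 * x.1) && (Nat.beq ((x.2.2 + 4 * x.1 - 2 * x.2.1) % 10) 0 &&
    Nat.ble (x.2.2 + 4 * x.1 - 2 * x.2.1) (10 * x.1))

/-- Encoding which excludes generators vanishing at the special point. -/
def survivorCode (x : ℕ × ℕ × ℕ) : ℕ × ℕ := bif survives x then fullCode x else (100, 0)

/-- Degrees treated by evaluation at the special point. -/
def pointDegs : List (ℕ × ℕ × ℕ) :=
  [(5, 2, 4), (7, 1, 4), (4, 4, 2), (10, 1, 2), (11, 2, 0), (5, 5, 0), (8, 2, 2), (9, 3, 0),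
   (7, 4, 0), (6, 3, 2)]

/-- The digit of a table of numbers of monomials. -/
def monDigit (T : List Nat) (x : ℕ × ℕ) : Nat :=
  Nat.mod (Nat.div (getAt 0 T (Nat.sub 15 x.1)) (Nat.pow (Nat.pow 2 24) x.2)) (Nat.pow 2 24)

theorem totals_fullCode : countTab 0 (degs.map fullCode) 16
    (fun T => T.all fun x => Nat.ble x 16000000) = true := by decide +kernel

theorem totals_survivorCode : countTab 0 (degs.map survivorCode) 16
    (fun T => T.all fun x => Nat.ble x 16000000) = true := by decide +kernel

theorem monDigit_le_tabDim : countTab 24 (degs.map fullCode) 16 (fun T =>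
    countTab 40 coefCodes 38 fun T' => degs.all fun x => pointDegs.any (beq3 x) ||
      Nat.ble (monDigit T (fullCode x)) (tabDim T' x.1 x.2.1 x.2.2)) = true := by decide +kernel

theorem monDigit_le_one : countTab 24 (degs.map survivorCode) 16 (fun T =>
    pointDegs.all fun x => survives x && Nat.ble (monDigit T (fullCode x)) 1) = true := by
  decide +kernel

theorem degs_bound : degs.all (fun x => Nat.blt 0 (Nat.add x.1 x.2.1) &&
    (Nat.ble (Nat.add x.1 x.2.1) 15 && Nat.beq (x.2.2 % 2) 0)) = true := by decide +kernel

theorem dgam_bound (i : Fin 194) : (dgam i).1 + (dgam i).2.1 ≤ 15 := by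
  have := List.all_eq_true.mp degs_bound _ (dgam_mem i)
  simp only [Bool.and_eq_true, Nat.ble_eq] at this
  exact this.2.1

theorem genNum_lt_of_totals {L : List (ℕ × ℕ)} (hL : ∀ g ∈ L, 0 < g.1)
    (h : countTab 0 L 16 (fun T => T.all fun x => Nat.ble x 16000000) = true) {n : ℕ} (hn : n ≤ 15) :
    genNum L.get 1 n < 2 ^ 24 := by
  rw [countTab_eq hL, pow_zero, List.all_eq_true] at h
  have hlen : ∀ m, (countList L.get 1 m).length = m := by
    intro m
    induction m with
    | zero => rfl
    | succ m ih => rw [countList, List.length_cons, ih]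
  have h1 : getAt 0 (countList L.get 1 16) (15 - n) ∈ countList L.get 1 16 := by
    rw [getAt_eq, List.getD_eq_getElem _ _ (by rw [hlen]; omega)]
    exact List.getElem_mem _
  have h2 := Nat.le_of_ble_eq_true (h _ h1)
  rw [getAt_countList, if_pos (by omega), show 16 - 1 - (15 - n) = n by omega] at h2
  exact h2.trans_lt (by norm_num)

theorem monDigit_eq {L : List (ℕ × ℕ)} {x : ℕ × ℕ} (hx : x.1 ≤ 15) :
    monDigit (countList L.get (2 ^ 24) 16) x =
      genNum L.get (2 ^ 24) x.1 / (2 ^ 24) ^ x.2 % 2 ^ 24 := by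
  unfold monDigit
  rw [getAt_countList, if_pos (by rw [Nat.sub_eq]; omega), Nat.sub_eq,
    show 16 - 1 - (15 - x.1) = x.1 by omega]
  rfl

theorem fullCode_pos : ∀ g ∈ degs.map fullCode, 0 < g.1 := by
  intro g hg
  obtain ⟨x, hx, rfl⟩ := List.mem_map.mp hg
  have := List.all_eq_true.mp degs_bound _ hx
  simp only [Bool.and_eq_true, Nat.blt_eq] at this
  exact this.1

theorem survivorCode_pos : ∀ g ∈ degs.map survivorCode, 0 < g.1 := by
  intro g hg
  obtain ⟨x, hx, rfl⟩ := List.mem_map.mp hg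
  unfold survivorCode
  cases survives x
  · exact Nat.succ_pos _
  · exact fullCode_pos _ (List.mem_map_of_mem hx)

theorem sum_fullCode {s : Multiset (Fin 194)} {δ : ℕ × ℕ × ℕ} (h : (s.map dgam).sum = δ) :
    (s.map fun i => fullCode (dgam i)).sum = fullCode δ := by
  change (s.map (degCode ∘ dgam)).sum = degCode δ
  rw [← h, map_multiset_sum, Multiset.map_map]

/-- Monomials in the generators of given degree. -/
def Mon (δ : ℕ × ℕ × ℕ) : Set (Multiset (Fin 194)) := {s | (s.map dgam).sum = δ}

theorem Mon_card {δ : ℕ × ℕ × ℕ} (hδ : δ ∈ degs) (h : ¬ δ ∈ pointDegs) :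
    (Mon δ).Finite ∧ (Mon δ).ncard ≤ Module.finrank ℂ (Sd δ) := by
  have h1 := monDigit_le_tabDim
  rw [countTab_eq fullCode_pos, countTab_coef] at h1
  have h2 := List.all_eq_true.mp h1 _ hδ
  have hb := List.all_eq_true.mp degs_bound _ hδ
  simp only [Bool.and_eq_true, Nat.blt_eq, Nat.ble_eq, Nat.beq_eq, Nat.add_eq] at hb
  have h3 : pointDegs.any (beq3 δ) = false := by
    rw [Bool.eq_false_iff]
    intro hc
    obtain ⟨y, hy, h4⟩ := List.any_eq_true.mp hc
    unfold beq3 at h4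
    simp only [Bool.and_eq_true, Nat.beq_eq] at h4
    refine h ?_
    rw [show δ = y from Prod.ext h4.1 (Prod.ext h4.2.1 h4.2.2)]
    exact hy
  rw [h3, Bool.false_or, Nat.ble_eq, monDigit_eq hb.2.1, tabDim_eq (by omega) hb.2.2] at h2
  obtain ⟨h5, h6⟩ := ncard_le_digit (w := fullCode) (n := (fullCode δ).1) (e := (fullCode δ).2)
    (b := 24) (S := Mon δ) (fun i => fullCode_pos _ (List.mem_map_of_mem (dgam_mem i)))
    (genNum_lt_of_totals fullCode_pos totals_fullCode hb.2.1) fun s hs => sum_fullCode hs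
  exact ⟨h5, h6.trans h2⟩

theorem survivors_unique {δ : ℕ × ℕ × ℕ} (h : δ ∈ pointDegs) (hδ : δ ∈ degs)
    {s t : Multiset (Fin 194)} (hs : s ∈ Mon δ) (ht : t ∈ Mon δ)
    (hs' : ∀ i ∈ s, survives (dgam i) = true) (ht' : ∀ i ∈ t, survives (dgam i) = true) : s = t := by
  have h1 := monDigit_le_one
  rw [countTab_eq survivorCode_pos] at h1
  have h2 := List.all_eq_true.mp h1 _ h
  have hb := List.all_eq_true.mp degs_bound _ hδ
  simp only [Bool.and_eq_true, Nat.blt_eq, Nat.ble_eq, Nat.beq_eq, Nat.add_eq] at hb h2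
  rw [monDigit_eq hb.2.1] at h2
  obtain ⟨h5, h6⟩ := ncard_le_digit (w := survivorCode) (n := (fullCode δ).1)
    (e := (fullCode δ).2) (b := 24) (S := {s ∈ Mon δ | ∀ i ∈ s, survives (dgam i) = true})
    (fun i => survivorCode_pos _ (List.mem_map_of_mem (dgam_mem i)))
    (genNum_lt_of_totals survivorCode_pos totals_survivorCode hb.2.1) fun s hs => by
      rw [Multiset.map_congr rfl fun i hi => by
        rw [survivorCode, hs.2 i hi, cond_true], sum_fullCode hs.1]
  exact (Set.ncard_le_one h5).mp (h6.trans h2.2) _ ⟨hs, hs'⟩ _ ⟨ht, ht'⟩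

theorem survives_of_mem {δ : ℕ × ℕ × ℕ} (h : δ ∈ pointDegs) : survives δ = true := by
  have h1 := monDigit_le_one
  rw [countTab_eq survivorCode_pos] at h1
  have h2 := List.all_eq_true.mp h1 _ h
  rw [Bool.and_eq_true] at h2
  exact h2.1

/-- The special point, at which most covariants vanish. -/
def specialPt (R : Type) [CommRing R] : Idx → R :=
  Sum.elim ![1, 0, 0, 0, 0, 1, 0] ![0, 1, 0, 0, 0]

theorem survives_of_eval_ne_zero {δ : ℕ × ℕ × ℕ} {p : MvPolynomial Idx ℂ} (hp : p ∈ Sd δ)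
    (h : eval (specialPt ℂ) p ≠ 0) : survives δ = true := by
  rw [eval_eq'] at h
  obtain ⟨s, hs, h1⟩ := Finset.exists_ne_zero_of_sum_ne_zero h
  have h2 : ∀ i, specialPt ℂ i ^ s i ≠ 0 := fun i =>
    Finset.prod_ne_zero_iff.mp (right_ne_zero_of_mul h1) i (Finset.mem_univ i)
  have h3 : ∀ i, specialPt ℂ i = 0 → s i = 0 := by
    intro i hi
    by_contra hc
    exact h2 i (by rw [hi, zero_pow hc])
  have hw : Finsupp.weight wt s = (δ.1, δ.2.1, (δ.2.2 : ℤ)) := hp.1 (mem_support_iff.mp hs)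
  rw [Finsupp.weight_apply, Finsupp.sum_fintype _ _ (by simp), Fintype.sum_sum_type,
    Fin.sum_univ_seven, Fin.sum_univ_five] at hw
  simp only [h3 (Sum.inl 1) rfl, h3 (Sum.inl 2) rfl, h3 (Sum.inl 3) rfl, h3 (Sum.inl 4) rfl,
    h3 (Sum.inl 6) rfl, h3 (Sum.inr 0) rfl, h3 (Sum.inr 2) rfl, h3 (Sum.inr 3) rfl,
    h3 (Sum.inr 4) rfl, zero_smul, add_zero, zero_add] at hw
  obtain ⟨a, b, k⟩ := δ
  simp [wt] at hw
  unfold survives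
  simp only [Bool.and_eq_true, Nat.ble_eq, Nat.beq_eq]
  omega

theorem RowP.C_zero {n : ℕ} {c : ZMod 8191} (h : RowP n (PowerSeries.C c)) :
    ((Nat.mod (Nat.land n 68719476735) 8191 : ℕ) : ZMod 8191) = c := by
  obtain ⟨d, hd, hn, h1⟩ := h
  have h2 : (d 0 : ZMod 8191) = PowerSeries.coeff 0 (PowerSeries.C c) := h1 0 (by norm_num)
  rw [PowerSeries.coeff_zero_C] at h2
  have e : ∀ x, Nat.land x 68719476735 = x % 2 ^ 36 := by
    intro x
    rw [show 68719476735 = 2 ^ 36 - 1 by norm_num]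
    exact Nat.and_two_pow_sub_one_eq_mod x 36
  rw [← h2, e, hn, Finset.sum_range_succ']
  have : ∑ k ∈ Finset.range 224, d (k + 1) * (2 ^ 36) ^ (k + 1) =
      2 ^ 36 * ∑ k ∈ Finset.range 224, d (k + 1) * (2 ^ 36) ^ k := by
    rw [Finset.mul_sum]
    exact Finset.sum_congr rfl fun i _ => by ring
  rw [this, pow_zero, mul_one, Nat.mul_add_mod, Nat.mod_eq_of_lt ((hd 0).trans (by norm_num))]
  exact ZMod.natCast_mod _ _

/-- Evaluation at the special point modulo 8191. -/
def specialHom : ZPoly →+* PowerSeries (ZMod 8191) :=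
  (PowerSeries.C (R := ZMod 8191)).comp ((Int.castRingHom (ZMod 8191)).comp (eval (specialPt ℤ)))

theorem specialHom_apply (p : ZPoly) : specialHom p =
    PowerSeries.C ((eval (specialPt ℤ) p : ℤ) : ZMod 8191) := rfl

theorem specialF_rep :
    NGen.Rep specialHom ⟨1, 0, 6, [1, 0, 0, 0, 0, 1, 0]⟩ (sexticData ℤ) := by
  refine ⟨rfl, rfl, rfl, sexticData_isCov, fun s => ?_⟩
  change RowP _ (specialHom (ca ℤ s))
  rw [specialHom_apply]
  unfold ca
  rcases s with _ | _ | _ | _ | _ | _ | _ | s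
  · exact RowP.one.congr (by simp [specialPt])
  · exact RowP.zero.congr (by simp [specialPt])
  · exact RowP.zero.congr (by simp [specialPt])
  · exact RowP.zero.congr (by simp [specialPt])
  · exact RowP.zero.congr (by simp [specialPt])
  · exact RowP.one.congr (by simp [specialPt])
  · exact RowP.zero.congr (by simp [specialPt])
  · exact RowP.zero.congr (by rw [dif_neg (by omega)]; simp)

theorem specialG_rep : NGen.Rep specialHom ⟨0, 1, 4, [0, 1, 0, 0, 0]⟩ (quarticData ℤ) := by
  refine ⟨rfl, rfl, rfl, quarticData_isCov, fun s => ?_⟩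
  change RowP _ (specialHom (cb ℤ s))
  rw [specialHom_apply]
  unfold cb
  rcases s with _ | _ | _ | _ | _ | s
  · exact RowP.zero.congr (by simp [specialPt])
  · exact RowP.one.congr (by simp [specialPt])
  · exact RowP.zero.congr (by simp [specialPt])
  · exact RowP.zero.congr (by simp [specialPt])
  · exact RowP.zero.congr (by simp [specialPt])
  · exact RowP.zero.congr (by rw [dif_neg (by omega)]; simp)

theorem special_values : ngens recipes
    [⟨0, 1, 4, [0, 1, 0, 0, 0]⟩, ⟨1, 0, 6, [1, 0, 0, 0, 0, 1, 0]⟩] (fun L => L.all fun x =>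
      impl (pointDegs.any (beq3 (x.d1, x.d2, x.k)))
        (!(Nat.beq (Nat.mod (Nat.land (getAt 0 x.u 0) 68719476735) 8191) 0))) = true := by
  decide +kernel

theorem exists_of_forall₂ {α β : Type*} {R : α → β → Prop} {l : List α} {l' : List β}
    (h : List.Forall₂ R l l') {y : β} (hy : y ∈ l') : ∃ x ∈ l, R x y := by
  induction h with
  | nil => simp at hy
  | cons h1 _ ih =>
    rcases List.mem_cons.mp hy with rfl | hy
    · exact ⟨_, List.mem_cons_self, h1⟩
    · obtain ⟨x, hx, h2⟩ := ih hy
      exact ⟨x, List.mem_cons_of_mem _ hx, h2⟩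

theorem eval_gam_ne_zero {i : Fin 194} (hi : dgam i ∈ pointDegs) :
    eval (specialPt ℂ) (gam i) ≠ 0 := by
  obtain ⟨L, hL, h1⟩ := ngens_rep recipes
    (.cons specialG_rep (.cons specialF_rep .nil)) special_values
  obtain ⟨x, hx, h2⟩ := exists_of_forall₂ hL (List.get_mem zGens (i.cast zGens_length.symm))
  have h3 := impl_mp (List.all_eq_true.mp h1 x hx) (List.any_eq_true.mpr ⟨_, hi, by
    rw [h2.d1, h2.d2, h2.k]
    exact beq3_self _⟩)
  have h4 := h2.row 0
  rw [specialHom_apply] at h4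
  have h5 := h4.C_zero
  intro h0
  have h6 : eval (specialPt ℤ) ((zGen i).u 0) = 0 := by
    unfold gam at h0
    rw [eval_map, show specialPt ℂ = (Int.castRingHom ℂ) ∘ specialPt ℤ from ?_, ← eval₂_comp] at h0
    · exact Int.cast_eq_zero.mp h0
    · funext j
      rcases j with j | j <;> fin_cases j <;> simp [specialPt]
  rw [show eval (specialPt ℤ) ((zGens.get (i.cast zGens_length.symm)).u 0) = 0 from h6,
    Int.cast_zero, ZMod.natCast_eq_zero_iff] at h5
  have h7 := Nat.eq_zero_of_dvd_of_lt h5 (Nat.mod_lt _ (by norm_num))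
  rw [h7] at h3
  exact absurd h3 (by decide)

/-- A monomial in the generators. -/
def gamMon (s : Multiset (Fin 194)) : MvPolynomial Idx ℂ := (s.map gam).prod

theorem gamMon_mem {δ : ℕ × ℕ × ℕ} {s : Multiset (Fin 194)} (hs : s ∈ Mon δ) : gamMon s ∈ Sd δ := by
  have := prod_mem_Sd gam_mem s
  rwa [show (s.map dgam).sum = δ from hs] at this

theorem gamMon_singleton (i : Fin 194) : gamMon {i} = gam i := by
  simp [gamMon]

theorem singleton_mem_Mon (i : Fin 194) : {i} ∈ Mon (dgam i) := by
  simp [Mon]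

theorem singleton_mem_Mon_of_eq {i : Fin 194} {δ : ℕ × ℕ × ℕ} (h : dgam i = δ) : {i} ∈ Mon δ :=
  h ▸ singleton_mem_Mon i

theorem linearIndependent_gamMon {δ : ℕ × ℕ × ℕ} (hδ : δ ∈ degs) (h : ¬ δ ∈ pointDegs) :
    LinearIndependent ℂ fun s : Mon δ => gamMon s := by
  obtain ⟨hf, hc⟩ := Mon_card hδ h
  have := hf.fintype
  have h1 : LinearIndependent ℂ fun s : Mon δ => (⟨gamMon s, gamMon_mem s.2⟩ : Sd δ) := by
    refine linearIndependent_of_top_le_span_of_card_le_finrank ?_ ?_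
    · rintro ⟨z, hz⟩ -
      have h2 := mem_span_monomials gam_mem (Ssp_le_genAlg _ _ _ hz) hz
      have h3 : Submodule.span ℂ {p | ∃ s : Multiset (Fin 194), (s.map dgam).sum = δ ∧
          p = (s.map gam).prod} ≤ (Submodule.span ℂ (Set.range fun s : Mon δ =>
            (⟨gamMon s, gamMon_mem s.2⟩ : Sd δ))).map (Sd δ).subtype := by
        rw [Submodule.span_le]
        rintro p ⟨s, hs, rfl⟩
        exact ⟨_, Submodule.subset_span ⟨⟨s, hs⟩, rfl⟩, rfl⟩
      obtain ⟨y, hy, rfl⟩ := h3 h2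
      exact hy
    · rwa [Fintype.card_eq_nat_card, Nat.card_coe_set_eq]
  exact h1.map' (Sd δ).subtype (Submodule.ker_subtype _)

/-- No generator is a combination of the other generators and decomposable elements of its
degree. -/
theorem coeff_eq_zero_of_decomposable (c : Fin 194 → ℂ) (i : Fin 194)
    (h : ∑ j with dgam j = dgam i, c j • gam j ∈
      Submodule.span ℂ (gamMon '' {s ∈ Mon (dgam i) | 2 ≤ Multiset.card s})) : c i = 0 := by
  by_cases hp : dgam i ∈ pointDegs
  · have h1 : Submodule.span ℂ (gamMon '' {s ∈ Mon (dgam i) | 2 ≤ Multiset.card s}) ≤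
        LinearMap.ker (aeval (R := ℂ) (specialPt ℂ)).toLinearMap := by
      rw [Submodule.span_le]
      rintro p ⟨s, ⟨hs, hs2⟩, rfl⟩
      change aeval (specialPt ℂ) (gamMon s) = 0
      by_contra hne
      unfold gamMon at hne
      rw [map_multiset_prod, Multiset.map_map] at hne
      have h2 : ∀ j ∈ s, survives (dgam j) = true := fun j hj => by
        refine survives_of_eval_ne_zero (gam_mem j) fun h0 => hne ?_
        refine Multiset.prod_eq_zero (Multiset.mem_map.mpr ⟨j, hj, ?_⟩)
        rw [Function.comp_apply, aeval_eq_eval]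
        exact h0
      have h3 := survivors_unique hp (dgam_mem i) hs (singleton_mem_Mon i) h2 (by
        simpa using survives_of_mem hp)
      rw [h3] at hs2
      simp at hs2
    have h4 := h1 h
    have h5 : (Finset.univ.filter fun j => dgam j = dgam i) = {i} := by
      ext j
      rw [Finset.mem_filter, Finset.mem_singleton]
      refine ⟨fun hj => ?_, fun hj => ⟨Finset.mem_univ _, by rw [hj]⟩⟩
      have h6 := survivors_unique hp (dgam_mem i) (hj.2 ▸ singleton_mem_Mon j)
        (singleton_mem_Mon i) (by simpa [hj.2] using survives_of_mem hp)
        (by simpa using survives_of_mem hp)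
      exact Multiset.singleton_inj.mp h6
    rw [h5, Finset.sum_singleton, LinearMap.mem_ker, map_smul, smul_eq_mul] at h4
    refine (mul_eq_zero.mp h4).resolve_right ?_
    change aeval (specialPt ℂ) (gam i) ≠ 0
    rw [aeval_eq_eval]
    exact eval_gam_ne_zero hp
  · have hli := linearIndependent_gamMon (dgam_mem i) hp
    have hd := hli.disjoint_span_image (s := {s | 2 ≤ Multiset.card s.1})
      (t := {s | Multiset.card s.1 = 1}) (by
        rw [Set.disjoint_left]
        intro s h1 h2
        simp only [Set.mem_ofPred_eq] at h1 h2
        omega)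
    rw [Submodule.disjoint_def] at hd
    have h0 := hd _ (Submodule.span_mono (by
        rintro p ⟨s, ⟨hs, hs2⟩, rfl⟩
        exact ⟨⟨s, hs⟩, hs2, rfl⟩) h) (sum_mem fun j hj => Submodule.smul_mem _ _
        (Submodule.subset_span ⟨⟨{j},
          singleton_mem_Mon_of_eq (Finset.mem_filter.mp hj).2⟩, by simp, gamMon_singleton j⟩))
    have hli' : LinearIndependent ℂ fun j : {j // dgam j = dgam i} => gam j := by
      have := hli.comp (fun j : {j // dgam j = dgam i} =>
        (⟨{j.1}, singleton_mem_Mon_of_eq j.2⟩ : Mon (dgam i))) (by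
          intro j k hjk
          have := congrArg Subtype.val hjk
          exact Subtype.ext (Multiset.singleton_inj.mp this))
      simpa [Function.comp_def, gamMon_singleton] using this
    rw [Finset.sum_subtype (p := fun j => dgam j = dgam i) _ (by simp)] at h0
    exact Fintype.linearIndependent_iff.mp hli' (fun j => c j.1) h0 ⟨i, rfl⟩

/-- The span of monomials of at least given length. -/
def monSpan (n : ℕ) : Submodule ℂ (MvPolynomial Idx ℂ) :=
  Submodule.span ℂ (gamMon '' {s | n ≤ Multiset.card s})

theorem monSpan_mul (m n : ℕ) : monSpan m * monSpan n ≤ monSpan (m + n) := by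
  unfold monSpan
  rw [Submodule.span_mul_span]
  refine Submodule.span_mono ?_
  rintro p ⟨_, ⟨s, hs, rfl⟩, _, ⟨t, ht, rfl⟩, rfl⟩
  refine ⟨s + t, ?_, ?_⟩
  · simp only [Set.mem_ofPred_eq, Multiset.card_add] at hs ht ⊢
    omega
  · simp [gamMon]

theorem monSpan_anti {m n : ℕ} (h : m ≤ n) : monSpan n ≤ monSpan m :=
  Submodule.span_mono (Set.image_mono fun _ hs => h.trans hs)

theorem constantCoeff_gam (i : Fin 194) : constantCoeff (gam i) = 0 := by
  by_contra h
  have h1 := (gam_mem i).1 h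
  rw [map_zero] at h1
  have h2 := dgam_pos i
  simp only [Prod.ext_iff, Prod.fst_zero, Prod.snd_zero] at h1
  omega

theorem sub_C_mem_monSpan {p : MvPolynomial Idx ℂ} (hp : p ∈ genAlg) :
    p - C (constantCoeff p) ∈ monSpan 1 := by
  unfold genAlg at hp
  induction hp using Algebra.adjoin_induction with
  | mem p hp =>
    obtain ⟨i, rfl⟩ := hp
    rw [constantCoeff_gam, map_zero, sub_zero]
    exact Submodule.subset_span ⟨{i}, by simp, gamMon_singleton i⟩
  | algebraMap r =>
    rw [algebraMap_eq, constantCoeff_C, sub_self]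
    exact zero_mem _
  | add p q _ _ hp hq =>
    rw [map_add, map_add, add_sub_add_comm]
    exact add_mem hp hq
  | mul p q _ _ hp hq =>
    have h1 := monSpan_anti (m := 1) (n := 1 + 1) (by norm_num) (monSpan_mul 1 1 (Submodule.mul_mem_mul hp hq))
    have h2 := (monSpan 1).smul_mem (constantCoeff p) hq
    have h3 := (monSpan 1).smul_mem (constantCoeff q) hp
    have := add_mem (add_mem h1 h2) h3
    rw [smul_eq_C_mul, smul_eq_C_mul] at this
    convert this using 1
    rw [map_mul, map_mul]
    ring

theorem mem_genAlg_of_ker {p : MvPolynomial Idx ℂ} (hp : opE ℂ p = 0) : p ∈ genAlg := by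
  rw [← sum_weightedHomogeneousComponent wt p]
  exact finsum_induction (· ∈ genAlg) (zero_mem _) (fun _ _ => add_mem) fun d =>
    Ssp_le_genAlg _ _ _ (comp_mem_Ssp d.1 d.2.1 d.2.2 hp)

theorem mem_monSpan_of_ker {p : MvPolynomial Idx ℂ} (hp : opE ℂ p = 0)
    (h0 : constantCoeff p = 0) : p ∈ monSpan 1 := by
  have := sub_C_mem_monSpan (mem_genAlg_of_ker hp)
  rwa [h0, map_zero, sub_zero] at this

/-- The generators are independent modulo decomposable elements. -/
theorem gam_independent {c : Fin 194 → ℂ} (h : ∑ i, c i • gam i ∈ monSpan 2) (i : Fin 194) :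
    c i = 0 := by
  refine coeff_eq_zero_of_decomposable c i ?_
  let δ : Deg := ((dgam i).1, (dgam i).2.1, ((dgam i).2.2 : ℤ))
  have key : ∀ x : ℕ × ℕ × ℕ, ((x.1, x.2.1, (x.2.2 : ℤ)) : Deg) = δ ↔ x = dgam i := by
    intro x
    simp only [δ, Prod.ext_iff, Nat.cast_inj]
  have h1 : weightedHomogeneousComponent wt δ (∑ i, c i • gam i) =
      ∑ j with dgam j = dgam i, c j • gam j := by
    rw [map_sum, Finset.sum_filter]
    refine Finset.sum_congr rfl fun j _ => ?_
    rw [map_smul, comp_of_mem (gam_mem j).1]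
    simp only [key]
    split_ifs
    · rfl
    · rw [smul_zero]
  rw [← h1]
  have h2 : monSpan 2 ≤ (Submodule.span ℂ (gamMon '' {s ∈ Mon (dgam i) |
      2 ≤ Multiset.card s})).comap (weightedHomogeneousComponent wt δ) := by
    unfold monSpan
    rw [Submodule.span_le]
    rintro p ⟨s, hs, rfl⟩
    change weightedHomogeneousComponent wt δ (gamMon s) ∈
      Submodule.span ℂ (gamMon '' {s ∈ Mon (dgam i) | 2 ≤ Multiset.card s})
    rw [comp_of_mem (show gamMon s ∈ Sd (s.map dgam).sum from prod_mem_Sd gam_mem s).1]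
    simp only [key]
    split_ifs with hd
    · exact Submodule.subset_span ⟨s, ⟨hd, hs⟩, rfl⟩
    · exact zero_mem _
  exact h2 h

/-- The exponent of the monomial carrying the `i`-th coefficient of a binary form. -/
def formExp (n i : ℕ) : Fin 2 →₀ ℕ := Finsupp.single 0 (n - i) + Finsupp.single 1 i

theorem formExp_inj {n i j : ℕ} (h : formExp n i = formExp n j) : i = j := by
  simpa [formExp] using DFunLike.congr_fun h 1

theorem form_eq (n : ℕ) (a : Fin (n + 1) → ℂ) :
    form n a = ∑ i : Fin (n + 1), monomial (formExp n i) (a i) := by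
  unfold form formExp
  refine Finset.sum_congr rfl fun i _ => ?_
  rw [X_pow_eq_monomial, X_pow_eq_monomial, C_mul_monomial, monomial_mul, mul_one, mul_one]

theorem coeffOf_form (n : ℕ) (a : Fin (n + 1) → ℂ) : coeffOf n (form n a) = a := by
  ext i
  rw [form_eq]
  change coeff (formExp n i) _ = _
  rw [coeff_sum, Finset.sum_eq_single i]
  · simp
  · intro j _ hj
    rw [coeff_monomial, if_neg fun h => hj (Fin.ext (formExp_inj h))]
  · simp

theorem form_coeffOf {n : ℕ} {q : MvPolynomial (Fin 2) ℂ} (hq : q.IsHomogeneous n) :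
    form n (coeffOf n q) = q := by
  ext m
  rw [form_eq, coeff_sum]
  by_cases hm : m 0 + m 1 = n
  · have h1 : formExp n (m 1) = m := by
      ext i
      fin_cases i <;> simp [formExp]
      omega
    rw [Finset.sum_eq_single ⟨m 1, by omega⟩]
    · change coeff m (monomial (formExp n (m 1)) (coeff (formExp n (m 1)) q)) = _
      rw [h1, coeff_monomial, if_pos rfl]
    · intro j _ hj
      rw [coeff_monomial, if_neg fun h => hj (Fin.ext (formExp_inj (h.trans h1.symm)))]
    · simp
  · have h0 : coeff m q = 0 := by
      by_contra h
      have := hq h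
      rw [Finsupp.weight_apply, Finsupp.sum_fintype _ _ (by simp)] at this
      simp at this
      exact hm this
    rw [h0]
    refine Finset.sum_eq_zero fun j _ => ?_
    rw [coeff_monomial, if_neg fun h => hm ?_]
    rw [← h]
    have := j.2
    simp [formExp]
    omega

theorem isHomogeneous_form (n : ℕ) (a : Fin (n + 1) → ℂ) : (form n a).IsHomogeneous n := by
  rw [form_eq]
  refine IsHomogeneous.sum _ _ _ fun i _ => isHomogeneous_monomial _ ?_
  have := i.2
  simp [formExp, Finsupp.degree_eq_sum]
  omega

theorem form_coeffAct (g : SL2) (n : ℕ) (a : Fin (n + 1) → ℂ) :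
    form n (coeffAct g n a) = subst2 g (form n a) := by
  refine form_coeffOf ?_
  have := (isHomogeneous_form n a).aeval (n := 1)
    (fun i : Fin 2 => ∑ j : Fin 2, C ((g⁻¹).1 i j) * (X j : MvPolynomial (Fin 2) ℂ)) fun i =>
      IsHomogeneous.sum _ _ _ fun j _ => by
        simpa using (isHomogeneous_C (Fin 2) ((g⁻¹).1 i j)).mul (isHomogeneous_X ℂ j)
  rwa [one_mul] at this

theorem form_injective (n : ℕ) : Function.Injective (form n) := fun a b h => by
  rw [← coeffOf_form n a, h, coeffOf_form]

theorem subst2_mul (g h : SL2) (p : MvPolynomial (Fin 2) ℂ) :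
    subst2 (g * h) p = subst2 g (subst2 h p) := by
  suffices h : subst2 (g * h) = (subst2 g).comp (subst2 h) from DFunLike.congr_fun h p
  refine algHom_ext fun i => ?_
  rw [AlgHom.comp_apply]
  simp only [subst2, aeval_X, Fin.sum_univ_two, map_add, map_mul, mul_inv_rev]
  simp only [algHom_C, algebraMap_eq, Matrix.SpecialLinearGroup.coe_mul,
    Matrix.mul_apply, Fin.sum_univ_two, map_add, map_mul]
  ring

theorem coeffAct_mul (g h : SL2) (n : ℕ) (a : Fin (n + 1) → ℂ) :
    coeffAct (g * h) n a = coeffAct g n (coeffAct h n a) := by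
  refine form_injective n ?_
  rw [form_coeffAct, form_coeffAct, form_coeffAct, subst2_mul]

theorem ptAct_mul {ι : Type} (ν : ι → ℕ) (g h : SL2) (pt : Var ν → ℂ) :
    ptAct ν (g * h) pt = ptAct ν g (ptAct ν h pt) := by
  ext (c | i)
  · simp only [ptAct, Sum.elim_inl, coeffAct_mul]
  · simp only [ptAct, Sum.elim_inr, Fin.sum_univ_two, Matrix.SpecialLinearGroup.coe_mul,
      Matrix.mul_apply]
    ring

/-- Upper unipotent matrices. -/
def upper (s : ℂ) : SL2 := ⟨!![1, s; 0, 1], by simp [Matrix.det_fin_two]⟩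

/-- Lower unipotent matrices. -/
def lower (s : ℂ) : SL2 := ⟨!![1, 0; s, 1], by simp [Matrix.det_fin_two]⟩

theorem subst2_upper (s : ℂ) :
    subst2 (upper s) = aeval ![X 0 - C s * X 1, X 1] := by
  refine algHom_ext fun i => ?_
  have h : (upper s)⁻¹ = upper (-s) := by
    refine inv_eq_of_mul_eq_one_right (Subtype.ext ?_)
    change !![1, s; 0, 1] * !![1, -s; 0, 1] = (1 : Matrix (Fin 2) (Fin 2) ℂ)
    simp [Matrix.one_fin_two]
  rw [subst2, h]
  fin_cases i <;> simp [upper, sub_eq_add_neg]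

theorem subst2_lower (s : ℂ) :
    subst2 (lower s) = aeval ![X 0, X 1 - C s * X 0] := by
  refine algHom_ext fun i => ?_
  have h : (lower s)⁻¹ = lower (-s) := by
    refine inv_eq_of_mul_eq_one_right (Subtype.ext ?_)
    change !![1, 0; s, 1] * !![1, 0; -s, 1] = (1 : Matrix (Fin 2) (Fin 2) ℂ)
    simp [Matrix.one_fin_two]
  rw [subst2, h]
  fin_cases i <;> simp [lower, sub_eq_add_neg, add_comm]

theorem coeffAct_upper {n : ℕ} (hn : n = 6 ∨ n = 4) (s : ℂ) (a : Fin (n + 1) → ℂ)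
    (i : Fin (n + 1)) : coeffAct (upper s) n a i =
      ∑ j : Fin (n + 1), ((n - j).choose (n - i) : ℂ) * (-s) ^ (i - j : ℕ) * a j := by
  suffices h : coeffAct (upper s) n a = fun i : Fin (n + 1) =>
      ∑ j : Fin (n + 1), ((n - j).choose (n - i) : ℂ) * (-s) ^ (i - j : ℕ) * a j from
    congrFun h i
  refine form_injective n ?_
  rw [form_coeffAct, subst2_upper]
  rcases hn with rfl | rfl
  · simp [form, Fin.sum_univ_succ, Nat.choose]
    ring
  · simp [form, Fin.sum_univ_succ, Nat.choose]
    ring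

theorem coeffAct_lower {n : ℕ} (hn : n = 6 ∨ n = 4) (s : ℂ) (a : Fin (n + 1) → ℂ)
    (i : Fin (n + 1)) : coeffAct (lower s) n a i =
      ∑ j : Fin (n + 1), ((j : ℕ).choose i : ℂ) * (-s) ^ (j - i : ℕ) * a j := by
  suffices h : coeffAct (lower s) n a = fun i : Fin (n + 1) =>
      ∑ j : Fin (n + 1), ((j : ℕ).choose i : ℂ) * (-s) ^ (j - i : ℕ) * a j from
    congrFun h i
  refine form_injective n ?_
  rw [form_coeffAct, subst2_lower]
  rcases hn with rfl | rfl
  · simp [form, Fin.sum_univ_succ, Nat.choose]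
    ring
  · simp [form, Fin.sum_univ_succ, Nat.choose]
    ring

/-- The covariant coordinate ring of a sextic and a quartic. -/
abbrev Ring64 : Type := CoordRing (![6, 4] : Fin 2 → ℕ)

/-- The coefficient variables among all variables. -/
def emb : Idx → Var (![6, 4] : Fin 2 → ℕ) :=
  Sum.elim (fun i => Sum.inl ⟨0, i⟩) (fun i => Sum.inl ⟨1, i⟩)

/-- Inclusion of functions of the coefficients. -/
def incl : MvPolynomial Idx ℂ →ₐ[ℂ] Ring64 := rename emb

theorem incl_X (i : Idx) : incl (X i) = X (emb i) := rename_X _ _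

theorem forall_var {P : Var (![6, 4] : Fin 2 → ℕ) → Prop} (h1 : ∀ i, P (emb i))
    (h2 : ∀ i, P (Sum.inr i)) (v) : P v := by
  rcases v with ⟨i, c⟩ | i
  · fin_cases i
    · exact h1 (Sum.inl c)
    · exact h1 (Sum.inr c)
  · exact h2 i

/-- Values on coefficients and on the coordinates of the variable, assembled to a function on
all variables. -/
def glue {T : Type} (f : Idx → T) (g : Fin 2 → T) : Var (![6, 4] : Fin 2 → ℕ) → T :=
  Sum.elim (fun c => match c with
    | ⟨0, i⟩ => f (Sum.inl i)
    | ⟨1, i⟩ => f (Sum.inr i)) g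

theorem glue_emb {T : Type} (f : Idx → T) (g : Fin 2 → T) (i : Idx) : glue f g (emb i) = f i := by
  rcases i with i | i <;> rfl

theorem glue_inr {T : Type} (f : Idx → T) (g : Fin 2 → T) (i : Fin 2) :
    glue f g (Sum.inr i) = g i := rfl

/-- Two derivations compatible on the variables along an algebra homomorphism are compatible. -/
theorem derivation_comp {σ : Type} {B : Type} [CommRing B] [Algebra ℂ B]
    (φ : MvPolynomial σ ℂ →ₐ[ℂ] B) (D : Derivation ℂ (MvPolynomial σ ℂ) (MvPolynomial σ ℂ))
    (D' : Derivation ℂ B B) (h : ∀ i, D' (φ (X i)) = φ (D (X i))) (p : MvPolynomial σ ℂ) :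
    D' (φ p) = φ (D p) := by
  induction p using MvPolynomial.induction_on with
  | C a => rw [algHom_C, Derivation.map_algebraMap, ← algebraMap_eq, Derivation.map_algebraMap,
      map_zero]
  | add p q hp hq => rw [map_add, map_add, hp, hq, map_add, map_add]
  | mul_X p i hp => simp only [map_mul, Derivation.leibniz, hp, h, smul_eq_mul, map_add]

/-- Infinitesimal generator of the upper unipotent group. -/
def dE : Derivation ℂ Ring64 Ring64 :=
  mkDerivation ℂ (glue (fun i => -incl (opE ℂ (X i))) ![X (Sum.inr 1), 0])

/-- Infinitesimal generator of the lower unipotent group. -/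
def dF : Derivation ℂ Ring64 Ring64 :=
  mkDerivation ℂ (glue (fun i => -incl (opF ℂ (X i))) ![0, X (Sum.inr 0)])

theorem dE_incl (p : MvPolynomial Idx ℂ) : dE (incl p) = -incl (opE ℂ p) := by
  have := derivation_comp incl (-opE ℂ) dE (fun i => by
    rw [incl_X, dE, mkDerivation_X, glue_emb, Derivation.neg_apply, map_neg]) p
  rw [this, Derivation.neg_apply, map_neg]

theorem dF_incl (p : MvPolynomial Idx ℂ) : dF (incl p) = -incl (opF ℂ p) := by
  have := derivation_comp incl (-opF ℂ) dF (fun i => by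
    rw [incl_X, dF, mkDerivation_X, glue_emb, Derivation.neg_apply, map_neg]) p
  rw [this, Derivation.neg_apply, map_neg]

/-- The leading coefficient of a covariant: its value at `x = (1, 0)`. -/
def lead : Ring64 →ₐ[ℂ] MvPolynomial Idx ℂ := aeval (glue X ![1, 0])

theorem lead_incl (p : MvPolynomial Idx ℂ) : lead (incl p) = p := by
  suffices h : lead.comp incl = AlgHom.id ℂ _ from DFunLike.congr_fun h p
  refine algHom_ext fun i => ?_
  rw [AlgHom.comp_apply, incl_X, lead, aeval_X, glue_emb, AlgHom.id_apply]

theorem lead_dE (p : Ring64) : lead (dE p) = -opE ℂ (lead p) := by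
  have := derivation_comp lead dE (-opE ℂ) (fun v => by
    induction v using forall_var with
    | h1 i => rw [← incl_X, lead_incl, dE_incl, map_neg, lead_incl, Derivation.neg_apply]
    | h2 i =>
      rw [dE, mkDerivation_X, lead, aeval_X, glue_inr, glue_inr, Derivation.neg_apply]
      fin_cases i <;> simp [glue_inr]) p
  rw [← this, Derivation.neg_apply]

/-- Derivative of a polynomial along a curve following a vector field. -/
theorem hasDerivAt_eval {σ : Type} (D : Derivation ℂ (MvPolynomial σ ℂ) (MvPolynomial σ ℂ))
    {γ : ℂ → σ → ℂ} {s : ℂ} (h : ∀ i, HasDerivAt (fun t => γ t i) (eval (γ s) (D (X i))) s)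
    (p : MvPolynomial σ ℂ) : HasDerivAt (fun t => eval (γ t) p) (eval (γ s) (D p)) s := by
  induction p using MvPolynomial.induction_on with
  | C a =>
    rw [← algebraMap_eq, Derivation.map_algebraMap]
    simpa [algebraMap_eq] using hasDerivAt_const s a
  | add p q hp hq => simpa using hp.fun_add hq
  | mul_X p i hp =>
    simp only [Derivation.leibniz, smul_eq_mul, map_add, map_mul, eval_X]
    refine (hp.fun_mul (h i)).congr_deriv ?_
    ring

theorem hasDerivAt_neg_pow_sub (c : ℂ) (i j : ℕ) (s : ℂ) :
    HasDerivAt (fun t : ℂ => (-t) ^ (i - j) * c) (-((i - j : ℕ) : ℂ) * (-s) ^ (i - 1 - j) * c) s := by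
  refine (((hasDerivAt_neg s).fun_pow (i - j)).mul_const c).congr_deriv ?_
  rw [show i - j - 1 = i - 1 - j by omega]
  ring

theorem hasDerivAt_coeffAct_upper {n : ℕ} (hn : n = 6 ∨ n = 4) (a : Fin (n + 1) → ℂ) (s : ℂ)
    (i : ℕ) (hi : i + 1 < n + 1) :
    HasDerivAt (fun t => coeffAct (upper t) n a ⟨i + 1, hi⟩)
      (-((n - i : ℕ) : ℂ) * coeffAct (upper s) n a ⟨i, by omega⟩) s := by
  simp only [coeffAct_upper hn]
  rw [Finset.mul_sum]
  refine HasDerivAt.fun_sum fun j _ => ?_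
  have := (hasDerivAt_neg_pow_sub (a j) (i + 1) j s).const_mul
    (((n - j : ℕ).choose (n - (i + 1)) : ℕ) : ℂ)
  simp only [Nat.add_sub_cancel] at this
  simp only [mul_assoc]
  refine this.congr_deriv ?_
  have h1 := Nat.choose_succ_right_eq (n - j) (n - (i + 1))
  rw [show n - (i + 1) + 1 = n - i by omega] at h1
  have h2 : (n - j).choose (n - (i + 1)) * (n - j - (n - (i + 1))) =
      (n - j).choose (n - (i + 1)) * (i + 1 - j) := by
    rcases le_or_gt (j : ℕ) (i + 1) with h | h
    · rw [show n - j - (n - (i + 1)) = i + 1 - j by omega]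
    · rw [Nat.choose_eq_zero_of_lt (by omega), zero_mul, zero_mul]
  rw [h2] at h1
  have h3 := congrArg (Nat.cast : ℕ → ℂ) h1
  push_cast at h3
  linear_combination ((-s) ^ (i - j : ℕ) * a j) * h3

theorem hasDerivAt_coeffAct_upper_zero {n : ℕ} (hn : n = 6 ∨ n = 4) (a : Fin (n + 1) → ℂ) (s : ℂ) :
    HasDerivAt (fun t => coeffAct (upper t) n a 0) 0 s := by
  simp only [coeffAct_upper hn, Fin.val_zero, Nat.zero_sub, pow_zero]
  exact hasDerivAt_const _ _

theorem hasDerivAt_coeffAct_lower {n : ℕ} (hn : n = 6 ∨ n = 4) (a : Fin (n + 1) → ℂ) (s : ℂ)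
    (i : ℕ) (hi : i + 1 < n + 1) :
    HasDerivAt (fun t => coeffAct (lower t) n a ⟨i, by omega⟩)
      (-((i + 1 : ℕ) : ℂ) * coeffAct (lower s) n a ⟨i + 1, hi⟩) s := by
  simp only [coeffAct_lower hn]
  rw [Finset.mul_sum]
  refine HasDerivAt.fun_sum fun j _ => ?_
  have := (hasDerivAt_neg_pow_sub (a j) j i s).const_mul (((j : ℕ).choose i : ℕ) : ℂ)
  simp only [show (j : ℕ) - 1 - i = j - (i + 1) by omega] at this
  simp only [mul_assoc]
  refine this.congr_deriv ?_
  have h3 := congrArg (Nat.cast : ℕ → ℂ) (Nat.choose_succ_right_eq (j : ℕ) i)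
  push_cast at h3
  push_cast
  linear_combination ((-s) ^ (j - (i + 1) : ℕ) * a j) * h3

theorem hasDerivAt_coeffAct_lower_last {n : ℕ} (hn : n = 6 ∨ n = 4) (a : Fin (n + 1) → ℂ) (s : ℂ) :
    HasDerivAt (fun t => coeffAct (lower t) n a (Fin.last n)) 0 s := by
  simp only [coeffAct_lower hn, Fin.val_last]
  have h : ∀ (t : ℂ) (j : Fin (n + 1)), (-t) ^ ((j : ℕ) - n) = 1 := fun t j => by
    rw [Nat.sub_eq_zero_of_le (by omega), pow_zero]
  simp only [h]
  exact hasDerivAt_const _ _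

theorem ptAct_inl (g : SL2) (pt : Var (![6, 4] : Fin 2 → ℕ) → ℂ) (i : Fin 7) :
    ptAct ![6, 4] g pt (emb (Sum.inl i)) = coeffAct g 6 (fun k => pt (emb (Sum.inl k))) i := rfl

theorem ptAct_inr (g : SL2) (pt : Var (![6, 4] : Fin 2 → ℕ) → ℂ) (i : Fin 5) :
    ptAct ![6, 4] g pt (emb (Sum.inr i)) = coeffAct g 4 (fun k => pt (emb (Sum.inr k))) i := rfl

theorem ptAct_coord (g : SL2) (pt : Var (![6, 4] : Fin 2 → ℕ) → ℂ) (i : Fin 2) :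
    ptAct ![6, 4] g pt (Sum.inr i) =
      g.1 i 0 * pt (Sum.inr 0) + g.1 i 1 * pt (Sum.inr 1) := by
  simp [ptAct, Fin.sum_univ_two]

theorem dE_emb (i : Idx) : dE (X (emb i)) = -incl (opE ℂ (X i)) := by
  rw [← incl_X, dE_incl]

theorem dF_emb (i : Idx) : dF (X (emb i)) = -incl (opF ℂ (X i)) := by
  rw [← incl_X, dF_incl]

theorem hasDerivAt_upper (pt : Var (![6, 4] : Fin 2 → ℕ) → ℂ) (s : ℂ) (v) :
    HasDerivAt (fun t => ptAct ![6, 4] (upper t) pt v)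
      (eval (ptAct ![6, 4] (upper s) pt) (dE (X v))) s := by
  induction v using forall_var with
  | h1 i =>
    rw [dE_emb]
    rcases i with ⟨i, hi⟩ | ⟨i, hi⟩
    · simp only [ptAct_inl]
      cases i with
      | zero =>
        have h : opE ℂ (X (Sum.inl ⟨0, hi⟩)) = 0 := by
          rw [← (isStr_ca ℂ).E_zero]; simp [ca]
        rw [h, map_zero, neg_zero, map_zero]
        exact hasDerivAt_coeffAct_upper_zero (Or.inl rfl) _ s
      | succ i =>
        have h := (isStr_ca ℂ).E_succ i
        rw [ca, dif_pos hi, ca, dif_pos (by omega : i < 7),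
          show ((6 : ℕ) : ℤ) - i = ((6 - i : ℕ) : ℤ) by omega, Int.cast_natCast] at h
        refine (hasDerivAt_coeffAct_upper (Or.inl rfl) _ s i hi).congr_deriv ?_
        rw [h, map_neg, map_mul, map_mul, incl_X, eval_X, ptAct_inl,
          map_natCast, map_natCast, neg_mul]
    · simp only [ptAct_inr]
      cases i with
      | zero =>
        have h : opE ℂ (X (Sum.inr ⟨0, hi⟩)) = 0 := by
          rw [← (isStr_cb ℂ).E_zero]; simp [cb]
        rw [h, map_zero, neg_zero, map_zero]
        exact hasDerivAt_coeffAct_upper_zero (Or.inr rfl) _ s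
      | succ i =>
        have h := (isStr_cb ℂ).E_succ i
        rw [cb, dif_pos hi, cb, dif_pos (by omega : i < 5),
          show ((4 : ℕ) : ℤ) - i = ((4 - i : ℕ) : ℤ) by omega, Int.cast_natCast] at h
        refine (hasDerivAt_coeffAct_upper (Or.inr rfl) _ s i hi).congr_deriv ?_
        rw [h, map_neg, map_mul, map_mul, incl_X, eval_X, ptAct_inr,
          map_natCast, map_natCast, neg_mul]
  | h2 i =>
    have e0 : ∀ t, ptAct ![6, 4] (upper t) pt (Sum.inr 0) =
        pt (Sum.inr 0) + t * pt (Sum.inr 1) := fun t => by rw [ptAct_coord]; simp [upper]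
    have e1 : ∀ t, ptAct ![6, 4] (upper t) pt (Sum.inr 1) = pt (Sum.inr 1) := fun t => by
      rw [ptAct_coord]; simp [upper]
    simp only [dE, mkDerivation_X, glue_inr]
    fin_cases i
    · simpa [e0, e1] using
        ((hasDerivAt_id s).mul_const (pt (Sum.inr 1))).const_add (pt (Sum.inr 0))
    · simpa [e1] using hasDerivAt_const s (pt (Sum.inr 1))

theorem hasDerivAt_lower (pt : Var (![6, 4] : Fin 2 → ℕ) → ℂ) (s : ℂ) (v) :
    HasDerivAt (fun t => ptAct ![6, 4] (lower t) pt v)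
      (eval (ptAct ![6, 4] (lower s) pt) (dF (X v))) s := by
  induction v using forall_var with
  | h1 i =>
    rw [dF_emb]
    rcases i with ⟨i, hi⟩ | ⟨i, hi⟩
    · simp only [ptAct_inl]
      have h := (isStr_ca ℂ).F_eq i
      by_cases h6 : i + 1 < 7
      · rw [ca, dif_pos hi, ca, dif_pos h6] at h
        refine (hasDerivAt_coeffAct_lower (Or.inl rfl) _ s i h6).congr_deriv ?_
        rw [h, map_neg, map_mul, map_mul, incl_X, eval_X, ptAct_inl,
          map_natCast, map_natCast, neg_mul]
      · obtain rfl : i = 6 := by omega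
        rw [ca, dif_pos hi, ca, dif_neg h6, mul_zero] at h
        rw [h, map_zero, neg_zero, map_zero]
        exact hasDerivAt_coeffAct_lower_last (Or.inl rfl) _ s
    · simp only [ptAct_inr]
      have h := (isStr_cb ℂ).F_eq i
      by_cases h6 : i + 1 < 5
      · rw [cb, dif_pos hi, cb, dif_pos h6] at h
        refine (hasDerivAt_coeffAct_lower (Or.inr rfl) _ s i h6).congr_deriv ?_
        rw [h, map_neg, map_mul, map_mul, incl_X, eval_X, ptAct_inr,
          map_natCast, map_natCast, neg_mul]
      · obtain rfl : i = 4 := by omega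
        rw [cb, dif_pos hi, cb, dif_neg h6, mul_zero] at h
        rw [h, map_zero, neg_zero, map_zero]
        exact hasDerivAt_coeffAct_lower_last (Or.inr rfl) _ s
  | h2 i =>
    have e0 : ∀ t, ptAct ![6, 4] (lower t) pt (Sum.inr 0) = pt (Sum.inr 0) := fun t => by
      rw [ptAct_coord]; simp [lower]
    have e1 : ∀ t, ptAct ![6, 4] (lower t) pt (Sum.inr 1) =
        t * pt (Sum.inr 0) + pt (Sum.inr 1) := fun t => by rw [ptAct_coord]; simp [lower]
    simp only [dF, mkDerivation_X, glue_inr]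
    fin_cases i
    · simpa [e0] using hasDerivAt_const s (pt (Sum.inr 0))
    · simpa [e0, e1] using
        ((hasDerivAt_id s).mul_const (pt (Sum.inr 0))).add_const (pt (Sum.inr 1))

theorem subst2_one (p : MvPolynomial (Fin 2) ℂ) : subst2 1 p = p := by
  suffices h : subst2 1 = AlgHom.id ℂ _ from DFunLike.congr_fun h p
  refine algHom_ext fun i => ?_
  fin_cases i <;> simp [subst2]

theorem ptAct_one {ι : Type} (ν : ι → ℕ) (pt : Var ν → ℂ) : ptAct ν 1 pt = pt := by
  ext (c | i)
  · simp only [ptAct, Sum.elim_inl, coeffAct, subst2_one, coeffOf_form]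
  · fin_cases i <;> simp [ptAct]

theorem upper_zero : upper 0 = 1 := Subtype.ext (by simp [upper, Matrix.one_fin_two])

theorem lower_zero : lower 0 = 1 := Subtype.ext (by simp [lower, Matrix.one_fin_two])

theorem dE_eq_zero {p : Ring64} (hp : p ∈ Covariants ![6, 4]) : dE p = 0 := by
  refine MvPolynomial.funext fun pt => ?_
  have h := hasDerivAt_eval dE (hasDerivAt_upper pt 0) p
  simp only [hp (upper _) pt] at h
  rw [upper_zero, ptAct_one] at h
  rw [map_zero]
  exact h.unique (hasDerivAt_const _ _)

/-- A polynomial killed by both infinitesimal generators is a covariant. -/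
theorem mem_covariants {p : Ring64} (hE : dE p = 0) (hF : dF p = 0) : p ∈ Covariants ![6, 4] := by
  have hU : ∀ s pt, eval (ptAct ![6, 4] (upper s) pt) p = eval pt p := by
    intro s pt
    have h := fun t => hasDerivAt_eval dE (hasDerivAt_upper pt t) p
    simp only [hE, map_zero] at h
    have := is_const_of_deriv_eq_zero (fun t => (h t).differentiableAt) (fun t => (h t).deriv) s 0
    rwa [upper_zero, ptAct_one] at this
  have hL : ∀ s pt, eval (ptAct ![6, 4] (lower s) pt) p = eval pt p := by
    intro s pt
    have h := fun t => hasDerivAt_eval dF (hasDerivAt_lower pt t) p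
    simp only [hF, map_zero] at h
    have := is_const_of_deriv_eq_zero (fun t => (h t).differentiableAt) (fun t => (h t).deriv) s 0
    rwa [lower_zero, ptAct_one] at this
  have key : ∀ (g : SL2), g.1 1 0 ≠ 0 → ∀ pt, eval (ptAct ![6, 4] g pt) p = eval pt p := by
    intro g hg pt
    have hd := g.2
    rw [Matrix.det_fin_two] at hd
    have h : g = upper ((g.1 0 0 - 1) / g.1 1 0) * (lower (g.1 1 0) *
        upper ((g.1 1 1 - 1) / g.1 1 0)) := by
      refine Subtype.ext ?_
      change g.1 = !![1, (g.1 0 0 - 1) / g.1 1 0; 0, 1] * (!![1, 0; g.1 1 0, 1] *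
        !![1, (g.1 1 1 - 1) / g.1 1 0; 0, 1])
      ext i j
      fin_cases i <;> fin_cases j <;> simp [Matrix.mul_apply, Fin.sum_univ_two] <;> field_simp
      · ring
      · linear_combination -hd
      · ring
    rw [h, ptAct_mul, ptAct_mul, hU, hL, hU]
  intro g pt
  by_cases hg : g.1 1 0 = 0
  · have hd := g.2
    rw [Matrix.det_fin_two, hg, mul_zero, sub_zero] at hd
    have h1 : (lower 1 * g).1 1 0 ≠ 0 := by
      change ((!![1, 0; 1, 1] : Matrix (Fin 2) (Fin 2) ℂ) * g.1) 1 0 ≠ 0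
      simp only [Matrix.mul_apply, Fin.sum_univ_two]
      simp only [hg]
      simpa using left_ne_zero_of_mul_eq_one hd
    have h2 := key _ h1 pt
    rwa [ptAct_mul, hL] at h2
  · exact key g hg pt

theorem opE_lead {p : Ring64} (hp : p ∈ Covariants ![6, 4]) : opE ℂ (lead p) = 0 := by
  have h := lead_dE p
  rw [dE_eq_zero hp, map_zero] at h
  exact neg_eq_zero.mp h.symm

theorem eval_lead (p : Ring64) (a : Idx → ℂ) : eval a (lead p) = eval (glue a ![1, 0]) p := by
  suffices h : (aeval a).comp lead = aeval (R := ℂ) (glue a ![1, 0]) by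
    have := DFunLike.congr_fun h p
    rwa [AlgHom.comp_apply, aeval_eq_eval, aeval_eq_eval] at this
  refine algHom_ext fun v => ?_
  rw [AlgHom.comp_apply, lead, aeval_X, aeval_X]
  induction v using forall_var with
  | h1 i => rw [glue_emb, glue_emb, aeval_X]
  | h2 i => rw [glue_inr, glue_inr]; fin_cases i <;> simp

theorem exists_ptAct_eq (pt : Var (![6, 4] : Fin 2 → ℕ) → ℂ) (h : pt (Sum.inr 0) ≠ 0) :
    ∃ (g : SL2) (a : Idx → ℂ), ptAct ![6, 4] g pt = glue a ![1, 0] := by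
  let g : SL2 := ⟨!![(pt (Sum.inr 0))⁻¹, 0; -pt (Sum.inr 1), pt (Sum.inr 0)], by
    rw [Matrix.det_fin_two_of]; field_simp; ring⟩
  refine ⟨g, fun i => ptAct ![6, 4] g pt (emb i), ?_⟩
  ext v
  induction v using forall_var with
  | h1 i => rw [glue_emb]
  | h2 i =>
    rw [glue_inr, ptAct_coord]
    fin_cases i
    · simp [g, h]
    · simp [g, mul_comm]

theorem eq_zero_of_lead {p : Ring64} (hp : p ∈ Covariants ![6, 4]) (h : lead p = 0) : p = 0 := by
  have h1 : p * X (Sum.inr 0) = 0 := by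
    refine MvPolynomial.funext fun pt => ?_
    rw [map_mul, eval_X, map_zero]
    by_cases hx : pt (Sum.inr 0) = 0
    · rw [hx, mul_zero]
    · obtain ⟨g, a, hg⟩ := exists_ptAct_eq pt hx
      rw [← hp g pt, hg, ← eval_lead, h, map_zero, zero_mul]
  exact (mul_eq_zero.mp h1).resolve_right (X_ne_zero _)

theorem constantCoeff_lead {p : Ring64} (hp : p ∈ Covariants ![6, 4]) :
    constantCoeff (lead p) = constantCoeff p := by
  let r : Polynomial ℂ := aeval (glue 0 ![Polynomial.X, 0]) p
  have hr : ∀ t, r.eval t = eval (glue 0 ![t, 0]) p := by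
    intro t
    suffices h : (Polynomial.aeval t).comp (aeval (glue 0 ![Polynomial.X, 0])) =
        aeval (R := ℂ) (glue 0 ![t, 0]) by
      have := DFunLike.congr_fun h p
      rwa [AlgHom.comp_apply, aeval_eq_eval, Polynomial.coe_aeval_eq_eval] at this
    refine algHom_ext fun v => ?_
    rw [AlgHom.comp_apply, aeval_X, aeval_X]
    induction v using forall_var with
    | h1 i => rw [glue_emb, glue_emb, Pi.zero_apply, Pi.zero_apply, map_zero]
    | h2 i => rw [glue_inr, glue_inr]; fin_cases i <;> simp
  have h1 : ∀ t, t ≠ 0 → r.eval t = r.eval 1 := by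
    intro t ht
    let g : SL2 := ⟨!![t, 0; 0, t⁻¹], by rw [Matrix.det_fin_two_of]; field_simp; ring⟩
    rw [hr, hr, ← hp g (glue 0 ![1, 0])]
    refine congrArg (fun f => eval f p) ?_
    ext v
    induction v using forall_var with
    | h1 i =>
      have : ∀ n, coeffAct g n 0 = 0 := fun n => by
        refine form_injective n ?_
        have h0 : form n 0 = 0 := by simp [form]
        rw [form_coeffAct, h0, map_zero]
      rcases i with i | i
      · rw [ptAct_inl, glue_emb]
        simp only [glue_emb]
        exact (congrFun (this 6) i).symm
      · rw [ptAct_inr, glue_emb]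
        simp only [glue_emb]
        exact (congrFun (this 4) i).symm
    | h2 i =>
      rw [ptAct_coord, glue_inr, glue_inr, glue_inr]
      fin_cases i <;> simp [g]
  have h2 : (r - Polynomial.C (r.eval 1)) * Polynomial.X = 0 := by
    refine Polynomial.funext fun t => ?_
    by_cases ht : t = 0
    · simp [ht]
    · simp [h1 t ht]
  have h3 := (mul_eq_zero.mp h2).resolve_right Polynomial.X_ne_zero
  have h4 := congrArg (Polynomial.eval 0) h3
  rw [Polynomial.eval_sub, Polynomial.eval_C, Polynomial.eval_zero, sub_eq_zero, hr, hr] at h4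
  have h5 : glue 0 ![(0 : ℂ), 0] = 0 := by
    ext v
    induction v using forall_var with
    | h1 i => rw [glue_emb]; rfl
    | h2 i => rw [glue_inr]; fin_cases i <;> rfl
  rw [← eval_zero, ← eval_zero, eval_lead]
  rw [h5] at h4
  exact h4.symm

/-- The covariant with a given leading coefficient. -/
def liftCov (k : ℕ) (y : MvPolynomial Idx ℂ) : Ring64 :=
  ∑ j ∈ Finset.range (k + 1), incl (strOf y j) * (X (Sum.inr 0) ^ (k - j) * X (Sum.inr 1) ^ j)

theorem lead_liftCov (k : ℕ) (y : MvPolynomial Idx ℂ) : lead (liftCov k y) = y := by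
  unfold liftCov
  rw [map_sum, Finset.sum_eq_single 0]
  · rw [map_mul, lead_incl, strOf_zero]
    simp [lead, glue_inr]
  · intro j _ hj
    rw [map_mul, map_mul, map_pow, map_pow, lead, aeval_X, aeval_X, glue_inr, glue_inr]
    simp [hj]
  · simp

theorem dE_coord (m j : ℕ) : dE (X (Sum.inr 0) ^ m * X (Sum.inr 1) ^ j) =
    (m : Ring64) * (X (Sum.inr 0) ^ (m - 1) * X (Sum.inr 1) ^ (j + 1)) := by
  have h0 : dE (X (Sum.inr 0)) = X (Sum.inr 1) := by rw [dE, mkDerivation_X, glue_inr]; rfl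
  have h1 : dE (X (Sum.inr 1)) = 0 := by rw [dE, mkDerivation_X, glue_inr]; rfl
  rw [Derivation.leibniz, Derivation.leibniz_pow, Derivation.leibniz_pow, h0, h1]
  simp only [smul_eq_mul, nsmul_eq_mul]
  ring

theorem dF_coord (m j : ℕ) : dF (X (Sum.inr 0) ^ m * X (Sum.inr 1) ^ j) =
    (j : Ring64) * (X (Sum.inr 0) ^ (m + 1) * X (Sum.inr 1) ^ (j - 1)) := by
  have h0 : dF (X (Sum.inr 0)) = 0 := by rw [dF, mkDerivation_X, glue_inr]; rfl
  have h1 : dF (X (Sum.inr 1)) = X (Sum.inr 0) := by rw [dF, mkDerivation_X, glue_inr]; rfl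
  rw [Derivation.leibniz, Derivation.leibniz_pow, Derivation.leibniz_pow, h0, h1]
  simp only [smul_eq_mul, nsmul_eq_mul]
  ring

theorem liftCov_mem {d₁ d₂ k : ℕ} {y : MvPolynomial Idx ℂ} (hy : y ∈ Ssp d₁ d₂ k) :
    liftCov k y ∈ Covariants ![6, 4] := by
  have hs := isStr_strOf hy
  refine mem_covariants ?_ ?_
  · have h1 : ∀ j ∈ Finset.range (k + 1), dE (incl (strOf y j) *
        (X (Sum.inr 0) ^ (k - j) * X (Sum.inr 1) ^ j)) =
        ((k - j : ℕ) : Ring64) * (incl (strOf y j) * (X (Sum.inr 0) ^ (k - (j + 1)) *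
          X (Sum.inr 1) ^ (j + 1))) -
        incl (opE ℂ (strOf y j)) * (X (Sum.inr 0) ^ (k - j) * X (Sum.inr 1) ^ j) := by
      intro j _
      rw [Derivation.leibniz, dE_coord, dE_incl, Nat.sub_sub]
      simp only [smul_eq_mul]
      ring
    unfold liftCov
    rw [map_sum, Finset.sum_congr rfl h1, Finset.sum_sub_distrib, Finset.sum_range_succ,
      Finset.sum_range_succ' _ k, hs.E_zero]
    simp only [Nat.sub_self, Nat.cast_zero, zero_mul, add_zero, map_zero]
    rw [sub_eq_zero]
    refine Finset.sum_congr rfl fun j hj => ?_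
    have hj := Finset.mem_range.mp hj
    rw [hs.E_succ, show (k : ℤ) - j = ((k - j : ℕ) : ℤ) by omega, Int.cast_natCast, map_mul,
      map_natCast, mul_assoc]
  · have h1 : ∀ j ∈ Finset.range (k + 1), dF (incl (strOf y j) *
        (X (Sum.inr 0) ^ (k - j) * X (Sum.inr 1) ^ j)) =
        (j : Ring64) * (incl (strOf y j) * (X (Sum.inr 0) ^ (k - j + 1) *
          X (Sum.inr 1) ^ (j - 1))) -
        ((j + 1 : ℕ) : Ring64) * (incl (strOf y (j + 1)) *
          (X (Sum.inr 0) ^ (k - j) * X (Sum.inr 1) ^ j)) := by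
      intro j _
      rw [Derivation.leibniz, dF_coord, dF_incl, strOf_F, map_mul, map_natCast]
      simp only [smul_eq_mul]
      ring
    unfold liftCov
    rw [map_sum, Finset.sum_congr rfl h1, Finset.sum_sub_distrib, Finset.sum_range_succ',
      Finset.sum_range_succ _ k, hs.zero (k + 1) (by omega)]
    simp only [Nat.cast_zero, zero_mul, add_zero, map_zero, mul_zero]
    rw [sub_eq_zero]
    refine Finset.sum_congr rfl fun j hj => ?_
    have hj := Finset.mem_range.mp hj
    rw [show k - (j + 1) + 1 = k - j by omega, Nat.add_sub_cancel]

theorem isWH_incl {d₁ d₂ : ℕ} {h : ℤ} {p : MvPolynomial Idx ℂ} (hp : p ∈ Wsp d₁ d₂ h) :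
    (incl p).IsWeightedHomogeneous (wBi ![6, 4]) (d₁ + d₂, 0) := by
  have hp := mem_Wsp.mp hp
  let f : Deg →+ ℕ × ℕ :=
    { toFun := fun d => (d.1 + d.2.1, 0)
      map_zero' := rfl
      map_add' := fun x y => by
        simp only [Prod.fst_add, Prod.snd_add, Prod.mk_add_mk, add_zero]
        rw [add_add_add_comm] }
  have hf : ∀ i, wBi ![6, 4] (emb i) = f (wt i) := by rintro (i | i) <;> rfl
  rw [← mem_weightedHomogeneousSubmodule, p.as_sum, map_sum]
  refine sum_mem fun s hs => ?_
  rw [mem_weightedHomogeneousSubmodule, incl, rename_monomial]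
  refine isWeightedHomogeneous_monomial _ _ _ ?_
  have h1 := congrArg f (hp (mem_support_iff.mp hs))
  rw [Finsupp.weight_apply, map_finsuppSum] at h1
  rw [Finsupp.weight_apply, Finsupp.sum_mapDomain_index (by simp) (fun _ _ _ => add_smul _ _ _)]
  simp only [hf, ← map_nsmul]
  exact h1

theorem isWH_liftCov {d₁ d₂ k : ℕ} {y : MvPolynomial Idx ℂ} (hy : y ∈ Ssp d₁ d₂ k) :
    (liftCov k y).IsWeightedHomogeneous (wBi ![6, 4]) (d₁ + d₂, k) := by
  rw [← mem_weightedHomogeneousSubmodule]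
  refine sum_mem fun j hj => ?_
  have hj := Finset.mem_range.mp hj
  have h0 := (isWeightedHomogeneous_X ℂ (wBi ![6, 4]) (Sum.inr 0)).pow (k - j)
  have h1 := (isWeightedHomogeneous_X ℂ (wBi ![6, 4]) (Sum.inr 1)).pow j
  have := (isWH_incl (strOf_mem hy.1 j)).mul (h0.mul h1)
  rw [mem_weightedHomogeneousSubmodule]
  convert this using 1
  simp [wBi]
  omega

/-- The generating covariants. -/
def covGen (i : Fin 194) : Covariants (![6, 4] : Fin 2 → ℕ) :=
  ⟨liftCov (dgam i).2.2 (gam i), liftCov_mem (gam_mem i)⟩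

/-- The leading coefficient on the algebra of covariants. -/
def leadCov : Covariants (![6, 4] : Fin 2 → ℕ) →ₐ[ℂ] MvPolynomial Idx ℂ :=
  lead.comp (Covariants _).val

theorem leadCov_covGen (i : Fin 194) : leadCov (covGen i) = gam i := lead_liftCov _ _

theorem leadCov_injective : Function.Injective leadCov := by
  rw [injective_iff_map_eq_zero]
  exact fun p hp => Subtype.ext (eq_zero_of_lead p.2 hp)

theorem leadCov_mem_monSpan {p : Covariants (![6, 4] : Fin 2 → ℕ)} (hp : p ∈ Cplus ![6, 4]) :
    leadCov p ∈ monSpan 1 := by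
  refine mem_monSpan_of_ker (opE_lead p.2) ?_
  change constantCoeff (lead p) = 0
  rw [constantCoeff_lead p.2]
  unfold Cplus at hp
  induction hp using Submodule.span_induction with
  | mem p hp =>
    obtain ⟨d, k, hdk, h⟩ := hp
    by_contra h0
    have := h h0
    rw [map_zero] at this
    simp only [Prod.ext_iff, Prod.fst_zero, Prod.snd_zero] at this
    omega
  | zero => exact map_zero _
  | add p q _ _ hp hq =>
    change constantCoeff ((p : Ring64) + (q : Ring64)) = 0
    rw [map_add, hp, hq, add_zero]
  | smul c p _ hp =>
    change constantCoeff (c • (p : Ring64)) = 0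
    rw [smul_eq_C_mul, map_mul, hp, mul_zero]

theorem covGen_isHom (i : Fin 194) : ∃ d k : ℕ, 0 < d + k ∧
    (covGen i : Ring64).IsWeightedHomogeneous (wBi ![6, 4]) (d, k) :=
  ⟨(dgam i).1 + (dgam i).2.1, (dgam i).2.2, by have := dgam_pos i; omega, isWH_liftCov (gam_mem i)⟩

theorem covGen_mem (i : Fin 194) : covGen i ∈ Cplus ![6, 4] :=
  Submodule.subset_span (covGen_isHom i)

theorem leadCov_mem_monSpan_two {p : Covariants (![6, 4] : Fin 2 → ℕ)}
    (hp : p ∈ CplusSq ![6, 4]) : leadCov p ∈ monSpan 2 := by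
  have : CplusSq ![6, 4] ≤ (monSpan 2).comap leadCov.toLinearMap := by
    unfold CplusSq
    rw [Submodule.span_le]
    rintro _ ⟨x, hx, y, hy, rfl⟩
    change leadCov (x * y) ∈ monSpan 2
    rw [map_mul]
    exact monSpan_mul 1 1 (Submodule.mul_mem_mul (leadCov_mem_monSpan hx) (leadCov_mem_monSpan hy))
  exact this hp

theorem mul_mem_Cplus {x y : Covariants (![6, 4] : Fin 2 → ℕ)} (hx : x ∈ Cplus ![6, 4])
    (hy : y ∈ Cplus ![6, 4]) : x * y ∈ Cplus ![6, 4] := by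
  suffices h : Cplus (![6, 4] : Fin 2 → ℕ) * Cplus ![6, 4] ≤ Cplus ![6, 4] from
    h (Submodule.mul_mem_mul hx hy)
  unfold Cplus
  rw [Submodule.span_mul_span]
  refine Submodule.span_mono ?_
  rintro _ ⟨x, ⟨d, k, h, hx⟩, y, ⟨d', k', h', hy⟩, rfl⟩
  exact ⟨d + d', k + k', by omega, hx.mul hy⟩

theorem prod_covGen_mem (s : Multiset (Fin 194)) (hs : s ≠ 0) :
    (s.map covGen).prod ∈ Cplus ![6, 4] ∧
    (s.map covGen).prod ∈ Submodule.span ℂ (Set.range covGen) ⊔ CplusSq ![6, 4] := by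
  induction s using Multiset.induction_on with
  | empty => exact absurd rfl hs
  | cons i t ih =>
    rw [Multiset.map_cons, Multiset.prod_cons]
    by_cases ht : t = 0
    · rw [ht, Multiset.map_zero, Multiset.prod_zero, mul_one]
      exact ⟨covGen_mem i, Submodule.mem_sup_left (Submodule.subset_span ⟨i, rfl⟩)⟩
    · exact ⟨mul_mem_Cplus (covGen_mem i) (ih ht).1, Submodule.mem_sup_right
        (Submodule.subset_span ⟨_, covGen_mem i, _, (ih ht).1, rfl⟩)⟩

theorem Cplus_le : Cplus ![6, 4] ≤ Submodule.span ℂ (Set.range covGen) ⊔ CplusSq ![6, 4] := by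
  intro p hp
  have h1 : monSpan 1 ≤ (Submodule.span ℂ (Set.range covGen) ⊔ CplusSq ![6, 4]).map
      leadCov.toLinearMap := by
    unfold monSpan
    rw [Submodule.span_le]
    rintro _ ⟨s, hs, rfl⟩
    refine ⟨_, (prod_covGen_mem s ?_).2, ?_⟩
    · rintro rfl
      exact absurd hs (by simp)
    · change leadCov _ = _
      rw [map_multiset_prod, Multiset.map_map, gamMon]
      simp only [Function.comp_def, leadCov_covGen]
  obtain ⟨q, hq, h⟩ := h1 (leadCov_mem_monSpan hp)
  exact leadCov_injective h ▸ hq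

theorem covGen_linearIndependent :
    LinearIndependent ℂ fun i => (CplusSq ![6, 4]).mkQ (covGen i) := by
  rw [Fintype.linearIndependent_iff]
  intro c hc
  simp only [← map_smul, ← map_sum] at hc
  rw [Submodule.mkQ_apply, Submodule.Quotient.mk_eq_zero] at hc
  have h := leadCov_mem_monSpan_two hc
  rw [map_sum] at h
  simp only [map_smul, leadCov_covGen] at h
  exact gam_independent h

theorem span_covGen : Submodule.span ℂ (Set.range fun i => (CplusSq ![6, 4]).mkQ (covGen i)) =
    (Cplus ![6, 4]).map (CplusSq ![6, 4]).mkQ := by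
  refine le_antisymm ?_ ?_
  · rw [Submodule.span_le]
    rintro _ ⟨i, rfl⟩
    exact Submodule.mem_map_of_mem (covGen_mem i)
  · refine (Submodule.map_mono Cplus_le).trans ?_
    rw [Submodule.map_sup, Submodule.mkQ_map_self, sup_bot_eq, Submodule.map_span,
      ← Set.range_comp]
    rfl

/-- **Minimal covariant basis of `S₆ ⊕ S₄`.** For `V = S₆ ⊕ S₄`, the covariant
algebra `Cov(V)` admits a minimal basis consisting of exactly `194` homogeneous
covariants; equivalently, `dim_ℂ (C₊ / C₊²) = 194`, where `C₊` is the ideal of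
`Cov(V)` spanned by the homogeneous components of positive total degree. -/
theorem minimal_covariant_basis_S6_S4 :
    (∃ B : Fin 194 → ↥(Covariants (![6, 4] : Fin 2 → ℕ)),
      IsMinimalBasis (![6, 4] : Fin 2 → ℕ) B) ∧
    Module.finrank ℂ
      ↥((Cplus (![6, 4] : Fin 2 → ℕ)).map (CplusSq (![6, 4] : Fin 2 → ℕ)).mkQ)
      = 194 := by
  refine ⟨⟨covGen, covGen_isHom, covGen_linearIndependent, span_covGen⟩, ?_⟩
  rw [← span_covGen, finrank_span_eq_card covGen_linearIndependent, Fintype.card_fin]
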